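/- For every ε > 0 there is a constant C(ε) such that for all positive integers q, l with gcd(l, q) = 1, all real A, B and all reals K, L ≥ 1: |N_{A,B}(K, L) − φ(q)·K·L/q²| ≤ C(ε)·((K + L)/q^{1/2−ε} + q^{1/2+ε}), where N_{A,B}(K, L) := #{(a, b) ∈ ℤ² : a²b³ ≡ l (mod q), A < a ≤ A+K, B < b ≤ B+L}. -/

import Mathlib

/-- `N_{A,B}(K, L)`: the number of integer points `(a, b)` with `a²b³ ≡ l (mod q)`,
`A < a ≤ A + K`, `B < b ≤ B + L`. -/
noncomputable def NAB (q : ℕ) (l : ℤ) (A B K L : ℝ) : ℕ :=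
  Nat.card {ab : ℤ × ℤ // (q : ℤ) ∣ ab.1 ^ 2 * ab.2 ^ 3 - l ∧
    A < ab.1 ∧ (ab.1 : ℝ) ≤ A + K ∧ B < ab.2 ∧ (ab.2 : ℝ) ≤ B + L}

section

open Polynomial

universe u

/-- A finite field's rational function field has a place at infinity, which extends to any
plane curve monic in the second variable. -/
theorem exists_place_at_infinity (F : Type u) [Field F] [Finite F] (G : F[X][X])
    (hG : G.Monic) (hG0 : G.natDegree ≠ 0) :
    ∃ (L : Type u) (_ : Field L) (φ : F[X][X] →+* L) (Γ : Type u)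
      (_ : LinearOrderedCommGroupWithZero Γ) (v : Valuation L Γ),
      φ G = 0 ∧ 1 < v (φ (C X)) ∧ ∀ c : F, c ≠ 0 → v (φ (C (C c))) = 1 := by
  classical
  let L := AlgebraicClosure (RatFunc F)
  let i : F[X] →+* L := (algebraMap (RatFunc F) L).comp (algebraMap F[X] (RatFunc F))
  have hi : Function.Injective i :=
    (algebraMap (RatFunc F) L).injective.comp (RatFunc.algebraMap_injective F)
  obtain ⟨z, hz⟩ : ∃ z : L, eval₂ i z G = 0 := by
    have hd : (G.map i).degree ≠ 0 := by
      rw [hG.degree_map, degree_eq_natDegree hG.ne_zero]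
      exact_mod_cast hG0
    obtain ⟨z, hz⟩ := IsAlgClosed.exists_root (G.map i) hd
    exact ⟨z, by rwa [IsRoot.def, eval_map] at hz⟩
  obtain ⟨V, hV⟩ : ∃ V : ValuationSubring L, i X ∉ V := by
    by_contra! h
    let g : F →+* L := i.comp C
    have h1 : i X ∈ ⨅ V : {V : ValuationSubring L // (g.range : Set L) ⊆ V.toSubring},
        V.1.toSubring := by
      rw [Subring.mem_iInf]
      exact fun V => h V.1
    rw [iInf_valuationSubring_superset, Subring.closure_eq] at h1
    obtain ⟨P, hP, hP0⟩ : IsIntegral g.range (i X) := h1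
    obtain ⟨P', rfl⟩ := Polynomial.map_surjective g.rangeRestrict g.rangeRestrict_surjective P
    rw [eval₂_map] at hP0
    have h2 : i P' = 0 := by
      rw [← hP0, ← eval₂_C_X (p := P'), hom_eval₂]
      simp only [eval₂_C_X]
      rfl
    rw [map_eq_zero_iff i hi] at h2
    simp [h2] at hP
  refine ⟨L, inferInstance, eval₂RingHom i z, V.ValueGroup, inferInstance, V.valuation,
    by simpa using hz, ?_, ?_⟩
  · rw [← not_le, V.valuation_le_one_iff]
    simpa using hV
  · intro c hc
    have := Fintype.ofFinite F
    have h : V.valuation (i (C c)) ^ (Fintype.card F - 1) = 1 := by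
      rw [← map_pow, ← map_pow, ← C_pow, FiniteField.pow_card_sub_one_eq_one c hc]; simp
    have h0 : Fintype.card F - 1 ≠ 0 := by
      have := Fintype.one_lt_card (α := F); omega
    simpa using (pow_eq_one_iff_of_nonneg zero_le h0).mp h

section Box

variable {F : Type u} [Field F]

/-- `f(x, z)` has degree at most `a` in `z` and at most `b` in `x`. -/
def BoxBound (a b : ℕ) (f : F[X][X]) : Prop :=
  f.natDegree ≤ a ∧ ∀ i, (f.coeff i).natDegree ≤ b

theorem BoxBound.mono {a b a' b' : ℕ} {f : F[X][X]} (h : BoxBound a b f) (ha : a ≤ a')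
    (hb : b ≤ b') : BoxBound a' b' f :=
  ⟨h.1.trans ha, fun i => (h.2 i).trans hb⟩

theorem BoxBound.add {a b : ℕ} {f g : F[X][X]} (hf : BoxBound a b f) (hg : BoxBound a b g) :
    BoxBound a b (f + g) :=
  ⟨natDegree_add_le_of_degree_le hf.1 hg.1, fun i => by
    rw [coeff_add]; exact natDegree_add_le_of_degree_le (hf.2 i) (hg.2 i)⟩

theorem boxBound_zero (a b : ℕ) : BoxBound a b (0 : F[X][X]) := by simp [BoxBound]

theorem BoxBound.sum {ι : Type*} {a b : ℕ} (s : Finset ι) {f : ι → F[X][X]}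
    (h : ∀ i ∈ s, BoxBound a b (f i)) : BoxBound a b (∑ i ∈ s, f i) :=
  Finset.sum_induction f (BoxBound a b) (fun _ _ => BoxBound.add) (boxBound_zero a b) h

theorem BoxBound.mul {a b a' b' : ℕ} {f g : F[X][X]} (hf : BoxBound a b f)
    (hg : BoxBound a' b' g) : BoxBound (a + a') (b + b') (f * g) := by
  refine ⟨natDegree_mul_le_of_le hf.1 hg.1, fun i => ?_⟩
  rw [coeff_mul]
  exact natDegree_sum_le_of_forall_le _ _ fun x _ => natDegree_mul_le_of_le (hf.2 _) (hg.2 _)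

theorem boxBound_C {b : ℕ} {f : F[X]} (hf : f.natDegree ≤ b) : BoxBound 0 b (C f) := by
  refine ⟨by simp, fun i => ?_⟩
  rw [coeff_C]
  split_ifs <;> simp [hf]

theorem boxBound_X : BoxBound 1 0 (X : F[X][X]) := by
  refine ⟨natDegree_X_le, fun i => ?_⟩
  rw [coeff_X]
  split_ifs <;> simp

theorem BoxBound.pow {a b : ℕ} {f : F[X][X]} (hf : BoxBound a b f) (n : ℕ) :
    BoxBound (n * a) (n * b) (f ^ n) := by
  induction n with
  | zero => simpa using boxBound_C (F := F) (f := 1) (b := 0) (by simp)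
  | succ n ih =>
    rw [pow_succ, add_mul, add_mul, one_mul, one_mul]
    exact ih.mul hf

/-- The polynomial with prescribed coefficients in a box. -/
noncomputable def gridPoly {m d : ℕ} (c : Fin m → Fin d → F) : F[X][X] :=
  ∑ i, C (∑ j, C (c i j) * X ^ (j : ℕ)) * X ^ (i : ℕ)

theorem coeff_sum_fin {R : Type*} [Semiring R] {m : ℕ} (c : Fin m → R) (i : Fin m) :
    (∑ i, C (c i) * X ^ (i : ℕ)).coeff i = c i := by
  simp only [finsetSum_coeff, coeff_C_mul, coeff_X_pow]
  rw [Finset.sum_eq_single i] <;> simp +contextual [Fin.val_inj, eq_comm]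

theorem gridPoly_coeff {m d : ℕ} (c : Fin m → Fin d → F) (i : Fin m) (j : Fin d) :
    ((gridPoly c).coeff i).coeff j = c i j := by
  rw [gridPoly, coeff_sum_fin, coeff_sum_fin]

theorem gridPoly_injective (m d : ℕ) :
    Function.Injective (gridPoly : (Fin m → Fin d → F) → F[X][X]) := fun c c' h => by
  ext i j
  rw [← gridPoly_coeff c, h, gridPoly_coeff]

theorem gridPoly_sub {m d : ℕ} (c c' : Fin m → Fin d → F) :
    gridPoly (c - c') = gridPoly c - gridPoly c' := by
  simp [gridPoly, sub_mul, Finset.sum_sub_distrib]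

theorem boxBound_gridPoly {m d : ℕ} (c : Fin m → Fin d → F) :
    BoxBound (m - 1) (d - 1) (gridPoly c) := by
  refine BoxBound.sum _ fun i _ => ?_
  refine ((boxBound_C (b := d - 1) ?_).mul (boxBound_X.pow i)).mono (by omega) (by omega)
  refine natDegree_sum_le_of_forall_le _ _ fun j _ => ?_
  exact (natDegree_C_mul_X_pow_le _ _).trans (by omega)

theorem sum_fin_coeff {R : Type*} [Semiring R] {m : ℕ} {f : R[X]} (hf : f.natDegree < m) :
    ∑ i : Fin m, C (f.coeff i) * X ^ (i : ℕ) = f := by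
  rw [Fin.sum_univ_eq_sum_range (fun i => C (f.coeff i) * X ^ i) m,
    ← as_sum_range_C_mul_X_pow' _ hf]

theorem exists_gridPoly_eq {m d : ℕ} {f : F[X][X]} (h : BoxBound m d f) :
    ∃ c : Fin (m + 1) → Fin (d + 1) → F, gridPoly c = f := by
  refine ⟨fun i j => (f.coeff i).coeff j, ?_⟩
  simp only [gridPoly]
  have h1 (i : Fin (m + 1)) :
      ∑ j : Fin (d + 1), C ((f.coeff i).coeff j) * X ^ (j : ℕ) = f.coeff i :=
    sum_fin_coeff (Nat.lt_succ_of_le (h.2 i))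
  simp only [h1]
  exact sum_fin_coeff (Nat.lt_succ_of_le h.1)

/-- The curve `z ^ p = x ^ (p - 1) z + g(x)`, birational to the Artin-Schreier curve
`y ^ p - y = g(x) / x ^ p` through `z = x y`. -/
noncomputable def curvePoly (p : ℕ) (g : F[X]) : F[X][X] :=
  X ^ p - (C (X ^ (p - 1)) * X + C g)

theorem curvePoly_aux {p : ℕ} (hp : 2 ≤ p) (g : F[X]) :
    (C (X ^ (p - 1)) * X + C g : F[X][X]).degree < p :=
  degree_linear_le.trans_lt (by exact_mod_cast hp)

theorem curvePoly_monic {p : ℕ} (hp : 2 ≤ p) (g : F[X]) : (curvePoly p g).Monic :=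
  (monic_X_pow p).sub_of_left (by rw [degree_X_pow]; exact curvePoly_aux hp g)

theorem curvePoly_natDegree {p : ℕ} (hp : 2 ≤ p) (g : F[X]) : (curvePoly p g).natDegree = p := by
  rw [curvePoly, natDegree_sub_eq_left_of_natDegree_lt, natDegree_X_pow]
  rw [natDegree_X_pow]
  exact natDegree_linear_le.trans_lt hp

theorem exists_reduction {p : ℕ} (hp : 2 ≤ p) {g : F[X]} (hg : g.natDegree ≤ p + 3) {a b : ℕ}
    {f : F[X][X]} (hf : BoxBound a b f) :
    ∃ r, curvePoly p g ∣ f - r ∧ BoxBound (p - 1) (b + a * (p + 3)) r := by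
  induction a generalizing b f with
  | zero => exact ⟨f, by simp, hf.mono (by omega) (by omega)⟩
  | succ a ih =>
    by_cases hap : a + 1 ≤ p - 1
    · exact ⟨f, by simp, hf.mono hap (by omega)⟩
    have he : BoxBound a b (f.erase (a + 1)) := by
      refine ⟨natDegree_le_iff_coeff_eq_zero.2 fun N hN => ?_, fun i => ?_⟩
      · rw [coeff_erase]
        split_ifs with h
        · rfl
        · exact coeff_eq_zero_of_natDegree_lt (by have := hf.1; omega)
      · rw [coeff_erase]
        split_ifs with h
        · simp
        · exact hf.2 i
    set c := f.coeff (a + 1) with hc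
    have hr : BoxBound a (b + (p + 3))
        (f.erase (a + 1) + C c * X ^ (a + 1 - p) * (C (X ^ (p - 1)) * X + C g)) := by
      refine (he.mono le_rfl (by omega)).add ?_
      have h1 : BoxBound 1 (p + 3) (C (X ^ (p - 1)) * X + C g : F[X][X]) := by
        refine BoxBound.add ?_ ((boxBound_C hg).mono (by omega) le_rfl)
        exact ((boxBound_C (b := p - 1) (by simp)).mul boxBound_X).mono (by omega) (by omega)
      exact (((boxBound_C (hf.2 (a + 1))).mul (boxBound_X.pow (a + 1 - p))).mul h1).mono
        (by omega) (by omega)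
    obtain ⟨r, hr1, hr2⟩ := ih hr
    refine ⟨r, ?_, hr2.mono le_rfl (by ring_nf; omega)⟩
    have : f - r = (f.erase (a + 1) + C c * X ^ (a + 1 - p) * (C (X ^ (p - 1)) * X + C g) - r)
        + C c * X ^ (a + 1 - p) * curvePoly p g := by
      have h2 : X ^ (a + 1 - p) * X ^ p = (X ^ (a + 1) : F[X][X]) := by
        rw [← pow_add]; congr 1; omega
      conv_lhs => rw [← monomial_add_erase f (a + 1), ← hc, ← C_mul_X_pow_eq_monomial, ← h2]
      rw [curvePoly]
      ring
    rw [this]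
    exact dvd_add hr1 (dvd_mul_left _ _)

end Box

theorem valuation_sum_eq_of_pow_injOn {L Γ ι : Type*} [Field L]
    [LinearOrderedCommGroupWithZero Γ] (v : Valuation L Γ) {u : Γ} (hu : 1 < u) {p : ℕ}
    (s : Finset ι) (hs : s.Nonempty) (a : ι → L) (e : ι → ℕ)
    (he : ∀ k ∈ s, v (a k) ^ p = u ^ e k) (hinj : Set.InjOn e s) :
    ∃ k ∈ s, v (∑ i ∈ s, a i) = v (a k) := by
  classical
  obtain ⟨k, hk, hmax⟩ := s.exists_max_image (fun i => v (a i)) hs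
  refine ⟨k, hk, v.map_sum_eq_of_lt hk ?_⟩
  intro i hi
  simp only [Finset.mem_sdiff, Finset.mem_singleton] at hi
  refine lt_of_le_of_ne (hmax i hi.1) fun h => hi.2 (hinj hi.1 hk ?_)
  have h1 : u ^ e i = u ^ e k := by rw [← he i hi.1, ← he k hk, h]
  exact (pow_right_strictMono₀ hu).injective h1

theorem exponent_injective {p i i' j j' : ℕ} (hp : p.Prime) (hp5 : 5 ≤ p) (hi : i < p)
    (hi' : i' < p) (h : p * j + (p + 3) * i = p * j' + (p + 3) * i') : i = i' ∧ j = j' := by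
  have h3 : p.Coprime 3 := by
    rw [hp.coprime_iff_not_dvd]
    intro h
    have := Nat.le_of_dvd (by norm_num) h
    omega
  have h1 : 3 * i ≡ 3 * i' [MOD p] := by
    have : (p * j + (p + 3) * i) % p = (p * j' + (p + 3) * i') % p := by rw [h]
    rw [add_mul, add_mul, ← add_assoc, ← add_assoc, ← mul_add, ← mul_add, Nat.mul_add_mod,
      Nat.mul_add_mod] at this
    exact this
  have h2 : i = i' := by
    have := Nat.ModEq.cancel_left_of_coprime h3 h1
    rwa [Nat.ModEq, Nat.mod_eq_of_lt hi, Nat.mod_eq_of_lt hi'] at this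
  subst h2
  exact ⟨rfl, Nat.eq_of_mul_eq_mul_left hp.pos (by omega)⟩

section Place

variable {F : Type u} [Field F] {L Γ : Type u} [Field L] [LinearOrderedCommGroupWithZero Γ]
  {φ : F[X][X] →+* L} {v : Valuation L Γ} {p : ℕ} {g : F[X]}

theorem valuation_const_poly (hu : 1 < v (φ (C X))) (hc : ∀ c : F, c ≠ 0 → v (φ (C (C c))) = 1)
    {f : F[X]} (hf : f ≠ 0) : v (φ (C f)) = v (φ (C X)) ^ f.natDegree := by
  have hterm (i : ℕ) (hi : i ∈ f.support) :
      v (φ (C (C (f.coeff i) * X ^ i))) = v (φ (C X)) ^ i := by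
    rw [C_mul, C_pow, map_mul, map_mul, hc _ (mem_support_iff.1 hi), map_pow, map_pow, one_mul]
  have hsum : φ (C f) = ∑ i ∈ f.support, φ (C (C (f.coeff i) * X ^ i)) := by
    conv_lhs => rw [f.as_sum_support_C_mul_X_pow, map_sum, map_sum]
  rw [hsum, v.map_sum_eq_of_lt (j := f.natDegree) (natDegree_mem_support_of_nonzero hf),
    hterm _ (natDegree_mem_support_of_nonzero hf)]
  intro i hi
  simp only [Finset.mem_sdiff, Finset.mem_singleton] at hi
  rw [hterm i hi.1, hterm _ (natDegree_mem_support_of_nonzero hf)]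
  exact pow_lt_pow_right₀ hu (lt_of_le_of_ne (le_natDegree_of_mem_supp i hi.1) hi.2)

theorem valuation_z_pow (hp : 2 ≤ p) (hg : g.natDegree = p + 3) (hφ : φ (curvePoly p g) = 0)
    (hu : 1 < v (φ (C X))) (hc : ∀ c : F, c ≠ 0 → v (φ (C (C c))) = 1) :
    v (φ X) ^ p = v (φ (C X)) ^ (p + 3) := by
  have hgv : v (φ (C g)) = v (φ (C X)) ^ (p + 3) := by
    rw [← hg]
    exact valuation_const_poly hu hc (fun h => by simp [h] at hg)
  have hz : φ X ^ p = φ (C X) ^ (p - 1) * φ X + φ (C g) := by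
    rw [curvePoly] at hφ
    simp only [map_sub, map_pow, map_add, map_mul] at hφ
    exact sub_eq_zero.1 hφ
  obtain h | h := le_or_gt (v (φ X)) (v (φ (C X)))
  · rw [← map_pow, hz, v.map_add_eq_of_lt_right, hgv]
    rw [hgv, map_mul, map_pow]
    calc v (φ (C X)) ^ (p - 1) * v (φ X) ≤ v (φ (C X)) ^ (p - 1) * v (φ (C X)) :=
          mul_le_mul_right h _
      _ = v (φ (C X)) ^ p := by rw [← pow_succ]; congr 1; omega
      _ < _ := pow_lt_pow_right₀ hu (by omega)
  · have h1 : v (φ (C X) ^ (p - 1) * φ X) < v (φ X ^ p) := by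
      rw [map_mul, map_pow, map_pow]
      have h0 : 0 < v (φ X) := (zero_lt_one.trans hu).trans h
      calc v (φ (C X)) ^ (p - 1) * v (φ X) < v (φ X) ^ (p - 1) * v (φ X) := by
            refine mul_lt_mul_of_pos_right (pow_lt_pow_left₀ h zero_le (by omega)) h0
        _ = _ := by rw [← pow_succ]; congr 1; omega
    have h2 : φ (C g) = φ X ^ p - φ (C X) ^ (p - 1) * φ X := by rw [hz]; ring
    rw [← hgv, h2, v.map_sub_eq_of_lt_left h1, map_pow]

theorem valuation_box (hp : p.Prime) (hp5 : 5 ≤ p) (hg : g.natDegree = p + 3)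
    (hφ : φ (curvePoly p g) = 0)
    (hu : 1 < v (φ (C X))) (hc : ∀ c : F, c ≠ 0 → v (φ (C (C c))) = 1) {b : ℕ} {f : F[X][X]}
    (hf : f ≠ 0) (hb : BoxBound (p - 1) b f) :
    ∃ e, e ≤ p * b + (p + 3) * (p - 1) ∧ v (φ f) ^ p = v (φ (C X)) ^ e := by
  have hz := valuation_z_pow hp.two_le hg hφ hu hc
  have hterm (i : ℕ) (hi : i ∈ f.support) :
      v (φ (C (f.coeff i) * X ^ i)) ^ p =
        v (φ (C X)) ^ (p * (f.coeff i).natDegree + (p + 3) * i) := by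
    have h1 : (v (φ X) ^ i) ^ p = v (φ (C X)) ^ ((p + 3) * i) := by
      rw [← pow_mul, mul_comm, pow_mul, hz, ← pow_mul]
    rw [map_mul, map_mul, map_pow, map_pow, valuation_const_poly hu hc (mem_support_iff.1 hi),
      mul_pow, h1, pow_add, ← pow_mul, mul_comm p]
  have hlt (i : ℕ) (hi : i ∈ f.support) : i ≤ p - 1 :=
    (le_natDegree_of_mem_supp i hi).trans hb.1
  obtain ⟨k, hk, hk'⟩ := valuation_sum_eq_of_pow_injOn v hu (p := p) f.support
    (support_nonempty.2 hf) (fun i => φ (C (f.coeff i) * X ^ i)) _ hterm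
    (fun i hi i' hi' h => (exponent_injective hp hp5 (by have := hlt i hi; omega)
      (by have := hlt i' hi'; omega) h).1)
  refine ⟨p * (f.coeff k).natDegree + (p + 3) * k, ?_, ?_⟩
  · gcongr
    exacts [hb.2 k, hlt k hk]
  · conv_lhs => rw [f.as_sum_support_C_mul_X_pow, map_sum, hk', hterm k hk]

theorem map_ne_zero_of_boxBound (hp : p.Prime) (hp5 : 5 ≤ p) (hg : g.natDegree = p + 3)
    (hφ : φ (curvePoly p g) = 0)
    (hu : 1 < v (φ (C X))) (hc : ∀ c : F, c ≠ 0 → v (φ (C (C c))) = 1) {b : ℕ} {f : F[X][X]}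
    (hf : f ≠ 0) (hb : BoxBound (p - 1) b f) : φ f ≠ 0 := by
  obtain ⟨e, -, he⟩ := valuation_box hp hp5 hg hφ hu hc hf hb
  intro h
  rw [h, map_zero, zero_pow hp.ne_zero] at he
  exact pow_ne_zero e (zero_lt_one.trans hu).ne' he.symm

/-- Linear independence of the products of small functions with `Q`-th powers. -/
theorem frobenius_combination_ne_zero (hp : p.Prime) (hp5 : 5 ≤ p) (hg : g.natDegree = p + 3)
    (hφ : φ (curvePoly p g) = 0)
    (hu : 1 < v (φ (C X))) (hc : ∀ c : F, c ≠ 0 → v (φ (C (C c))) = 1) {b t Q : ℕ}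
    (hQ : p * b + (p + 3) * (p - 1) < Q) (τ : Fin p × Fin t → F[X][X])
    (hτ : ∀ k, BoxBound (p - 1) b (τ k)) (hτ0 : ∃ k, τ k ≠ 0) :
    φ (∑ k, τ k * (C X ^ (k.2 : ℕ) * X ^ (k.1 : ℕ)) ^ Q) ≠ 0 := by
  classical
  have hz := valuation_z_pow hp.two_le hg hφ hu hc
  choose! e he he' using fun k (hk : τ k ≠ 0) => valuation_box hp hp5 hg hφ hu hc hk (hτ k)
  have hterm (k : Fin p × Fin t) (hk : k ∈ Finset.univ.filter fun k => τ k ≠ 0) :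
      v (φ (τ k * (C X ^ (k.2 : ℕ) * X ^ (k.1 : ℕ)) ^ Q)) ^ p =
        v (φ (C X)) ^ (e k + Q * (p * k.2 + (p + 3) * k.1)) := by
    rw [Finset.mem_filter] at hk
    simp only [map_mul, map_pow, mul_pow]
    rw [he' k hk.2, pow_add, mul_add, pow_add]
    congr 2
    · rw [← pow_mul, ← pow_mul]
      congr 1
      ring
    · rw [← pow_mul, ← pow_mul, show (k.1 : ℕ) * (Q * p) = p * (k.1 * Q) by ring, pow_mul, hz,
        ← pow_mul]
      congr 1
      ring
  obtain ⟨k, hk, hk'⟩ := valuation_sum_eq_of_pow_injOn v hu (p := p) _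
    (hτ0.imp fun k hk => by simpa using hk) _ _ hterm (by
      intro k hk k' hk' h
      simp only [Finset.coe_filter, Finset.mem_univ, true_and, Set.mem_ofPred_eq] at hk hk'
      have h1 := (he k hk).trans_lt hQ
      have h2 := (he k' hk').trans_lt hQ
      have h3 : p * k.2 + (p + 3) * k.1 = p * k'.2 + (p + 3) * k'.1 := by
        have := congrArg (· / Q) h
        simpa [Nat.add_mul_div_left _ _ (by omega : 0 < Q), Nat.div_eq_of_lt h1,
          Nat.div_eq_of_lt h2] using this
      obtain ⟨h4, h5⟩ := exponent_injective hp hp5 k.1.2 k'.1.2 h3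
      exact Prod.ext (Fin.ext h4) (Fin.ext h5))
  have hsum : (∑ k, τ k * (C X ^ (k.2 : ℕ) * X ^ (k.1 : ℕ)) ^ Q) =
      ∑ k ∈ Finset.univ.filter (fun k => τ k ≠ 0),
        τ k * (C X ^ (k.2 : ℕ) * X ^ (k.1 : ℕ)) ^ Q := by
    rw [Finset.sum_filter_of_ne]
    intro k _ h h0
    simp [h0] at h
  intro h
  rw [hsum, map_sum] at h
  rw [h, map_zero] at hk'
  have := hterm k hk
  rw [← hk', zero_pow hp.ne_zero] at this
  exact pow_ne_zero _ (zero_lt_one.trans hu).ne' this.symm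

end Place

section Count

variable {F : Type u} [Field F]

/-- Evaluation of a bivariate polynomial at a point `(x, z)`. -/
noncomputable def evalAt (P : F × F) : F[X][X] →+* F := eval₂RingHom (evalRingHom P.1) P.2

@[simp] theorem evalAt_C (P : F × F) (f : F[X]) : evalAt P (C f) = f.eval P.1 := by
  simp [evalAt]

@[simp] theorem evalAt_X (P : F × F) : evalAt P X = P.2 := by simp [evalAt]

theorem map_eq_of_dvd_sub {R S : Type*} [CommRing R] [CommRing S] (φ : R →+* S) {G a b : R}
    (hG : φ G = 0) (h : G ∣ a - b) : φ a = φ b := by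
  obtain ⟨c, hc⟩ := h
  rw [← sub_eq_zero, ← map_sub, hc, map_mul, hG, zero_mul]

theorem exists_indicator [Fintype F] {p : ℕ} (hp : 2 ≤ p) {g : F[X]}
    (hg : g.natDegree ≤ p + 3) (P : F × F) :
    ∃ f : F[X][X],
      BoxBound (p - 1) (Fintype.card F + Fintype.card F * (p + 3)) f ∧
      ∀ P' : F × F, evalAt P' (curvePoly p g) = 0 →
        (P' = P → evalAt P' f = 1) ∧ (P' ≠ P → evalAt P' f = 0) := by
  set q := Fintype.card F
  have hq : 1 < q := Fintype.one_lt_card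
  have h1 : BoxBound (q - 1) 0 (1 + C (C (-1)) * (X + C (C (-P.2))) ^ (q - 1) : F[X][X]) := by
    have hx : BoxBound 1 0 (X + C (C (-P.2)) : F[X][X]) :=
      boxBound_X.add ((boxBound_C (by simp)).mono (by omega) le_rfl)
    refine BoxBound.add ?_ (((boxBound_C (b := 0) (by simp)).mul (hx.pow (q - 1))).mono
      (by omega) (by omega))
    exact (boxBound_C (f := 1) (b := 0) (by simp)).mono (by omega) le_rfl
  have h2 : BoxBound 0 (q - 1) (C (1 - (X - C P.1) ^ (q - 1)) : F[X][X]) := by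
    refine boxBound_C ?_
    refine (natDegree_sub_le _ _).trans (max_le (by simp) ?_)
    exact natDegree_pow_le_of_le _ (natDegree_X_sub_C_le _) |>.trans (by simp)
  obtain ⟨f, hf, hfb⟩ := exists_reduction hp hg ((h2.mul h1).mono (a' := q) (b' := q)
    (by omega) (by omega))
  refine ⟨f, hfb, fun P' hP' => ?_⟩
  rw [← map_eq_of_dvd_sub _ hP' hf]
  simp only [map_mul, map_add, map_one, map_pow, evalAt_C, evalAt_X, eval_sub, eval_one, eval_pow,
    eval_X, eval_C]
  constructor
  · rintro rfl
    simp [zero_pow (by omega : q - 1 ≠ 0)]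
  · intro hne
    by_cases h : P'.1 = P.1
    · have h' : P'.2 + -P.2 ≠ 0 := fun h' => hne (Prod.ext h (by linear_combination h'))
      rw [FiniteField.pow_card_sub_one_eq_one _ h']
      ring
    · rw [FiniteField.pow_card_sub_one_eq_one _ (sub_ne_zero.2 h)]
      ring

/-- The number of zeros of a function on the curve is bounded by its number of poles. -/
theorem card_zeros_le [Fintype F] {p : ℕ} (hp : p.Prime) (hp5 : 5 ≤ p) {g : F[X]}
    (hg : g.natDegree = p + 3) {L Γ : Type u} [Field L] [LinearOrderedCommGroupWithZero Γ]
    {φ : F[X][X] →+* L} {v : Valuation L Γ} (hφ : φ (curvePoly p g) = 0)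
    (hu : 1 < v (φ (C X))) (hc : ∀ c : F, c ≠ 0 → v (φ (C (C c))) = 1)
    (pts : Finset (F × F)) (hpts : ∀ P ∈ pts, evalAt P (curvePoly p g) = 0) {D : ℕ}
    {h : F[X][X]} (hb : BoxBound (p - 1) D h) (hh : φ h ≠ 0) (h0 : ∀ P ∈ pts, evalAt P h = 0) :
    pts.card ≤ p * (D + (p - 1 + (p - 1)) * (p + 3)) := by
  classical
  set q := Fintype.card F with hq
  have hq1 : 1 < q := Fintype.one_lt_card
  choose ι hιb hι using exists_indicator hp.two_le hg.le
  set E := q + q * (p + 3)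
  set m := (p - 1 + (p - 1)) * (p + 3)
  let T : (Fin (p - 1 + 1) → Fin (E + 1) → F) × (pts → F) → F[X][X] := fun c =>
    h * gridPoly c.1 + ∑ P : pts, C (C (c.2 P)) * ι P
  have hT (c) : ∃ r : Fin (p - 1 + 1) → Fin (D + E + m + 1) → F,
      curvePoly p g ∣ T c - gridPoly r := by
    have h1 : BoxBound (p - 1 + (p - 1)) (D + E) (T c) := by
      refine ((hb.mul (boxBound_gridPoly c.1)).mono (by omega) (by omega)).add ?_
      exact BoxBound.sum _ fun P _ =>
        ((boxBound_C (b := 0) (by simp)).mul (hιb P)).mono (by omega) (by omega)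
    obtain ⟨r, hr, hrb⟩ := exists_reduction hp.two_le hg.le h1
    obtain ⟨c, rfl⟩ := exists_gridPoly_eq hrb
    exact ⟨c, hr⟩
  choose r hr using hT
  have hinj : Function.Injective r := by
    intro c c' hcc
    have hd : curvePoly p g ∣ T c - T c' := by
      have := dvd_sub (hr c) (hr c')
      rwa [hcc, sub_sub_sub_cancel_right] at this
    have h2 : c.2 = c'.2 := by
      funext P
      have := map_eq_of_dvd_sub _ (hpts P P.2) hd
      have hs (c : (Fin (p - 1 + 1) → Fin (E + 1) → F) × (pts → F)) :
          evalAt (P : F × F) (T c) = c.2 P := by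
        simp only [T, map_add, map_mul, h0 P P.2, zero_mul, zero_add, map_sum, evalAt_C, eval_C]
        rw [Finset.sum_eq_single P, (hι _ _ (hpts P P.2)).1 rfl, mul_one]
        · intro P' _ hne
          rw [(hι _ _ (hpts P P.2)).2 (fun h => hne (Subtype.ext h).symm), mul_zero]
        · simp
      rwa [hs, hs] at this
    have h1 : c.1 = c'.1 := by
      by_contra hne
      have hg0 : gridPoly (c.1 - c'.1) ≠ 0 := by
        rw [gridPoly_sub, sub_ne_zero]
        exact fun h => hne (gridPoly_injective _ _ h)
      have := map_eq_of_dvd_sub φ hφ hd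
      simp only [T, h2, map_add, add_left_inj, map_mul] at this
      have h3 := mul_left_cancel₀ hh this
      refine map_ne_zero_of_boxBound hp hp5 hg hφ hu hc hg0
        ((boxBound_gridPoly _).mono (by omega) le_rfl) ?_
      rw [gridPoly_sub, map_sub, h3, sub_self]
    exact Prod.ext h1 h2
  have hcard := Fintype.card_le_of_injective r hinj
  simp only [Fintype.card_prod, Fintype.card_fun, Fintype.card_fin, Fintype.card_coe] at hcard
  rw [← hq, ← pow_mul, ← pow_mul, ← pow_add, Nat.pow_le_pow_iff_right hq1,
    show p - 1 + 1 = p by omega] at hcard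
  nlinarith

theorem exists_frobenius_linear {p : ℕ} [CharP F p] (hp : p.Prime) (hp5 : 5 ≤ p) {g : F[X]}
    (hg : g.natDegree ≤ p + 3) (μ : ℕ) :
    ∃ l : F[X][X], curvePoly p g ∣ X ^ p ^ μ - l ∧ BoxBound 1 (2 * p ^ μ) l := by
  have := Fact.mk hp
  suffices ∃ a b : F[X], curvePoly p g ∣ X ^ p ^ μ - (C a * X + C b) ∧
      a.natDegree + 1 ≤ p ^ μ ∧ b.natDegree ≤ 2 * p ^ μ by
    obtain ⟨a, b, h, ha, hb⟩ := this
    exact ⟨_, h, (((boxBound_C (b := p ^ μ) (by omega)).mul boxBound_X).mono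
      (by omega) (by omega)).add
      ((boxBound_C hb).mono (by omega) (by omega))⟩
  induction μ with
  | zero => exact ⟨1, 0, by simp, by simp, by simp⟩
  | succ μ ih =>
    obtain ⟨a, b, h, ha, hb⟩ := ih
    refine ⟨a ^ p * X ^ (p - 1), a ^ p * g + b ^ p, ?_, ?_, ?_⟩
    · have h1 := h.trans (sub_dvd_pow_sub_pow _ _ p)
      have h2 : curvePoly p g ∣ C (a ^ p) * curvePoly p g := dvd_mul_left _ _
      convert dvd_add h1 h2 using 1
      rw [add_pow_char, curvePoly, ← pow_mul, ← pow_succ]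
      simp only [map_mul, map_pow, map_add]
      ring
    · have h1 : (a ^ p * X ^ (p - 1)).natDegree ≤ p * a.natDegree + (p - 1) :=
        natDegree_mul_le_of_le (natDegree_pow_le) (natDegree_X_pow_le _)
      have h2 : p * (a.natDegree + 1) ≤ p * p ^ μ := by gcongr
      rw [pow_succ']
      have := hp.pos
      rw [mul_add] at h2
      omega
    · have hpp : p ≤ p ^ (μ + 1) := Nat.le_self_pow (by omega) p
      refine (natDegree_add_le _ _).trans (max_le ?_ ?_)
      · have h1 : (a ^ p * g).natDegree ≤ p * a.natDegree + (p + 3) :=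
          natDegree_mul_le_of_le natDegree_pow_le hg
        have h2 : p * (a.natDegree + 1) ≤ p * p ^ μ := by gcongr
        rw [pow_succ'] at hpp ⊢
        rw [mul_add] at h2
        omega
      · refine natDegree_pow_le.trans ?_
        calc p * b.natDegree ≤ p * (2 * p ^ μ) := by gcongr
          _ = _ := by ring

theorem dvd_sum_sub_sum {R ι : Type*} [CommRing R] {G : R} (s : Finset ι) {f g : ι → R}
    (h : ∀ i ∈ s, G ∣ f i - g i) : G ∣ ∑ i ∈ s, f i - ∑ i ∈ s, g i := by
  rw [← Finset.sum_sub_distrib]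
  exact Finset.dvd_sum h

theorem exists_frobenius_pow {p : ℕ} [CharP F p] (hp : p.Prime) (hp5 : 5 ≤ p) {g : F[X]}
    (hg : g.natDegree ≤ p + 3) (μ : ℕ) {b : ℕ} {f : F[X][X]} (hf : BoxBound (p - 1) b f) :
    ∃ r : F[X][X], curvePoly p g ∣ f ^ p ^ μ - r ∧
      BoxBound (p - 1) (p ^ μ * b + (p - 1) * (2 * p ^ μ)) r := by
  have := Fact.mk hp
  obtain ⟨l, hl, hlb⟩ := exists_frobenius_linear hp hp5 hg μ
  refine ⟨∑ i ∈ Finset.range p, C (f.coeff i) ^ p ^ μ * l ^ i, ?_, ?_⟩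
  · conv in f ^ p ^ μ => rw [f.as_sum_range_C_mul_X_pow' (n := p)
      (by have := hf.1; have := hp.pos; omega), sum_pow_char_pow]
    refine dvd_sum_sub_sum _ fun i _ => ?_
    rw [mul_pow, ← mul_sub, pow_right_comm]
    exact (hl.trans (sub_dvd_pow_sub_pow _ _ i)).mul_left _
  · refine BoxBound.sum _ fun i hi => ?_
    rw [Finset.mem_range] at hi
    have hi' : i ≤ p - 1 := by omega
    refine (((boxBound_C (hf.2 i)).pow (p ^ μ)).mul (hlb.pow i)).mono (by omega) ?_
    gcongr

end Count

section Stepanov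

variable {F : Type u} [Field F]

theorem dvd_sub_of_dvd_sub {R : Type*} [CommRing R] {G a b c : R} (h : G ∣ a - b) (h' : G ∣ b - c) :
    G ∣ a - c := by
  simpa using dvd_add h h'

theorem boxBound_monomial (i j : ℕ) : BoxBound i j (C X ^ j * X ^ i : F[X][X]) := by
  have := ((boxBound_C (F := F) (b := 1) (f := X) natDegree_X_le).pow j).mul (boxBound_X.pow i)
  exact this.mono (by omega) (by omega)

/-- Siegel's lemma by pigeonhole: a nontrivial combination of monomials with `Q`-th powers as
coefficients that vanishes on the curve. -/
theorem exists_vanishing_combination [Fintype F] {p : ℕ} [CharP F p] (hp : p.Prime) (hp5 : 5 ≤ p)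
    {g : F[X]} (hg : g.natDegree ≤ p + 3) (μ : ℕ) {s t : ℕ}
    (hst : p ^ μ * (s - 1) + (p - 1) * (2 * p ^ μ) + t + (p - 1 + (p - 1)) * (p + 3) + 1
      < p * (t * s)) :
    ∃ τ : Fin p × Fin t → F[X][X], (∀ k, BoxBound (p - 1) (s - 1) (τ k)) ∧ (∃ k, τ k ≠ 0) ∧
      curvePoly p g ∣ ∑ k, τ k ^ p ^ μ * (C X ^ (k.2 : ℕ) * X ^ (k.1 : ℕ)) := by
  classical
  have := Fact.mk hp
  set D := p ^ μ * (s - 1) + (p - 1) * (2 * p ^ μ) + t + (p - 1 + (p - 1)) * (p + 3)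
  let T : (Fin p × Fin t → Fin (p - 1 + 1) → Fin s → F) → F[X][X] := fun c =>
    ∑ k, gridPoly (c k) ^ p ^ μ * (C X ^ (k.2 : ℕ) * X ^ (k.1 : ℕ))
  have hT (c) : ∃ r : Fin (p - 1 + 1) → Fin (D + 1) → F, curvePoly p g ∣ T c - gridPoly r := by
    choose r hr hrb using fun k => exists_frobenius_pow hp hp5 hg μ (boxBound_gridPoly (c k))
    have h1 : curvePoly p g ∣ T c - ∑ k, r k * (C X ^ (k.2 : ℕ) * X ^ (k.1 : ℕ)) :=
      dvd_sum_sub_sum _ fun k _ => by rw [← sub_mul]; exact (hr k).mul_right _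
    obtain ⟨r', hr', hrb'⟩ := exists_reduction hp.two_le hg (a := p - 1 + (p - 1))
      (b := p ^ μ * (s - 1) + (p - 1) * (2 * p ^ μ) + t)
      (BoxBound.sum Finset.univ fun k _ => ((hrb k).mul (boxBound_monomial k.1 k.2)).mono
        (by have := k.1.2; omega) (by have := k.2.2; omega))
    obtain ⟨c', rfl⟩ := exists_gridPoly_eq hrb'
    exact ⟨c', dvd_sub_of_dvd_sub h1 hr'⟩
  choose r hr using hT
  obtain ⟨c, c', hne, hcc⟩ := Fintype.exists_ne_map_eq_of_card_lt r (by
    simp only [Fintype.card_fun, Fintype.card_fin, Fintype.card_prod]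
    rw [← pow_mul, ← pow_mul, ← pow_mul]
    refine Nat.pow_lt_pow_right Fintype.one_lt_card ?_
    calc (D + 1) * (p - 1 + 1) < (p * (t * s)) * (p - 1 + 1) := by gcongr
      _ = _ := by ring)
  refine ⟨fun k => gridPoly (c k - c' k), fun k => boxBound_gridPoly _, ?_, ?_⟩
  · by_contra! h
    refine hne (funext fun k => ?_)
    have := h k
    rw [gridPoly_sub, sub_eq_zero] at this
    exact gridPoly_injective _ _ this
  · have h1 := hr c
    rw [hcc] at h1
    convert (dvd_sub h1 (hr c')) using 1
    simp only [T, gridPoly_sub, sub_pow_char_pow, sub_mul, Finset.sum_sub_distrib]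
    ring

/-- Stepanov's bound for the number of affine points on the curve `z ^ p = x ^ (p - 1) z + g(x)`. -/
theorem card_points_le [Fintype F] {p : ℕ} [CharP F p] (hp : p.Prime) (hp5 : 5 ≤ p)
    {g : F[X]} (hg : g.natDegree = p + 3) {μ : ℕ} (hμ : 3 ≤ μ)
    (hF : Fintype.card F = (p ^ μ) ^ 2) (pts : Finset (F × F))
    (hpts : ∀ P ∈ pts, evalAt P (curvePoly p g) = 0) :
    pts.card ≤ (p ^ μ) ^ 2 + 11 * p ^ 2 * p ^ μ := by
  have := Fact.mk hp
  obtain ⟨L, _, φ, Γ, _, v, hφ, hu, hc⟩ := exists_place_at_infinity F (curvePoly p g)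
    (curvePoly_monic hp.two_le g) (by rw [curvePoly_natDegree hp.two_le]; exact hp.ne_zero)
  obtain ⟨ν, rfl⟩ : ∃ ν, μ = ν + 1 := ⟨μ - 1, by omega⟩
  set Q' := p ^ ν
  have hQ' : p ^ 2 ≤ Q' := Nat.pow_le_pow_right hp.pos (by omega)
  have hQ : p ^ (ν + 1) = p * Q' := pow_succ' _ _
  have hpQ : p + 2 ≤ Q' := by nlinarith
  obtain ⟨τ, hτb, hτ0, hτ⟩ := exists_vanishing_combination hp hp5 hg.le (ν + 1)
    (s := Q' - p - 1) (t := Q' + 4 * p) (by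
      rw [hQ]
      obtain ⟨w, hw⟩ : ∃ w, Q' = w + p + 2 := ⟨Q' - p - 2, by omega⟩
      obtain ⟨y, rfl⟩ : ∃ y, p = y + 5 := ⟨p - 5, by omega⟩
      rw [show Q' - (y + 5) - 1 - 1 = w by omega, show Q' - (y + 5) - 1 = w + 1 by omega,
        show y + 5 - 1 = y + 4 by omega]
      rw [hw] at hQ' ⊢
      obtain ⟨e, rfl⟩ : ∃ e, w = e + (y ^ 2 + 9 * y + 18) :=
        ⟨w - (y ^ 2 + 9 * y + 18), by
          have : y ^ 2 + 9 * y + 18 ≤ w := by nlinarith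
          omega⟩
      ring_nf
      nlinarith [Nat.zero_le (e * y), Nat.zero_le (e * y ^ 2)])
  have hne := frobenius_combination_ne_zero hp hp5 hg hφ hu hc (b := Q' - p - 1 - 1)
    (Q := p ^ (ν + 1)) (by
      rw [hQ]
      obtain ⟨w, hw⟩ : ∃ w, Q' = w + p + 2 := ⟨Q' - p - 2, by omega⟩
      obtain ⟨y, rfl⟩ : ∃ y, p = y + 5 := ⟨p - 5, by omega⟩
      rw [show Q' - (y + 5) - 1 - 1 = w by omega, show y + 5 - 1 = y + 4 by omega, hw]
      nlinarith) τ hτb hτ0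
  obtain ⟨l, hl, hlb⟩ := exists_frobenius_linear hp hp5 hg.le (ν + 1)
  set Q := p ^ (ν + 1) with hQdef
  have h1 : curvePoly p g ∣ ∑ k, τ k * (C X ^ (k.2 : ℕ) * X ^ (k.1 : ℕ)) ^ Q -
      ∑ k, τ k * (C X ^ ((k.2 : ℕ) * Q) * l ^ (k.1 : ℕ)) := dvd_sum_sub_sum _ fun k _ => by
    rw [mul_pow, ← pow_mul, pow_right_comm, ← mul_sub, ← mul_sub]
    exact ((hl.trans (sub_dvd_pow_sub_pow _ _ _)).mul_left _).mul_left _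
  obtain ⟨r, hr, hrb⟩ := exists_reduction hp.two_le hg.le (a := p - 1 + (p - 1))
      (b := Q' - p - 1 - 1 + ((Q' + 4 * p) * Q + (p - 1) * (2 * Q)))
      (BoxBound.sum (f := fun k => τ k * (C X ^ ((k.2 : ℕ) * Q) * l ^ (k.1 : ℕ)))
        Finset.univ fun k _ => by
          have hk1 : (k.1 : ℕ) ≤ p - 1 := by have := k.1.2; omega
          have hk2 : (k.2 : ℕ) ≤ Q' + 4 * p := k.2.2.le
          refine ((hτb k).mul ((boxBound_C (b := (k.2 * Q)) (f := X ^ ((k.2 : ℕ) * Q)) ?_).mul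
            (hlb.pow (k.1 : ℕ)))).mono ?_ ?_ |> fun h => by simpa using h
          · exact natDegree_X_pow_le _
          · omega
          · gcongr)
  have hd := dvd_sub_of_dvd_sub h1 hr
  have h0 : ∀ P ∈ pts, evalAt P r = 0 := fun P hP => by
    rw [← map_eq_of_dvd_sub _ (hpts P hP) hd]
    refine pow_eq_zero_iff (n := Q) (by positivity) |>.1 ?_
    have h2 := map_eq_of_dvd_sub (evalAt P) (hpts P hP) (a := ∑ k, τ k ^ Q *
      (C X ^ (k.2 : ℕ) * X ^ (k.1 : ℕ))) (b := 0) (by simpa using hτ)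
    rw [map_zero] at h2
    rw [← h2, ← map_pow, hQdef, sum_pow_char_pow, map_sum, map_sum]
    refine Finset.sum_congr rfl fun k _ => ?_
    rw [mul_pow, ← pow_mul, ← hQdef, ← sq, ← hF, map_mul, map_mul, map_pow _ (_ * _),
      FiniteField.pow_card]
  have := card_zeros_le hp hp5 hg hφ hu hc pts hpts hrb
    (by rwa [← map_eq_of_dvd_sub _ hφ hd]) h0
  refine this.trans ?_
  rw [hQ]
  obtain ⟨w, hw⟩ : ∃ w, Q' = w + p + 2 := ⟨Q' - p - 2, by omega⟩
  obtain ⟨y, rfl⟩ : ∃ y, p = y + 5 := ⟨p - 5, by omega⟩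
  rw [show Q' - (y + 5) - 1 - 1 = w by omega, show y + 5 - 1 = y + 4 by omega]
  rw [hw] at hQ' ⊢
  obtain ⟨e, rfl⟩ : ∃ e, w = e + (y ^ 2 + 9 * y + 18) :=
    ⟨w - (y ^ 2 + 9 * y + 18), by
      have : y ^ 2 + 9 * y + 18 ≤ w := by nlinarith
      omega⟩
  ring_nf
  nlinarith [Nat.zero_le (e * y), Nat.zero_le (e * y ^ 2), Nat.zero_le (e * y ^ 3),
    Nat.zero_le (y ^ 3), Nat.zero_le (y ^ 4), Nat.zero_le (y ^ 5)]

end Stepanov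

section EvenMoment

variable {F : Type u} [Field F] [Fintype F] {p : ℕ} [Fact p.Prime] [Algebra (ZMod p) F]

/-- The additive form of Hilbert 90 for finite fields. -/
theorem exists_pow_sub_self_eq {x : F} (hx : Algebra.trace (ZMod p) F x = 0) :
    ∃ y : F, y ^ p - y = x := by
  classical
  have hp : p.Prime := Fact.out
  have : CharP F p := charP_of_injective_algebraMap (algebraMap (ZMod p) F).injective p
  let D : F →ₗ[ZMod p] F :=
    (FiniteField.frobeniusAlgEquivOfAlgebraic (ZMod p) F).toLinearMap - LinearMap.id
  have hD (y : F) : D y = y ^ p - y := by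
    simp [D]
  have hker : Module.finrank (ZMod p) (LinearMap.ker D) ≤ 1 := by
    have h1 : Nat.card (LinearMap.ker D) ≤ p := by
      have h2 : ((LinearMap.ker D : Set F)).ncard ≤ p := by
        have h3 : (LinearMap.ker D : Set F) ⊆ ((X ^ p - X : F[X]).roots.toFinset : Set F) := by
          intro y hy
          have hy' : y ^ p - y = 0 := by rw [← hD]; exact hy
          simp [mem_roots (FiniteField.X_pow_card_sub_X_ne_zero F hp.one_lt), hy']
        refine (Set.ncard_le_ncard h3 (Finset.finite_toSet _)).trans ?_
        rw [Set.ncard_coe_finset]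
        refine (Multiset.toFinset_card_le _).trans ((card_roots' _).trans ?_)
        rw [FiniteField.X_pow_card_sub_X_natDegree_eq F hp.one_lt]
      exact h2
    have h4 := Module.card_eq_pow_finrank (K := ZMod p) (V := LinearMap.ker D)
    rw [← Nat.card_eq_fintype_card, ZMod.card] at h4
    rw [h4] at h1
    by_contra! h
    have := Nat.pow_lt_pow_right hp.one_lt h
    rw [pow_one] at this
    omega
  have hle : LinearMap.range D ≤ LinearMap.ker (Algebra.trace (ZMod p) F) := by
    rintro _ ⟨y, rfl⟩
    rw [LinearMap.mem_ker, hD, map_sub, sub_eq_zero]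
    simpa using Algebra.trace_eq_of_algEquiv (FiniteField.frobeniusAlgEquivOfAlgebraic (ZMod p) F) y
  have h1 := LinearMap.finrank_range_add_finrank_ker D
  have h2 := LinearMap.finrank_range_add_finrank_ker (Algebra.trace (ZMod p) F)
  rw [LinearMap.range_eq_top.2 (Algebra.trace_surjective (ZMod p) F), finrank_top,
    Module.finrank_self] at h2
  have h3 := Submodule.eq_of_le_of_finrank_le hle (by omega)
  have h4 : x ∈ LinearMap.range D := by rw [h3]; exact hx
  obtain ⟨y, hy⟩ := h4
  exact ⟨y, by rw [← hD, hy]⟩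

theorem card_trace_fiber_le [DecidableEq F] (hp5 : 5 ≤ p) {μ : ℕ} (hμ : 3 ≤ μ)
    (hF : Fintype.card F = (p ^ μ) ^ 2) {m : F} (hm : m ≠ 0) (n : F) (a : ZMod p) :
    p * (Finset.univ.filter fun x : Fˣ =>
      Algebra.trace (ZMod p) F (m * x ^ 3 + n * (x⁻¹ : Fˣ) ^ 2) = a).card ≤
      (p ^ μ) ^ 2 + 11 * p ^ 2 * p ^ μ := by
  have hp : p.Prime := Fact.out
  have : CharP F p := charP_of_injective_algebraMap (algebraMap (ZMod p) F).injective p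
  obtain ⟨c, hc⟩ := Algebra.trace_surjective (ZMod p) F (-a)
  set N := Finset.univ.filter fun x : Fˣ =>
      Algebra.trace (ZMod p) F (m * x ^ 3 + n * (x⁻¹ : Fˣ) ^ 2) = a
  have hy (x : N) : ∃ y : F, y ^ p - y = m * (x : Fˣ) ^ 3 + n * ((x : Fˣ)⁻¹ : Fˣ) ^ 2 + c := by
    refine exists_pow_sub_self_eq ?_
    rw [map_add, hc, (Finset.mem_filter.1 x.2).2, add_neg_cancel]
  choose y hy using hy
  set g : F[X] := C m * X ^ (p + 3) + C n * X ^ (p - 2) + C c * X ^ p with hgdef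
  have hg : g.natDegree = p + 3 := by
    rw [hgdef, add_assoc]
    rw [natDegree_add_eq_left_of_natDegree_lt, natDegree_C_mul_X_pow _ _ hm]
    rw [natDegree_C_mul_X_pow _ _ hm]
    refine (natDegree_add_le_of_degree_le (n := p) ?_ ?_).trans_lt (by omega)
    · exact (natDegree_C_mul_X_pow_le _ _).trans (by omega)
    · exact natDegree_C_mul_X_pow_le _ _
  refine le_trans ?_ (card_points_le hp hp5 hg hμ hF
    (Finset.univ.filter fun P => evalAt P (curvePoly p g) = 0) (by simp))
  let f : ZMod p × N → F × F := fun jx =>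
    (((jx.2 : Fˣ) : F), ((jx.2 : Fˣ) : F) * (y jx.2 + algebraMap (ZMod p) F jx.1))
  have hf : Function.Injective f := by
    rintro ⟨j, x⟩ ⟨j', x'⟩ h
    obtain ⟨h1, h2⟩ := Prod.ext_iff.1 h
    obtain rfl : x = x' := Subtype.ext (Units.ext h1)
    simp only [f, mul_eq_mul_left_iff, Units.ne_zero, or_false, add_right_inj] at h2
    rw [(algebraMap (ZMod p) F).injective h2]
  have hcard : p * N.card = (Finset.univ.image f).card := by
    rw [Finset.card_image_of_injective _ hf, Finset.card_univ, Fintype.card_prod, ZMod.card,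
      Fintype.card_coe]
  rw [hcard]
  refine Finset.card_le_card fun P hP => ?_
  obtain ⟨⟨j, x⟩, -, rfl⟩ := Finset.mem_image.1 hP
  rw [Finset.mem_filter]
  refine ⟨Finset.mem_univ _, ?_⟩
  have hx : ((x : Fˣ) : F) ≠ 0 := Units.ne_zero _
  have h1 := hy x
  rw [Units.val_inv_eq_inv_val] at h1
  obtain ⟨w, hw⟩ : ∃ w, p = w + 2 := ⟨p - 2, by omega⟩
  have hj : (algebraMap (ZMod p) F j) ^ p = algebraMap (ZMod p) F j := by
    rw [← map_pow, ZMod.pow_card]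
  simp only [f, curvePoly, hgdef, map_sub, map_add, map_mul, map_pow, evalAt_X, evalAt_C, eval_X,
    eval_C]
  generalize ((x : Fˣ) : F) = X at *
  rw [mul_pow, add_pow_char, hj, show p - 2 = w by omega, show p - 1 = w + 1 by omega]
  have h2 : X ^ w * X * X * (X⁻¹ ^ 2) = X ^ w := by field_simp
  rw [eq_add_of_sub_eq h1]
  have h3 : X ^ p = X ^ w * X * X := by rw [hw]; ring
  rw [pow_add X p, h3, pow_succ X w]
  linear_combination n * h2

theorem norm_sum_trace_le [DecidableEq F] (hp5 : 5 ≤ p) {μ : ℕ} (hμ : 3 ≤ μ)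
    (hF : Fintype.card F = (p ^ μ) ^ 2) {m : F} (hm : m ≠ 0) (n : F) {ψ : AddChar (ZMod p) ℂ}
    (hψ : ψ ≠ 1) :
    ‖∑ x : Fˣ, ψ (Algebra.trace (ZMod p) F (m * x ^ 3 + n * (x⁻¹ : Fˣ) ^ 2))‖ ≤
      12 * (p : ℝ) ^ 2 * p ^ μ := by
  classical
  have hp : p.Prime := Fact.out
  set T : Fˣ → ZMod p := fun x => Algebra.trace (ZMod p) F (m * x ^ 3 + n * (x⁻¹ : Fˣ) ^ 2)
  set N : ZMod p → ℝ := fun a => ((Finset.univ.filter fun x => T x = a).card : ℝ)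
  set M : ℝ := ((p ^ μ) ^ 2 + 11 * p ^ 2 * p ^ μ) / p
  have hp0 : (0 : ℝ) < p := by exact_mod_cast hp.pos
  have hN (a) : N a ≤ M := by
    rw [le_div_iff₀ hp0, mul_comm]
    have := card_trace_fiber_le hp5 hμ hF hm n a
    simp only [N, T]
    exact_mod_cast this
  have hS : ∑ x : Fˣ, ψ (T x) = ∑ a, ((N a - M : ℝ) : ℂ) * ψ a := by
    simp only [Complex.ofReal_sub, sub_mul, Finset.sum_sub_distrib, ← Finset.mul_sum]
    rw [AddChar.sum_eq_zero_of_ne_one hψ, mul_zero, sub_zero,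
      ← Finset.sum_fiberwise _ T]
    refine Finset.sum_congr rfl fun a _ => ?_
    rw [Finset.sum_congr rfl (g := fun _ => ψ a) (fun x hx => by rw [(Finset.mem_filter.1 hx).2]),
      Finset.sum_const, nsmul_eq_mul]
    simp [N]
  have hsum : ∑ a, N a = (p ^ μ : ℝ) ^ 2 - 1 := by
    have := Finset.card_eq_sum_card_fiberwise (f := T) (s := Finset.univ) (t := Finset.univ)
      (by simp [Set.MapsTo])
    rw [Finset.card_univ, Fintype.card_units, hF] at this
    have h1 : 1 ≤ (p ^ μ) ^ 2 := Nat.one_le_pow _ _ (Nat.pow_pos hp.pos)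
    have h2 := congrArg (Nat.cast (R := ℝ)) this
    push_cast [h1] at h2
    simp only [N]
    rw [← h2]
  rw [hS]
  refine (norm_sum_le _ _).trans ?_
  calc ∑ a, ‖((N a - M : ℝ) : ℂ) * ψ a‖ = ∑ a, (M - N a) := by
        refine Finset.sum_congr rfl fun a _ => ?_
        rw [norm_mul, AddChar.norm_apply, mul_one, Complex.norm_real, Real.norm_eq_abs,
          abs_of_nonpos (sub_nonpos.2 (hN a)), neg_sub]
    _ = 11 * p ^ 2 * p ^ μ + 1 := by
        rw [Finset.sum_sub_distrib, hsum, Finset.sum_const, Finset.card_univ, ZMod.card,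
          nsmul_eq_mul]
        simp only [M]
        field_simp
        ring
    _ ≤ _ := by
        have h1 : (1 : ℝ) ≤ p := by exact_mod_cast hp.one_le
        have h2 : (1 : ℝ) ≤ p ^ 2 * p ^ μ := by
          rw [← pow_add]; exact one_le_pow₀ h1
        linarith

end EvenMoment

section Weight

variable {K : Type u} [Field K]

/-- For `f = ∏ (X - β)` with nonzero constant term, the sum of `m β ^ 3 + n β ^ (-2)`. -/
noncomputable def rootWeight (m n : K) (f : K[X]) : K :=
  m * (-f.reverse.coeff 1 ^ 3 + 3 * f.reverse.coeff 1 * f.reverse.coeff 2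
    - 3 * f.reverse.coeff 3) +
  n * ((f.coeff 1 / f.coeff 0) ^ 2 - 2 * (f.coeff 2 / f.coeff 0))

theorem mul_coeff_two' {R : Type*} [Semiring R] (f g : R[X]) :
    (f * g).coeff 2 = f.coeff 0 * g.coeff 2 + f.coeff 1 * g.coeff 1 + f.coeff 2 * g.coeff 0 := by
  simp [coeff_mul, Finset.Nat.antidiagonal_succ, add_assoc]

theorem mul_coeff_three' {R : Type*} [Semiring R] (f g : R[X]) :
    (f * g).coeff 3 = f.coeff 0 * g.coeff 3 + f.coeff 1 * g.coeff 2 + f.coeff 2 * g.coeff 1 +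
      f.coeff 3 * g.coeff 0 := by
  simp [coeff_mul, Finset.Nat.antidiagonal_succ, add_assoc]

theorem rootWeight_mul (m n : K) {f g : K[X]} (hf : f.Monic) (hg : g.Monic)
    (hf0 : f.coeff 0 ≠ 0) (hg0 : g.coeff 0 ≠ 0) :
    rootWeight m n (f * g) = rootWeight m n f + rootWeight m n g := by
  have h1 : f.reverse.coeff 0 = 1 := by rw [coeff_zero_reverse, hf.leadingCoeff]
  have h2 : g.reverse.coeff 0 = 1 := by rw [coeff_zero_reverse, hg.leadingCoeff]
  simp only [rootWeight, reverse_mul_of_domain, mul_coeff_two', mul_coeff_three', mul_coeff_one,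
    mul_coeff_zero, h1, h2]
  field_simp
  ring

theorem rootWeight_one (m n : K) : rootWeight m n 1 = 0 := by
  have : (1 : K[X]).reverse = 1 := by rw [← C_1, reverse_C]
  simp [rootWeight, coeff_one, this]

theorem rootWeight_pow (m n : K) {f : K[X]} (hf : f.Monic) (hf0 : f.coeff 0 ≠ 0) (j : ℕ) :
    rootWeight m n (f ^ j) = j * rootWeight m n f := by
  induction j with
  | zero => simp [rootWeight_one]
  | succ j ih =>
    rw [pow_succ, rootWeight_mul m n (hf.pow j) hf ?_ hf0, ih]
    · push_cast; ring
    · rw [coeff_zero_eq_eval_zero, eval_pow, ← coeff_zero_eq_eval_zero]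
      exact pow_ne_zero _ hf0

theorem rootWeight_X_sub_C (m n : K) {β : K} (hβ : β ≠ 0) :
    rootWeight m n (X - C β) = m * β ^ 3 + n * β⁻¹ ^ 2 := by
  have h0 : (X - C β).reverse.coeff 1 = -β := by
    rw [coeff_one_reverse, nextCoeff_X_sub_C]
  have h (j : ℕ) (hj : 2 ≤ j) : (X - C β).reverse.coeff j = 0 := by
    refine coeff_eq_zero_of_natDegree_lt (lt_of_le_of_lt (reverse_natDegree_le _) ?_)
    rw [natDegree_X_sub_C]
    exact hj
  simp only [rootWeight, h0, h 2 le_rfl, h 3 (by norm_num)]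
  simp [coeff_X, coeff_C]
  field_simp

theorem rootWeight_prod (m n : K) (s : Multiset K) (hs : ∀ β ∈ s, β ≠ 0) :
    rootWeight m n (s.map fun β => X - C β).prod =
      (s.map fun β => m * β ^ 3 + n * β⁻¹ ^ 2).sum := by
  induction s using Multiset.induction with
  | empty => simp [rootWeight_one]
  | cons β s ih =>
    rw [Multiset.map_cons, Multiset.prod_cons, Multiset.map_cons, Multiset.sum_cons,
      rootWeight_mul m n (monic_X_sub_C β) (monic_multisetProd_X_sub_C s), ih,
      rootWeight_X_sub_C m n (hs β (Multiset.mem_cons_self _ _))]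
    · exact fun γ hγ => hs γ (Multiset.mem_cons_of_mem hγ)
    · simpa using hs β (Multiset.mem_cons_self _ _)
    · rw [coeff_zero_eq_eval_zero, eval_multiset_prod, Multiset.map_map]
      refine Multiset.prod_ne_zero fun h => ?_
      obtain ⟨γ, hγ, h⟩ := Multiset.mem_map.1 h
      exact hs γ (Multiset.mem_cons_of_mem hγ) (by simpa using h)

theorem rootWeight_map {L : Type*} [Field L] (φ : K →+* L) (m n : K) (f : K[X]) :
    rootWeight (φ m) (φ n) (f.map φ) = φ (rootWeight m n f) := by
  have : (f.map φ).reverse = f.reverse.map φ := by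
    ext i
    simp [coeff_reverse]
  simp only [rootWeight, this, coeff_map, map_add, map_sub, map_mul, map_neg, map_pow, map_div₀,
    map_ofNat]

end Weight

section Trace

variable {p : ℕ} [Fact p.Prime] {L : Type u} [Field L] [Algebra (ZMod p) L]

/-- The orbit of `x` under Frobenius consists of the roots of its minimal polynomial. -/
theorem map_minpoly_eq_prod {x : L} (hx : IsIntegral (ZMod p) x) :
    (minpoly (ZMod p) x).map (algebraMap (ZMod p) L) =
      (((Finset.range (minpoly (ZMod p) x).natDegree).val.map fun i => x ^ p ^ i).map
        fun β => X - C β).prod := by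
  classical
  have hp : p.Prime := Fact.out
  have : CharP L p := charP_of_injective_algebraMap (algebraMap (ZMod p) L).injective p
  set P := minpoly (ZMod p) x
  have hmon : (P.map (algebraMap (ZMod p) L)).Monic := (minpoly.monic hx).map _
  have hirr := minpoly.irreducible hx
  have hperiod {j : ℕ} (h : x ^ p ^ j = x) : P.natDegree ∣ j := by
    rw [hirr.natDegree_dvd_iff_dvd_X_pow_card_pow_sub_X, Nat.card_zmod]
    exact minpoly.dvd _ _ (by simp [h])
  have hinj : Set.InjOn (fun i => x ^ p ^ i) (Finset.range P.natDegree) := by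
    intro i hi j hj h
    wlog hij : i ≤ j generalizing i j
    · exact (this hj hi h.symm (by omega)).symm
    obtain ⟨k, rfl⟩ := Nat.exists_eq_add_of_le hij
    have h1 : (x ^ p ^ k) ^ p ^ i = x ^ p ^ i := by
      rw [← pow_mul, ← pow_add, add_comm k]
      exact h.symm
    have h2 := hperiod (iterateFrobenius_inj L p i h1)
    have h3 := Finset.mem_range.1 (Finset.mem_coe.1 hj)
    have := Nat.eq_zero_of_dvd_of_lt h2 (by omega)
    omega
  have hnd : ((Finset.range P.natDegree).val.map fun i => x ^ p ^ i).Nodup :=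
    Multiset.Nodup.map_on (fun i hi j hj => hinj hi hj) (Finset.nodup _)
  have hle : (Finset.range P.natDegree).val.map (fun i => x ^ p ^ i) ≤
      (P.map (algebraMap (ZMod p) L)).roots := by
    rw [Multiset.le_iff_subset hnd]
    intro β hβ
    obtain ⟨i, -, rfl⟩ := Multiset.mem_map.1 hβ
    rw [mem_roots hmon.ne_zero, IsRoot, eval_map, ← aeval_def]
    clear hβ
    induction i with
    | zero => simp [P]
    | succ i ih => rw [pow_succ, pow_mul, ← expand_aeval, ZMod.expand_card, map_pow, ih,
        zero_pow hp.ne_zero]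
  have heq : (Finset.range P.natDegree).val.map (fun i => x ^ p ^ i) =
      (P.map (algebraMap (ZMod p) L)).roots := by
    refine Multiset.eq_of_le_of_card_le hle ((card_roots' _).trans ?_)
    simp
  rw [heq]
  refine (prod_multiset_X_sub_C_of_monic_of_roots_card_eq hmon ?_).symm
  rw [← heq]
  simp

theorem pow_natDegree_minpoly {x : L} (hx : IsIntegral (ZMod p) x) :
    x ^ p ^ (minpoly (ZMod p) x).natDegree = x := by
  have h := ((minpoly.irreducible hx).natDegree_dvd_iff_dvd_X_pow_card_pow_sub_X
    (n := (minpoly (ZMod p) x).natDegree)).1 dvd_rfl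
  rw [Nat.card_zmod] at h
  have := map_eq_of_dvd_sub (aeval x : (ZMod p)[X] →ₐ[ZMod p] L).toRingHom (minpoly.aeval _ x) h
  simpa using this

theorem natDegree_minpoly_dvd [Finite L] (x : L) :
    (minpoly (ZMod p) x).natDegree ∣ Module.finrank (ZMod p) L :=
  minpoly.degree_dvd (Algebra.IsIntegral.isIntegral x)

/-- The characteristic polynomial of `x` over the prime field. -/
noncomputable def primeCharpoly (p : ℕ) [Fact p.Prime] [Algebra (ZMod p) L] (x : L) : (ZMod p)[X] :=
  minpoly (ZMod p) x ^ (Module.finrank (ZMod p) L / (minpoly (ZMod p) x).natDegree)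

theorem rootWeight_primeCharpoly [Finite L] (m n : ZMod p) {x : L} (hx0 : x ≠ 0) :
    rootWeight m n (primeCharpoly p x) = Algebra.trace (ZMod p) L
      (algebraMap _ L m * x ^ 3 + algebraMap _ L n * x⁻¹ ^ 2) := by
  have hp : p.Prime := Fact.out
  have : CharP L p := charP_of_injective_algebraMap (algebraMap (ZMod p) L).injective p
  have hx : IsIntegral (ZMod p) x := Algebra.IsIntegral.isIntegral x
  set y := algebraMap _ L m * x ^ 3 + algebraMap _ L n * x⁻¹ ^ 2
  obtain ⟨k, hk⟩ := natDegree_minpoly_dvd (p := p) x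
  set e := (minpoly (ZMod p) x).natDegree
  have he : 0 < e := minpoly.natDegree_pos hx
  have hy (i : ℕ) : algebraMap _ L m * (x ^ p ^ i) ^ 3 + algebraMap _ L n * (x ^ p ^ i)⁻¹ ^ 2 =
      y ^ p ^ i := by
    simp only [y]
    rw [add_pow_char_pow, mul_pow, mul_pow, ← map_pow, ← map_pow, ZMod.pow_card_pow,
      ZMod.pow_card_pow, ← inv_pow, pow_right_comm x, pow_right_comm x⁻¹]
  have hye : y ^ p ^ e = y := by
    rw [← hy, pow_natDegree_minpoly hx]
  have hsum (k : ℕ) :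
      ∑ i ∈ Finset.range (e * k), y ^ p ^ i = k * ∑ i ∈ Finset.range e, y ^ p ^ i := by
    have hper (k : ℕ) : y ^ p ^ (e * k) = y := by
      induction k with
      | zero => simp
      | succ k ih => rw [mul_add, mul_one, pow_add, pow_mul, ih, hye]
    induction k with
    | zero => simp
    | succ k ih =>
      rw [mul_add, mul_one, Finset.sum_range_add, ih]
      simp only [pow_add, pow_mul y, hper]
      push_cast
      ring
  refine (algebraMap (ZMod p) L).injective ?_
  rw [FiniteField.algebraMap_trace_eq_sum_pow, Nat.card_zmod, hk, hsum, primeCharpoly, hk,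
    Nat.mul_div_cancel_left _ he, rootWeight_pow _ _ (minpoly.monic hx)
      (minpoly.coeff_zero_ne_zero hx hx0), map_mul, map_natCast, ← rootWeight_map,
      map_minpoly_eq_prod hx, rootWeight_prod]
  · rw [Multiset.map_map]
    congr 1
    refine Finset.sum_congr rfl fun i _ => ?_
    exact hy i
  · intro β hβ
    obtain ⟨i, -, rfl⟩ := Multiset.mem_map.1 hβ
    exact pow_ne_zero _ hx0

end Trace

section Count

open UniqueFactorizationMonoid

variable {p : ℕ} [Fact p.Prime]

theorem card_minpoly_eq {L : Type u} [Field L] [Fintype L] [DecidableEq L] [Algebra (ZMod p) L]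
    [DecidableEq (ZMod p)[X]]
    {P : (ZMod p)[X]} (hP : Irreducible P) (hm : P.Monic)
    (hd : P.natDegree ∣ Module.finrank (ZMod p) L) :
    (Finset.univ.filter fun x : L => minpoly (ZMod p) x = P).card = P.natDegree := by
  have hsplit : Splits (P.map (algebraMap (ZMod p) L)) := by
    have h1 := FiniteField.splits_X_pow_nat_card_sub_X p (K := L)
    rw [hP.natDegree_dvd_iff_dvd_X_pow_card_pow_sub_X, Nat.card_zmod,
      FiniteField.pow_finrank_eq_natCard p] at hd
    refine h1.of_dvd ?_ (map_dvd (mapRingHom (algebraMap (ZMod p) L)) hd)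
    rw [Polynomial.map_sub, Polynomial.map_pow, map_X]
    exact FiniteField.X_pow_card_sub_X_ne_zero L Finite.one_lt_card
  rw [← card_rootSet_eq_natDegree (PerfectField.separable_of_irreducible hP) hsplit,
    ← Set.toFinset_card]
  congr 1
  ext x
  rw [Finset.mem_filter, Set.mem_toFinset, mem_rootSet]
  refine ⟨?_, fun ⟨_, h⟩ => ⟨Finset.mem_univ _,
    (minpoly.eq_of_irreducible_of_monic hP h hm).symm⟩⟩
  rintro ⟨-, rfl⟩
  exact ⟨hP.ne_zero, minpoly.aeval _ _⟩

theorem pow_dvd_iff_le_count [DecidableEq (ZMod p)[X]] {f P : (ZMod p)[X]} (hf : f ≠ 0)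
    (hP : Irreducible P) (hm : P.Monic) (j : ℕ) :
    P ^ j ∣ f ↔ j ≤ (normalizedFactors f).count P := by
  rw [pow_dvd_iff_le_emultiplicity, emultiplicity_eq_count_normalizedFactors hP hf,
    hm.normalize_eq_self, Nat.cast_le]

theorem primeCharpoly_exponent_pos {L : Type u} [Field L] [Finite L] [Algebra (ZMod p) L] (x : L) :
    0 < Module.finrank (ZMod p) L / (minpoly (ZMod p) x).natDegree :=
  Nat.div_pos (Nat.le_of_dvd Module.finrank_pos (natDegree_minpoly_dvd x))
    (minpoly.natDegree_pos (Algebra.IsIntegral.isIntegral x))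

theorem primeCharpoly_monic {L : Type u} [Field L] [Finite L] [Algebra (ZMod p) L] (x : L) :
    (primeCharpoly p x).Monic :=
  (minpoly.monic (Algebra.IsIntegral.isIntegral x)).pow _

theorem primeCharpoly_natDegree {L : Type u} [Field L] [Finite L] [Algebra (ZMod p) L] (x : L) :
    (primeCharpoly p x).natDegree = Module.finrank (ZMod p) L := by
  rw [primeCharpoly, natDegree_pow, Nat.div_mul_cancel (natDegree_minpoly_dvd x)]

open Classical in
theorem card_primeCharpoly_dvd {L : Type u} [Field L] [Fintype L] [Algebra (ZMod p) L]
    {f : (ZMod p)[X]} (hf : f ≠ 0) :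
    (Finset.univ.filter fun x : L => primeCharpoly p x ∣ f).card =
      ∑ P ∈ (normalizedFactors f).toFinset,
        if P.natDegree ∣ Module.finrank (ZMod p) L ∧
          Module.finrank (ZMod p) L / P.natDegree ≤ (normalizedFactors f).count P
        then P.natDegree else 0 := by
  rw [Finset.card_eq_sum_card_fiberwise (f := fun x : L => minpoly (ZMod p) x)
    (t := (normalizedFactors f).toFinset)]
  · refine Finset.sum_congr rfl fun P hP => ?_
    rw [Multiset.mem_toFinset, Polynomial.mem_normalizedFactors_iff hf] at hP
    rw [Finset.filter_filter]
    split_ifs with h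
    · rw [← card_minpoly_eq hP.1 hP.2.1 h.1]
      congr 1
      ext x
      simp only [Finset.mem_filter, Finset.mem_univ, true_and, and_iff_right_iff_imp]
      rintro rfl
      rw [primeCharpoly, pow_dvd_iff_le_count hf hP.1 hP.2.1]
      exact h.2
    · rw [Finset.card_eq_zero, Finset.filter_eq_empty_iff]
      rintro x - ⟨h1, rfl⟩
      rw [primeCharpoly, pow_dvd_iff_le_count hf hP.1 hP.2.1] at h1
      exact h ⟨natDegree_minpoly_dvd x, h1⟩
  · intro x hx
    have hx' : primeCharpoly p x ∣ f := by simpa using hx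
    have hi : IsIntegral (ZMod p) x := Algebra.IsIntegral.isIntegral x
    simp only [Finset.mem_coe, Multiset.mem_toFinset]
    rw [Polynomial.mem_normalizedFactors_iff hf]
    exact ⟨minpoly.irreducible hi, minpoly.monic hi,
      (dvd_pow_self _ (primeCharpoly_exponent_pos x).ne').trans hx'⟩

noncomputable instance (p : ℕ) [Fact p.Prime] (r : ℕ) : Fintype (GaloisField p r) :=
  Fintype.ofFinite _

open Classical in
/-- Counting, over all extensions, the elements whose characteristic polynomial divides `f`. -/
theorem sum_card_primeCharpoly_dvd {f : (ZMod p)[X]} (hf : f.Monic) :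
    ∑ r ∈ Finset.Icc 1 f.natDegree,
      (Finset.univ.filter fun x : GaloisField p r => primeCharpoly p x ∣ f).card =
      f.natDegree := by
  have hf0 := hf.ne_zero
  have hdeg : f.natDegree = ∑ P ∈ (normalizedFactors f).toFinset,
      (normalizedFactors f).count P * P.natDegree := by
    conv_lhs => rw [← hf.normalize_eq_self, ← prod_normalizedFactors_eq hf0,
      natDegree_multiset_prod _ (zero_notMem_normalizedFactors f)]
    rw [Finset.sum_multiset_map_count]
    simp
  rw [Finset.sum_congr rfl fun r _ => card_primeCharpoly_dvd hf0, Finset.sum_comm]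
  conv_rhs => rw [hdeg]
  refine Finset.sum_congr rfl fun P hP => ?_
  have hP' := hP
  rw [Multiset.mem_toFinset, Polynomial.mem_normalizedFactors_iff hf0] at hP'
  have he : 0 < P.natDegree := hP'.1.natDegree_pos
  have hle : (normalizedFactors f).count P * P.natDegree ≤ f.natDegree := by
    conv_rhs => rw [hdeg]
    exact Finset.single_le_sum (f := fun P => (normalizedFactors f).count P * P.natDegree)
      (fun _ _ => Nat.zero_le _) hP
  set e := P.natDegree
  set c := (normalizedFactors f).count P
  rw [← Finset.sum_filter, Finset.sum_const, smul_eq_mul]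
  congr 1
  refine Eq.trans (Eq.symm ?_) (show (Finset.Icc 1 c).card = c by simp)
  refine Finset.card_bij (fun j _ => j * e) ?_ ?_ ?_
  · intro j hj
    rw [Finset.mem_Icc] at hj
    have h1 : 1 ≤ j * e := Nat.mul_pos hj.1 he
    rw [Finset.mem_filter, Finset.mem_Icc, GaloisField.finrank p (by omega)]
    exact ⟨⟨h1, (Nat.mul_le_mul_right e hj.2).trans hle⟩, dvd_mul_left _ _,
      by rw [Nat.mul_div_cancel _ he]; exact hj.2⟩
  · intro i _ j _ h
    exact Nat.eq_of_mul_eq_mul_right he h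
  · intro r hr
    rw [Finset.mem_filter, Finset.mem_Icc] at hr
    rw [GaloisField.finrank p (by omega)] at hr
    obtain ⟨⟨h1, h2⟩, ⟨j, rfl⟩, h3⟩ := hr
    rw [Nat.mul_div_cancel_left _ he] at h3
    exact ⟨j, Finset.mem_Icc.2 ⟨Nat.pos_of_mul_pos_left h1, h3⟩, mul_comm _ _⟩

end Count

section LFunction

variable {p : ℕ} [Fact p.Prime]

open Classical in
/-- The monic polynomials of degree `d` over the prime field. -/
noncomputable def monicSet (p : ℕ) [Fact p.Prime] (d : ℕ) : Finset (ZMod p)[X] :=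
  Finset.univ.image fun c : Fin d → ZMod p => X ^ d + ∑ i, C (c i) * X ^ (i : ℕ)

theorem mem_monicSet {d : ℕ} {f : (ZMod p)[X]} :
    f ∈ monicSet p d ↔ f.Monic ∧ f.natDegree = d := by
  have hdeg (c : Fin d → ZMod p) : (∑ i, C (c i) * X ^ (i : ℕ)).degree < (d : WithBot ℕ) :=
    degree_sum_fin_lt c
  simp only [monicSet, Finset.mem_image, Finset.mem_univ, true_and]
  constructor
  · rintro ⟨c, rfl⟩
    exact ⟨monic_X_pow_add (hdeg c), natDegree_eq_of_degree_eq_some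
      (by rw [degree_add_eq_left_of_degree_lt (by simpa using hdeg c), degree_X_pow])⟩
  · rintro ⟨hf, rfl⟩
    refine ⟨fun i => f.coeff i, ?_⟩
    rw [Fin.sum_univ_eq_sum_range (fun i => C (f.coeff i) * X ^ i)]
    exact hf.as_sum.symm

/-- The multiplicative function on monic polynomials attached to an additive character. -/
noncomputable def polyChar (ψ : AddChar (ZMod p) ℂ) (m n : ZMod p) (f : (ZMod p)[X]) : ℂ :=
  if f.coeff 0 = 0 then 0 else ψ (rootWeight m n f)

variable (ψ : AddChar (ZMod p) ℂ) (m n : ZMod p)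

theorem polyChar_mul {f g : (ZMod p)[X]} (hf : f.Monic) (hg : g.Monic) :
    polyChar ψ m n (f * g) = polyChar ψ m n f * polyChar ψ m n g := by
  simp only [polyChar, mul_coeff_zero, mul_eq_zero]
  by_cases h1 : f.coeff 0 = 0
  · simp [h1]
  by_cases h2 : g.coeff 0 = 0
  · simp [h2]
  simp [h1, h2, rootWeight_mul m n hf hg h1 h2, AddChar.map_add_eq_mul]

/-- The coefficients of the L-function. -/
noncomputable def lCoeff (d : ℕ) : ℂ := ∑ f ∈ monicSet p d, polyChar ψ m n f

/-- The exponential sum over the extension of degree `r`. -/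
noncomputable def extSum (r : ℕ) : ℂ := ∑ x : GaloisField p r, polyChar ψ m n (primeCharpoly p x)

theorem lCoeff_zero : lCoeff ψ m n 0 = 1 := by
  have : monicSet p 0 = {1} := by
    ext f
    rw [mem_monicSet, Finset.mem_singleton]
    exact ⟨fun h => h.1.natDegree_eq_zero.1 h.2, by rintro rfl; simp⟩
  simp [lCoeff, this, polyChar, rootWeight_one]

open Classical in
theorem sum_monicSet_dvd {d r : ℕ} (hr : r ≤ d) {g : (ZMod p)[X]} (hg : g.Monic)
    (hgr : g.natDegree = r) :
    ∑ f ∈ monicSet p d with g ∣ f, polyChar ψ m n f =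
      polyChar ψ m n g * lCoeff ψ m n (d - r) := by
  rw [lCoeff, Finset.mul_sum]
  symm
  refine Finset.sum_bij (fun f _ => g * f) ?_ ?_ ?_ ?_
  · intro f hf
    rw [mem_monicSet] at hf
    rw [Finset.mem_filter, mem_monicSet]
    exact ⟨⟨hg.mul hf.1, by rw [hg.natDegree_mul hf.1]; omega⟩, dvd_mul_right _ _⟩
  · intro f _ f' _ h
    exact mul_left_cancel₀ hg.ne_zero h
  · intro f hf
    rw [Finset.mem_filter, mem_monicSet] at hf
    obtain ⟨⟨h1, h2⟩, f', rfl⟩ := hf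
    have h3 := hg.of_mul_monic_left h1
    rw [hg.natDegree_mul h3] at h2
    exact ⟨f', mem_monicSet.2 ⟨h3, by omega⟩, rfl⟩
  · intro f hf
    rw [polyChar_mul ψ m n hg (mem_monicSet.1 hf).1]

/-- The logarithmic derivative of the Euler product. -/
theorem mul_lCoeff (d : ℕ) :
    (d : ℂ) * lCoeff ψ m n d = ∑ r ∈ Finset.Icc 1 d, extSum ψ m n r * lCoeff ψ m n (d - r) := by
  classical
  have h1 (f) (hf : f ∈ monicSet p d) : (d : ℂ) = ∑ r ∈ Finset.Icc 1 d, ∑ x : GaloisField p r,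
      if primeCharpoly p x ∣ f then (1 : ℂ) else 0 := by
    rw [mem_monicSet] at hf
    rw [← hf.2]
    conv_lhs => rw [← sum_card_primeCharpoly_dvd hf.1]
    push_cast
    refine Finset.sum_congr rfl fun r _ => ?_
    rw [Finset.sum_boole]
  rw [lCoeff, Finset.mul_sum, Finset.sum_congr rfl fun f hf => by rw [h1 f hf]]
  simp_rw [Finset.sum_mul]
  rw [Finset.sum_comm]
  refine Finset.sum_congr rfl fun r hr => ?_
  rw [Finset.mem_Icc] at hr
  rw [Finset.sum_comm, extSum, Finset.sum_mul]
  refine Finset.sum_congr rfl fun x _ => ?_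
  rw [← sum_monicSet_dvd ψ m n hr.2 (primeCharpoly_monic x)
    ((primeCharpoly_natDegree x).trans (GaloisField.finrank p (by omega))), Finset.sum_filter]
  refine Finset.sum_congr rfl fun f _ => ?_
  rw [ite_mul, one_mul, zero_mul]

theorem extSum_eq {r : ℕ} [DecidableEq (GaloisField p r)] :
    extSum ψ m n r = ∑ x : (GaloisField p r)ˣ, ψ (Algebra.trace (ZMod p) (GaloisField p r)
      (algebraMap _ _ m * x ^ 3 + algebraMap _ _ n * (x⁻¹ : (GaloisField p r)ˣ) ^ 2)) := by
  classical
  have h0 : polyChar ψ m n (primeCharpoly p (0 : GaloisField p r)) = 0 := by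
    have : (primeCharpoly p (0 : GaloisField p r)).coeff 0 = 0 := by
      rw [primeCharpoly, minpoly.zero, coeff_X_pow, if_neg]
      have := primeCharpoly_exponent_pos (p := p) (0 : GaloisField p r)
      rw [minpoly.zero] at this
      exact this.ne
    rw [polyChar, if_pos this]
  rw [extSum, ← Finset.sum_erase Finset.univ
    (f := fun x : GaloisField p r => polyChar ψ m n (primeCharpoly p x)) h0]
  symm
  refine Finset.sum_bij (fun x _ => (x : GaloisField p r)) ?_ ?_ ?_ ?_
  · intro x _
    simp
  · intro x _ y _ h
    exact Units.ext h
  · intro x hx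
    exact ⟨Units.mk0 x (Finset.ne_of_mem_erase hx), Finset.mem_univ _, rfl⟩
  · intro x _
    have hx : (x : GaloisField p r) ≠ 0 := x.ne_zero
    have : (primeCharpoly p (x : GaloisField p r)).coeff 0 ≠ 0 := by
      rw [primeCharpoly, coeff_zero_eq_eval_zero, eval_pow, ← coeff_zero_eq_eval_zero]
      exact pow_ne_zero _ (minpoly.coeff_zero_ne_zero (Algebra.IsIntegral.isIntegral _) hx)
    rw [polyChar, if_neg this, rootWeight_primeCharpoly m n hx, Units.val_inv_eq_inv_val]

theorem rootWeight_add_X_pow {d : ℕ} (hd : 6 ≤ d) {f : (ZMod p)[X]} (hf : f.natDegree = d)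
    (t : ZMod p) :
    rootWeight m n (f + C t * X ^ (d - 3)) = rootWeight m n f + -(3 * m * t) ∧
      (f + C t * X ^ (d - 3)).coeff 0 = f.coeff 0 := by
  have h1 : (C t * X ^ (d - 3)).natDegree < f.natDegree :=
    (natDegree_C_mul_X_pow_le _ _).trans_lt (by omega)
  have h2 : (f + C t * X ^ (d - 3)).natDegree = d := by
    rw [natDegree_add_eq_left_of_natDegree_lt h1, hf]
  have h3 (j : ℕ) (hj : j ≤ 2) : (f + C t * X ^ (d - 3)).coeff j = f.coeff j := by
    rw [coeff_add, coeff_C_mul_X_pow, if_neg (by omega), add_zero]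
  have h4 (j : ℕ) (hj : j ≤ 3) : (f + C t * X ^ (d - 3)).reverse.coeff j =
      f.reverse.coeff j + if j = 3 then t else 0 := by
    rw [coeff_reverse, coeff_reverse, h2, hf, revAt_le (by omega), coeff_add, coeff_C_mul_X_pow]
    congr 1
    exact if_congr (by omega) rfl rfl
  refine ⟨?_, h3 0 (by norm_num)⟩
  simp only [rootWeight]
  rw [h3 0 (by norm_num), h3 1 (by norm_num), h3 2 (by norm_num), h4 1 (by norm_num),
    h4 2 (by norm_num), h4 3 (by norm_num)]
  simp
  ring

theorem lCoeff_eq_zero (hp5 : 5 ≤ p) (hψ : ψ ≠ 1) (hm : m ≠ 0) {d : ℕ} (hd : 6 ≤ d) :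
    lCoeff ψ m n d = 0 := by
  obtain ⟨s, hs⟩ : ∃ s, ψ s ≠ 1 := by
    by_contra! h
    exact hψ (by ext s; simp [h s])
  have h3 : (3 : ZMod p) ≠ 0 := by
    have : ((3 : ℕ) : ZMod p) ≠ 0 := by
      rw [Ne, ZMod.natCast_eq_zero_iff]
      exact fun h => absurd (Nat.le_of_dvd (by norm_num) h) (by omega)
    exact_mod_cast this
  set t := -s / (3 * m)
  have ht : -(3 * m * t) = s := by
    simp only [t]
    field_simp
  have hmem (u : ZMod p) {f} (hf : f ∈ monicSet p d) : f + C u * X ^ (d - 3) ∈ monicSet p d := by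
    rw [mem_monicSet] at hf ⊢
    have h1 : (C u * X ^ (d - 3)).natDegree < f.natDegree :=
      (natDegree_C_mul_X_pow_le _ _).trans_lt (by omega)
    exact ⟨hf.1.add_of_left (degree_lt_degree h1),
      by rw [natDegree_add_eq_left_of_natDegree_lt h1, hf.2]⟩
  have h : lCoeff ψ m n d = ψ s * lCoeff ψ m n d := by
    conv_rhs => rw [lCoeff, Finset.mul_sum]
    rw [lCoeff]
    symm
    refine Finset.sum_nbij' (fun f => f + C t * X ^ (d - 3)) (fun f => f + C (-t) * X ^ (d - 3))
      (fun f hf => hmem t hf) (fun f hf => hmem (-t) hf) (fun f _ => by simp)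
      (fun f _ => by simp) ?_
    intro f hf
    obtain ⟨h1, h2⟩ := rootWeight_add_X_pow m n hd (mem_monicSet.1 hf).2 t
    rw [polyChar, polyChar, h1, h2, ht, AddChar.map_add_eq_mul]
    split_ifs <;> ring
  have h' : (1 - ψ s) * lCoeff ψ m n d = 0 := by linear_combination h
  rcases mul_eq_zero.1 h' with h0 | h0
  · exact absurd (sub_eq_zero.1 h0).symm hs
  · exact h0

theorem norm_extSum_even_le (hp5 : 5 ≤ p) (hψ : ψ ≠ 1) (hm : m ≠ 0) {μ : ℕ} (hμ : 3 ≤ μ) :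
    ‖extSum ψ m n (2 * μ)‖ ≤ 12 * (p : ℝ) ^ 2 * p ^ μ := by
  classical
  rw [extSum_eq]
  refine norm_sum_trace_le hp5 hμ ?_ (by simpa using hm) _ hψ
  rw [← Nat.card_eq_fintype_card, GaloisField.card p _ (by omega), ← pow_mul, mul_comm]

end LFunction

section PowerSums

theorem exists_prod_one_sub (f : ℂ[X]) (hf : f.coeff 0 = 1) :
    ∃ Z : Multiset ℂ, Z.card ≤ f.natDegree ∧ f = (Z.map fun z => 1 - C z * X).prod := by
  have hf0 : f ≠ 0 := by
    rintro rfl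
    simp at hf
  refine ⟨f.roots.map fun z => z⁻¹, by simpa using f.card_roots', ?_⟩
  have hs := (IsAlgClosed.splits f).eq_prod_roots
  have h (Z : Multiset ℂ) (hZ : ∀ z ∈ Z, z ≠ 0) : ∃ c : ℂ, (Z.map fun z => X - C z).prod =
      C c * ((Z.map fun z => z⁻¹).map fun z => 1 - C z * X).prod := by
    induction Z using Multiset.induction with
    | empty => exact ⟨1, by simp⟩
    | cons z Z ih =>
      obtain ⟨c, hc⟩ := ih fun w hw => hZ w (Multiset.mem_cons_of_mem hw)
      have hz := hZ z (Multiset.mem_cons_self _ _)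
      refine ⟨-z * c, ?_⟩
      have h1 : (C z * C z⁻¹ : ℂ[X]) = 1 := by rw [← C_mul, mul_inv_cancel₀ hz, C_1]
      simp only [Multiset.map_cons, Multiset.prod_cons]
      rw [hc, C_mul, C_neg]
      linear_combination (-X * C c * ((Z.map fun z => z⁻¹).map fun z => 1 - C z * X).prod) * h1
  obtain ⟨c, hc⟩ := h f.roots (by
    intro z hz hz0
    rw [mem_roots hf0, IsRoot, hz0, ← coeff_zero_eq_eval_zero, hf] at hz
    exact one_ne_zero hz)
  rw [hc, ← mul_assoc, ← C_mul] at hs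
  have h1 (Z : Multiset ℂ) : (Z.map fun z => 1 - C z * X).prod.coeff 0 = 1 := by
    induction Z using Multiset.induction with
    | empty => simp
    | cons z Z ih =>
      rw [Multiset.map_cons, Multiset.prod_cons, mul_coeff_zero, ih]
      simp
  have h2 := congrArg (fun g => coeff g 0) hs
  simp only [hf] at h2
  rw [coeff_C_mul, h1, mul_one] at h2
  rwa [← h2, C_1, one_mul] at hs

/-- The generating series of the power sums of a multiset, without constant term. -/
noncomputable def powerSumSeries (Z : Multiset ℂ) : PowerSeries ℂ :=
  PowerSeries.mk fun r => if r = 0 then 0 else (Z.map fun z => z ^ r).sum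

theorem X_mul_derivative_prod (Z : Multiset ℂ) :
    PowerSeries.X * PowerSeries.derivative ℂ (Z.map fun z => 1 - C z * X).prod.toPowerSeries =
      -(powerSumSeries Z * (Z.map fun z => 1 - C z * X).prod.toPowerSeries) := by
  induction Z using Multiset.induction with
  | empty =>
    have : powerSumSeries 0 = 0 := by
      ext r
      simp [powerSumSeries]
    simp [this]
  | cons z Z ih =>
    have h1 : powerSumSeries (z ::ₘ Z) = powerSumSeries {z} + powerSumSeries Z := by
      ext r
      simp only [powerSumSeries, map_add, PowerSeries.coeff_mk]
      split_ifs <;> simp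
    have h2 : powerSumSeries {z} * (1 - PowerSeries.C z * PowerSeries.X) =
        PowerSeries.C z * PowerSeries.X := by
      ext r
      rw [mul_sub, mul_one, map_sub, mul_left_comm, PowerSeries.coeff_C_mul]
      rcases r with _ | r
      · simp [powerSumSeries]
      · rw [PowerSeries.coeff_succ_mul_X, PowerSeries.coeff_C_mul, PowerSeries.coeff_X]
        simp only [powerSumSeries, PowerSeries.coeff_mk]
        rcases r with _ | r
        · simp
        · simp [pow_succ]
          ring
    have h3 : ((1 - C z * X : ℂ[X]) : PowerSeries ℂ) = 1 - PowerSeries.C z * PowerSeries.X := by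
      simp
    have h4 : PowerSeries.derivative ℂ (1 - PowerSeries.C z * PowerSeries.X : PowerSeries ℂ) =
        -PowerSeries.C z := by
      simp
    rw [Multiset.map_cons, Multiset.prod_cons, Polynomial.coe_mul, h3, Derivation.leibniz, h1, h4,
      smul_eq_mul, smul_eq_mul]
    linear_combination (1 - PowerSeries.C z * PowerSeries.X) * ih +
      (Z.map fun z => 1 - C z * X).prod.toPowerSeries * h2

theorem eq_neg_power_sum {a S : ℕ → ℂ} {Z : Multiset ℂ} (ha0 : a 0 = 1)
    (hZ : ∀ d, ((Z.map fun z => 1 - C z * X).prod : ℂ[X]).coeff d = a d)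
    (hS : ∀ d : ℕ, (d : ℂ) * a d = ∑ r ∈ Finset.Icc 1 d, S r * a (d - r)) {r : ℕ} (hr : 1 ≤ r) :
    S r = -(Z.map fun z => z ^ r).sum := by
  set A : PowerSeries ℂ := (Z.map fun z => 1 - C z * X).prod.toPowerSeries with hA
  have hAc (d) : PowerSeries.coeff d A = a d := by rw [hA, Polynomial.coeff_coe, hZ]
  set G : PowerSeries ℂ := PowerSeries.mk fun r => if r = 0 then 0 else S r with hG
  have h1 : PowerSeries.X * PowerSeries.derivative ℂ A = G * A := by
    ext d
    rw [PowerSeries.coeff_mul d G A, Finset.Nat.sum_antidiagonal_eq_sum_range_succ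
      (fun i j => PowerSeries.coeff i G * PowerSeries.coeff j A), Finset.sum_range_succ']
    simp only [hAc, hG, PowerSeries.coeff_mk]
    have h2 : ∑ k ∈ Finset.range d, (if k + 1 = 0 then 0 else S (k + 1)) * a (d - (k + 1)) =
        d * a d := by
      rw [hS d, Finset.range_eq_Ico, Finset.sum_Ico_add'
        (fun k => (if k = 0 then 0 else S k) * a (d - k)) 0 d 1]
      refine Finset.sum_congr (by ext; simp) fun k hk => ?_
      rw [Finset.mem_Icc] at hk
      rw [if_neg (by omega)]
    rw [h2]
    rcases d with _ | d
    · simp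
    · rw [PowerSeries.coeff_succ_X_mul, PowerSeries.coeff_derivative, hAc]
      simp [mul_comm]
  have hA0 : A ≠ 0 := by
    intro h
    have := hAc 0
    rw [h, ha0] at this
    simp at this
  have h2 : G = -powerSumSeries Z := by
    refine mul_right_cancel₀ hA0 ?_
    rw [← h1, X_mul_derivative_prod, neg_mul]
  have h3 := congrArg (PowerSeries.coeff r) h2
  simpa [hG, powerSumSeries, show r ≠ 0 by omega] using h3

theorem norm_le_of_power_sums {Z : Multiset ℂ} {c R : ℝ} (hR : 0 < R) {k : ℕ}
    (h : ∀ μ, k ≤ μ → ‖(Z.map fun z => z ^ μ).sum‖ ≤ c * R ^ μ) {w : ℂ} (hw : w ∈ Z) : ‖w‖ ≤ R := by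
  classical
  by_contra! hlt
  set Q : ℂ[X] := ∏ z ∈ Z.toFinset.erase w, (X - C z) with hQ
  have hQw : Q.eval w ≠ 0 := by
    rw [hQ, eval_prod, Finset.prod_ne_zero_iff]
    intro z hz
    simpa [sub_eq_zero] using (Finset.ne_of_mem_erase hz).symm
  have hQz (z : ℂ) (hz : z ∈ Z.toFinset.erase w) : Q.eval z = 0 := by
    rw [hQ, eval_prod]
    exact Finset.prod_eq_zero hz (by simp)
  have key (μ : ℕ) : ∑ i ∈ Finset.range (Q.natDegree + 1),
      Q.coeff i * (Z.map fun z => z ^ (μ + i)).sum = Z.count w * (w ^ μ * Q.eval w) := by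
    have h1 (ν : ℕ) : (Z.map fun z => z ^ ν).sum = ∑ z ∈ Z.toFinset, Z.count z * z ^ ν := by
      rw [Finset.sum_multiset_map_count]
      simp
    simp_rw [h1, Finset.mul_sum]
    rw [Finset.sum_comm]
    have h2 (z : ℂ) : ∑ i ∈ Finset.range (Q.natDegree + 1), Q.coeff i * (Z.count z * z ^ (μ + i)) =
        Z.count z * (z ^ μ * Q.eval z) := by
      rw [eval_eq_sum_range, Finset.mul_sum, Finset.mul_sum]
      refine Finset.sum_congr rfl fun i _ => ?_
      ring
    simp_rw [h2]
    rw [← Finset.add_sum_erase _ _ (Multiset.mem_toFinset.2 hw), Finset.sum_eq_zero, add_zero]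
    intro z hz
    rw [hQz z hz]
    simp
  set D := ∑ i ∈ Finset.range (Q.natDegree + 1), ‖Q.coeff i‖ * (c * R ^ i) with hD
  have hbound (μ : ℕ) (hμ : k ≤ μ) : ‖w‖ ^ μ * ‖Q.eval w‖ ≤ D * R ^ μ := by
    have h1 : ‖(Z.count w * (w ^ μ * Q.eval w) : ℂ)‖ ≤ D * R ^ μ := by
      rw [← key μ, hD, Finset.sum_mul]
      refine norm_sum_le_of_le _ fun i _ => ?_
      rw [norm_mul]
      calc ‖Q.coeff i‖ * ‖(Z.map fun z => z ^ (μ + i)).sum‖ ≤ ‖Q.coeff i‖ * (c * R ^ (μ + i)) :=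
            mul_le_mul_of_nonneg_left (h _ (by omega)) (norm_nonneg _)
        _ = _ := by ring
    rw [norm_mul, norm_mul, norm_pow, Complex.norm_natCast] at h1
    have h2 : (1 : ℝ) ≤ Z.count w := by exact_mod_cast Multiset.one_le_count_iff_mem.2 hw
    refine le_trans ?_ h1
    exact le_mul_of_one_le_left (by positivity) h2
  have hQpos : 0 < ‖Q.eval w‖ := norm_pos_iff.2 hQw
  obtain ⟨N, hN⟩ := pow_unbounded_of_one_lt (D / ‖Q.eval w‖) ((one_lt_div hR).2 hlt)
  have hN' : D / ‖Q.eval w‖ < (‖w‖ / R) ^ (N + k) :=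
    hN.trans_le (pow_le_pow_right₀ ((one_lt_div hR).2 hlt).le (by omega))
  have h1 := hbound (N + k) (by omega)
  rw [div_lt_iff₀ hQpos, div_pow, div_mul_eq_mul_div, lt_div_iff₀ (by positivity)] at hN'
  linarith

end PowerSums

section PrimeBound

variable {p : ℕ} [Fact p.Prime] (ψ : AddChar (ZMod p) ℂ) (m n : ZMod p)

theorem norm_lCoeff_one_le (hp5 : 5 ≤ p) (hψ : ψ ≠ 1) (hm : m ≠ 0) :
    ‖lCoeff ψ m n 1‖ ≤ 5 * Real.sqrt p := by
  set A : ℂ[X] := ∑ i ∈ Finset.range 6, C (lCoeff ψ m n i) * X ^ i with hA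
  have hAc (d) : A.coeff d = lCoeff ψ m n d := by
    rw [hA]
    simp only [finsetSum_coeff, coeff_C_mul_X_pow]
    rw [Finset.sum_ite_eq, ite_eq_left_iff, Finset.mem_range]
    intro hd
    exact (lCoeff_eq_zero ψ m n hp5 hψ hm (by omega)).symm
  have hAd : A.natDegree ≤ 5 := by
    rw [natDegree_le_iff_coeff_eq_zero]
    intro d hd
    rw [hAc, lCoeff_eq_zero ψ m n hp5 hψ hm (by omega)]
  obtain ⟨Z, hZ1, hZ2⟩ := exists_prod_one_sub A (by rw [hAc, lCoeff_zero])
  have hS {r : ℕ} (hr : 1 ≤ r) : extSum ψ m n r = -(Z.map fun z => z ^ r).sum :=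
    eq_neg_power_sum (lCoeff_zero ψ m n) (fun d => by rw [← hZ2, hAc]) (mul_lCoeff ψ m n) hr
  have hp : (0 : ℝ) < p := by exact_mod_cast (by omega : 0 < p)
  have hz (z : ℂ) (h : z ∈ Z) : ‖z‖ ≤ Real.sqrt p := by
    have h1 : ‖z ^ 2‖ ≤ p := by
      refine norm_le_of_power_sums (Z := Z.map fun z => z ^ 2) (c := 12 * p ^ 2) hp (k := 3) ?_
        (Multiset.mem_map_of_mem _ h)
      intro μ hμ
      have := norm_extSum_even_le ψ m n hp5 hψ hm hμ
      rw [hS (by omega), norm_neg] at this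
      simpa [← pow_mul] using this
    rw [norm_pow] at h1
    exact Real.le_sqrt_of_sq_le h1
  have h1 : lCoeff ψ m n 1 = -(Z.map fun z => z).sum := by
    have := mul_lCoeff ψ m n 1
    simpa [lCoeff_zero, hS] using this
  rw [h1, norm_neg]
  have h2 (T : Multiset ℂ) (hT : ∀ z ∈ T, ‖z‖ ≤ Real.sqrt p) :
      ‖(T.map fun z => z).sum‖ ≤ T.card * Real.sqrt p := by
    induction T using Multiset.induction with
    | empty => simp
    | cons z T ih =>
      have h3 := ih fun w hw => hT w (Multiset.mem_cons_of_mem hw)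
      have h4 := hT z (Multiset.mem_cons_self _ _)
      rw [Multiset.map_cons, Multiset.sum_cons, Multiset.card_cons]
      push_cast
      linarith [norm_add_le z (T.map fun z => z).sum]
  refine (h2 Z hz).trans ?_
  have : (Z.card : ℝ) ≤ 5 := by exact_mod_cast hZ1.trans hAd
  exact mul_le_mul_of_nonneg_right this (Real.sqrt_nonneg _)

theorem lCoeff_one : lCoeff ψ m n 1 =
    ∑ x : (ZMod p)ˣ, ψ (m * x ^ 3 + n * (x⁻¹ : (ZMod p)ˣ) ^ 2) := by
  rw [lCoeff, ← Finset.sum_filter_add_sum_filter_not _ (fun f => f.coeff 0 = 0),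
    Finset.sum_eq_zero, zero_add]
  · symm
    refine Finset.sum_bij (fun x _ => X - C (x : ZMod p)) ?_ ?_ ?_ ?_
    · intro x _
      rw [Finset.mem_filter, mem_monicSet]
      exact ⟨⟨monic_X_sub_C _, natDegree_X_sub_C _⟩, by simp⟩
    · intro x _ y _ h
      simpa [Units.ext_iff] using h
    · intro f hf
      rw [Finset.mem_filter, mem_monicSet] at hf
      have h1 : f = X - C (-f.coeff 0) := by
        conv_lhs => rw [hf.1.1.eq_X_add_C hf.1.2]
        simp
      exact ⟨Units.mk0 (-f.coeff 0) (neg_ne_zero.2 hf.2), Finset.mem_univ _, h1.symm⟩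
    · intro x _
      rw [polyChar, if_neg (by simp), rootWeight_X_sub_C m n x.ne_zero, Units.val_inv_eq_inv_val]
  · intro f hf
    rw [polyChar, if_pos (Finset.mem_filter.1 hf).2]

theorem norm_prime_sum_le (hp5 : 5 ≤ p) (hψ : ψ ≠ 1) (hm : m ≠ 0) :
    ‖∑ x : (ZMod p)ˣ, ψ (m * x ^ 3 + n * (x⁻¹ : (ZMod p)ˣ) ^ 2)‖ ≤ 5 * Real.sqrt p := by
  rw [← lCoeff_one]
  exact norm_lCoeff_one_le ψ m n hp5 hψ hm

end PrimeBound

section ExpSum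

variable {R S : Type*} [CommRing R] [Fintype R] [DecidableEq R] [CommRing S] [Fintype S]
  [DecidableEq S]

/-- The exponential sum `∑ ψ (m u³ + n u⁻²)` over the units of a finite ring. -/
noncomputable def unitSum (ψ : AddChar R ℂ) (m n : R) : ℂ :=
  ∑ u : Rˣ, ψ (m * u ^ 3 + n * (u⁻¹ : Rˣ) ^ 2)

/-- The number of common annihilators of two elements. -/
noncomputable def annCount (m n : R) : ℕ := Nat.card {x : R // x * m = 0 ∧ x * n = 0}

theorem annCount_pos {A : Type*} [CommRing A] [Finite A] (m n : A) : 0 < annCount m n :=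
  Nat.card_pos_iff.2 ⟨⟨⟨0, by simp⟩⟩, inferInstance⟩

/-- Square root cancellation in `unitSum`, up to the constant `c` and common annihilators. -/
def SqrtCancel (R : Type*) [CommRing R] [Fintype R] [DecidableEq R] (c : ℝ) : Prop :=
  ∀ ψ : AddChar R ℂ, ψ.IsPrimitive → ∀ m n : R,
    ‖unitSum ψ m n‖ ^ 2 ≤ c * Fintype.card R * annCount m n

theorem norm_unitSum_le (ψ : AddChar R ℂ) (m n : R) : ‖unitSum ψ m n‖ ≤ Fintype.card R := by
  refine (norm_sum_le _ _).trans ?_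
  simp only [AddChar.norm_apply, Finset.sum_const, nsmul_eq_mul, mul_one, Finset.card_univ]
  exact_mod_cast Fintype.card_le_of_injective (fun u : Rˣ => (u : R)) fun u v h => Units.ext h

theorem SqrtCancel.congr (e : R ≃+* S) {c : ℝ} (h : SqrtCancel S c) : SqrtCancel R c := by
  intro ψ hψ m n
  set ψ' : AddChar S ℂ := ψ.compAddMonoidHom (e.symm : S →+ R) with hψ'
  have hap (x : R) : ψ' (e x) = ψ x := by simp [hψ']
  have hprim : ψ'.IsPrimitive := by
    intro a ha h1
    refine hψ (a := e.symm a) (by simpa using ha) ?_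
    ext x
    have := DFunLike.congr_fun h1 (e x)
    rw [AddChar.mulShift_apply] at this ⊢
    rw [← hap]
    simpa using this
  have h1 : unitSum ψ m n = unitSum ψ' (e m) (e n) := by
    refine Fintype.sum_equiv (Units.mapEquiv e.toMulEquiv).toEquiv _ _ fun u => ?_
    rw [← hap]
    simp [← map_inv]
  have h2 : annCount m n = annCount (e m) (e n) := by
    refine Nat.card_congr (e.toEquiv.subtypeEquiv fun x => ?_)
    simp [← map_mul]
  rw [h1, h2, Fintype.card_congr e.toEquiv]
  exact h ψ' hprim _ _

theorem SqrtCancel.prod {c d : ℝ} (hc : 0 ≤ c) (h1 : SqrtCancel R c) (h2 : SqrtCancel S d) :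
    SqrtCancel (R × S) (c * d) := by
  intro ψ hψ m n
  set ψ₁ : AddChar R ℂ := ψ.compAddMonoidHom (AddMonoidHom.inl R S) with hψ₁
  set ψ₂ : AddChar S ℂ := ψ.compAddMonoidHom (AddMonoidHom.inr R S) with hψ₂
  have hap (x : R × S) : ψ x = ψ₁ x.1 * ψ₂ x.2 := by
    simp [hψ₁, hψ₂, ← AddChar.map_add_eq_mul]
  have hp1 : ψ₁.IsPrimitive := by
    intro a ha h
    refine hψ (a := (a, 0)) (by simpa using ha) ?_
    ext x
    have := DFunLike.congr_fun h x.1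
    rw [AddChar.mulShift_apply] at this ⊢
    rw [hap]
    simpa using this
  have hp2 : ψ₂.IsPrimitive := by
    intro a ha h
    refine hψ (a := (0, a)) (by simpa using ha) ?_
    ext x
    have := DFunLike.congr_fun h x.2
    rw [AddChar.mulShift_apply] at this ⊢
    rw [hap]
    simpa using this
  have e1 : unitSum ψ m n = unitSum ψ₁ m.1 n.1 * unitSum ψ₂ m.2 n.2 := by
    rw [unitSum, unitSum, unitSum, Finset.sum_mul_sum, ← Fintype.sum_prod_type']
    refine Fintype.sum_equiv MulEquiv.prodUnits.toEquiv _ _ fun u => ?_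
    rw [hap]
    rfl
  have e2 : annCount m n = annCount m.1 n.1 * annCount m.2 n.2 := by
    rw [annCount, annCount, annCount, ← Nat.card_prod]
    refine Nat.card_congr ⟨fun x => ⟨⟨x.1.1, ?_⟩, ⟨x.1.2, ?_⟩⟩,
      fun x => ⟨(x.1.1, x.2.1), ?_⟩, fun x => rfl, fun x => rfl⟩
    · exact ⟨congrArg Prod.fst x.2.1, congrArg Prod.fst x.2.2⟩
    · exact ⟨congrArg Prod.snd x.2.1, congrArg Prod.snd x.2.2⟩
    · exact ⟨Prod.ext x.1.2.1 x.2.2.1, Prod.ext x.1.2.2 x.2.2.2⟩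
  rw [e1, e2, norm_mul, mul_pow, Fintype.card_prod]
  push_cast
  calc _ ≤ (c * Fintype.card R * annCount m.1 n.1) * (d * Fintype.card S * annCount m.2 n.2) :=
        mul_le_mul (h1 _ hp1 _ _) (h2 _ hp2 _ _) (by positivity) (by positivity)
    _ = _ := by ring

/-- The bound for quadratic Gauss sums. -/
theorem norm_quadratic_sum_sq_le {ψ : AddChar R ℂ} (hψ : ψ.IsPrimitive) (a b : R) :
    ‖∑ t : R, ψ (a * t + b * t ^ 2)‖ ^ 2 ≤
      Fintype.card R * ({d : R | 2 * b * d = 0} : Finset R).card := by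
  have h1 : ((‖∑ t : R, ψ (a * t + b * t ^ 2)‖ ^ 2 : ℝ) : ℂ) =
      ∑ d : R, ψ (a * d + b * d ^ 2) * ∑ t : R, ψ (t * (2 * b * d)) := by
    push_cast
    rw [← Complex.mul_conj', map_sum, Finset.sum_mul_sum]
    simp_rw [Finset.mul_sum]
    conv_lhs => rw [Finset.sum_comm]
    conv_rhs => rw [Finset.sum_comm]
    refine Finset.sum_congr rfl fun t _ => ?_
    refine Fintype.sum_equiv (Equiv.subRight t) _ _ fun s => ?_
    rw [← AddChar.map_neg_eq_conj, ← AddChar.map_add_eq_mul, ← AddChar.map_add_eq_mul]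
    congr 1
    simp only [Equiv.subRight_apply]
    ring
  have h2 : ‖((‖∑ t : R, ψ (a * t + b * t ^ 2)‖ ^ 2 : ℝ) : ℂ)‖ ≤
      ∑ d : R, if 2 * b * d = 0 then (Fintype.card R : ℝ) else 0 := by
    rw [h1]
    refine norm_sum_le_of_le _ fun d _ => ?_
    rw [AddChar.sum_mulShift _ hψ, norm_mul, AddChar.norm_apply, one_mul]
    split_ifs <;> simp
  rw [Complex.norm_real, Real.norm_of_nonneg (by positivity)] at h2
  refine h2.trans (le_of_eq ?_)
  rw [← Finset.sum_filter, Finset.sum_const, nsmul_eq_mul, mul_comm]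

end ExpSum

section Stationary

variable {R : Type*} [CommRing R]

/-- The argument of the exponential sum `unitSum`. -/
def phase (m n : R) (u : Rˣ) : R := m * u ^ 3 + n * (u⁻¹ : Rˣ) ^ 2

/-- The logarithmic derivative of the phase. -/
def phaseDeriv (m n : R) (u : Rˣ) : R := 3 * (m * u ^ 3) - 2 * (n * (u⁻¹ : Rˣ) ^ 2)

/-- The unit `1 + ρ t` for `ρ ^ 3 = 0`. -/
def oneAddUnit (ρ t : R) (hρ : ρ ^ 3 = 0) : Rˣ where
  val := 1 + ρ * t
  inv := 1 - ρ * t + ρ ^ 2 * t ^ 2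
  val_inv := by linear_combination t ^ 3 * hρ
  inv_val := by linear_combination t ^ 3 * hρ

theorem phase_mul_oneAddUnit (m n : R) (u : Rˣ) {ρ : R} (t : R) (hρ : ρ ^ 3 = 0) :
    phase m n (u * oneAddUnit ρ t hρ) = phase m n u + (ρ * phaseDeriv m n u * t +
      3 * ρ ^ 2 * (m * u ^ 3 + n * (u⁻¹ : Rˣ) ^ 2) * t ^ 2) := by
  have h1 : ((oneAddUnit ρ t hρ : Rˣ) : R) = 1 + ρ * t := rfl
  have h2 : (((oneAddUnit ρ t hρ)⁻¹ : Rˣ) : R) = 1 - ρ * t + ρ ^ 2 * t ^ 2 := rfl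
  rw [phase, phase, phaseDeriv, mul_inv, Units.val_mul, Units.val_mul, h1, h2]
  linear_combination (m * u ^ 3 * t ^ 3 + n * (u⁻¹ : Rˣ) ^ 2 * (-2 * t ^ 3 + ρ * t ^ 4)) * hρ

theorem mul_phaseDeriv_mul_oneAddUnit (m n : R) (u : Rˣ) {ρ π : R} (t : R) (hρ : ρ ^ 3 = 0)
    (hπ : π * ρ = 0) :
    π * phaseDeriv m n (u * oneAddUnit ρ t hρ) = π * phaseDeriv m n u := by
  have h1 : ((oneAddUnit ρ t hρ : Rˣ) : R) = 1 + ρ * t := rfl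
  have h2 : (((oneAddUnit ρ t hρ)⁻¹ : Rˣ) : R) = 1 - ρ * t + ρ ^ 2 * t ^ 2 := rfl
  rw [phaseDeriv, phaseDeriv, mul_inv, Units.val_mul, Units.val_mul, h1, h2]
  linear_combination (3 * m * u ^ 3 * (3 * t + 3 * ρ * t ^ 2 + ρ ^ 2 * t ^ 3)
    - 2 * n * (u⁻¹ : Rˣ) ^ 2 * (-2 * t + 3 * ρ * t ^ 2 - 2 * ρ ^ 2 * t ^ 3 + ρ ^ 3 * t ^ 4)) * hπ

variable [Fintype R] [DecidableEq R]

/-- The units where the derivative of the phase is annihilated by `π`. -/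
def stationarySet (π m n : R) : Finset Rˣ := {u | π * phaseDeriv m n u = 0}

theorem unitSum_eq_sum_stationarySet {ψ : AddChar R ℂ} (hψ : ψ.IsPrimitive) (m n : R) {π : R}
    (hπ : π ^ 2 = 0) : unitSum ψ m n = ∑ u ∈ stationarySet π m n, ψ (phase m n u) := by
  have hπ3 : π ^ 3 = 0 := by rw [pow_succ, hπ, zero_mul]
  have h1 (t : R) : unitSum ψ m n = ∑ u : Rˣ, ψ (phase m n u) * ψ (t * (π * phaseDeriv m n u)) := by
    rw [unitSum]
    refine (Fintype.sum_equiv (Equiv.mulRight (oneAddUnit π t hπ3)) _ _ fun u => ?_).symm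
    rw [← AddChar.map_add_eq_mul]
    change _ = ψ (phase m n (u * oneAddUnit π t hπ3))
    rw [phase_mul_oneAddUnit, hπ]
    congr 1
    ring
  have h2 : (Fintype.card R : ℂ) * unitSum ψ m n =
      Fintype.card R * ∑ u ∈ stationarySet π m n, ψ (phase m n u) := by
    calc (Fintype.card R : ℂ) * unitSum ψ m n = ∑ t : R, unitSum ψ m n := by simp
      _ = ∑ t : R, ∑ u : Rˣ, ψ (phase m n u) * ψ (t * (π * phaseDeriv m n u)) :=
        Finset.sum_congr rfl fun t _ => h1 t
      _ = _ := by
        rw [Finset.sum_comm, stationarySet, Finset.sum_filter, Finset.mul_sum]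
        refine Finset.sum_congr rfl fun u _ => ?_
        rw [← Finset.mul_sum, AddChar.sum_mulShift _ hψ]
        split_ifs <;> simp [mul_comm]
  exact mul_left_cancel₀ (by exact_mod_cast Fintype.card_ne_zero) h2

theorem norm_unitSum_le_card {ψ : AddChar R ℂ} (hψ : ψ.IsPrimitive) (m n : R) {π : R}
    (hπ : π ^ 2 = 0) : ‖unitSum ψ m n‖ ≤ (stationarySet π m n).card := by
  rw [unitSum_eq_sum_stationarySet hψ m n hπ]
  refine (norm_sum_le _ _).trans ?_
  simp

theorem norm_unitSum_sq_le {ψ : AddChar R ℂ} (hψ : ψ.IsPrimitive) (m n : R) {π ρ : R}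
    (hπ : π ^ 2 = 0) (hρ : ρ ^ 3 = 0) (hπρ : π * ρ = 0) {D : ℕ}
    (hD : ∀ u ∈ stationarySet π m n,
      ({d : R | 2 * (3 * ρ ^ 2 * phase m n u) * d = 0} : Finset R).card ≤ D) :
    (Fintype.card R : ℝ) * ‖unitSum ψ m n‖ ^ 2 ≤ D * (stationarySet π m n).card ^ 2 := by
  set q : ℝ := (Fintype.card R : ℝ) with hq
  have hq0 : 0 < q := by
    rw [hq]
    exact_mod_cast Fintype.card_pos
  set g : Rˣ → ℂ := fun u => ∑ t : R, ψ (ρ * phaseDeriv m n u * t +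
    3 * ρ ^ 2 * phase m n u * t ^ 2) with hg
  have hgb (u) (hu : u ∈ stationarySet π m n) : ‖g u‖ ≤ Real.sqrt (q * D) := by
    refine Real.le_sqrt_of_sq_le ((norm_quadratic_sum_sq_le hψ _ _).trans ?_)
    exact mul_le_mul_of_nonneg_left (by exact_mod_cast hD u hu) hq0.le
  have h1 (t : R) : unitSum ψ m n = ∑ u ∈ stationarySet π m n, ψ (phase m n u) *
      ψ (ρ * phaseDeriv m n u * t + 3 * ρ ^ 2 * phase m n u * t ^ 2) := by
    rw [unitSum_eq_sum_stationarySet hψ m n hπ]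
    symm
    refine Finset.sum_equiv (Equiv.mulRight (oneAddUnit ρ t hρ)) (fun u => ?_) fun u _ => ?_
    · simp only [stationarySet, Finset.mem_filter, Finset.mem_univ, true_and, Equiv.coe_mulRight]
      rw [mul_phaseDeriv_mul_oneAddUnit m n u t hρ hπρ]
    · rw [← AddChar.map_add_eq_mul, Equiv.coe_mulRight, phase_mul_oneAddUnit]
      rfl
  have h2 : (q : ℂ) * unitSum ψ m n = ∑ u ∈ stationarySet π m n, ψ (phase m n u) * g u := by
    calc (q : ℂ) * unitSum ψ m n = ∑ t : R, unitSum ψ m n := by simp [hq]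
      _ = _ := by
        rw [Finset.sum_congr rfl fun t _ => h1 t, Finset.sum_comm]
        simp_rw [hg, Finset.mul_sum]
  have h3 : q * ‖unitSum ψ m n‖ ≤ (stationarySet π m n).card * Real.sqrt (q * D) := by
    calc q * ‖unitSum ψ m n‖ = ‖(q : ℂ) * unitSum ψ m n‖ := by
          rw [norm_mul, Complex.norm_real, Real.norm_of_nonneg hq0.le]
      _ ≤ ∑ u ∈ stationarySet π m n, Real.sqrt (q * D) := by
          rw [h2]
          refine norm_sum_le_of_le _ fun u hu => ?_
          rw [norm_mul, AddChar.norm_apply, one_mul]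
          exact hgb u hu
      _ = _ := by rw [Finset.sum_const, nsmul_eq_mul]
  have h4 := pow_le_pow_left₀ (by positivity) h3 2
  rw [mul_pow, mul_pow, Real.sq_sqrt (by positivity)] at h4
  refine le_of_mul_le_mul_left ?_ hq0
  calc q * (q * ‖unitSum ψ m n‖ ^ 2) = q ^ 2 * ‖unitSum ψ m n‖ ^ 2 := by ring
    _ ≤ _ := h4
    _ = _ := by ring

/-- If a coefficient is a unit, stationary points are counted by fifth roots of unity. -/
theorem card_stationarySet_le (m n : R) {π : R} (hmn : IsUnit m ∨ IsUnit n) {A B : ℕ}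
    (h3 : ({x : R | 3 * π * x = 0} : Finset R).card ≤ A)
    (h2 : ({x : R | 2 * π * x = 0} : Finset R).card ≤ A)
    (h5 : ({v : Rˣ | v ^ 5 = 1} : Finset Rˣ).card ≤ B) :
    (stationarySet π m n).card ≤ A * B := by
  rcases (stationarySet π m n).eq_empty_or_nonempty with h | ⟨u₀, hu₀⟩
  · simp [h]
  have key (π' : R) (hA : ({x : R | π' * x = 0} : Finset R).card ≤ A) (g : Rˣ → Rˣ)
      (hg : Function.Injective g)
      (h : ∀ u ∈ stationarySet π m n, π' * (((g u ^ 5 : Rˣ) : R) - (g u₀ ^ 5 : Rˣ)) = 0) :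
      (stationarySet π m n).card ≤ A * B := by
    rw [mul_comm]
    refine (Finset.card_le_mul_card_image_of_maps_to (s := stationarySet π m n)
      (t := ({x : R | π' * x = 0} : Finset R))
      (f := fun u => ((g u ^ 5 : Rˣ) : R) - (g u₀ ^ 5 : Rˣ)) ?_ B ?_).trans
      (Nat.mul_le_mul_left _ hA)
    · intro u hu
      simpa using h u hu
    · intro x _
      rcases Finset.eq_empty_or_nonempty ((stationarySet π m n).filter
        fun u => ((g u ^ 5 : Rˣ) : R) - (g u₀ ^ 5 : Rˣ) = x) with h0 | ⟨w, hw⟩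
      · rw [h0, Finset.card_empty]
        exact Nat.zero_le _
      rw [Finset.mem_filter] at hw
      refine le_trans ?_ h5
      refine Finset.card_le_card_of_injOn (fun u => g u * (g w)⁻¹) ?_ ?_
      · intro u hu
        have hu := Finset.mem_filter.1 hu
        have h6 : ((g u ^ 5 : Rˣ) : R) = (g w ^ 5 : Rˣ) := by
          linear_combination hu.2 - hw.2
        have h7 := Units.ext h6
        simp [mul_pow, h7]
      · intro u _ v _ huv
        exact hg (mul_right_cancel huv)
  have hu₀' : π * phaseDeriv m n u₀ = 0 := (Finset.mem_filter.1 hu₀).2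
  rcases hmn with hm | hn
  · refine key (3 * π) h3 id Function.injective_id fun u hu => ?_
    have hu' : π * phaseDeriv m n u = 0 := (Finset.mem_filter.1 hu).2
    have hi : (u : R) * (u⁻¹ : Rˣ) = 1 := u.mul_inv
    have hi₀ : (u₀ : R) * (u₀⁻¹ : Rˣ) = 1 := u₀.mul_inv
    refine hm.mul_left_cancel ?_
    rw [phaseDeriv] at hu' hu₀'
    simp only [id, Units.val_pow_eq_pow_val]
    have e1 : (u : R) ^ 2 * (u⁻¹ : Rˣ) ^ 2 = 1 := by rw [← mul_pow, hi, one_pow]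
    have e2 : (u₀ : R) ^ 2 * (u₀⁻¹ : Rˣ) ^ 2 = 1 := by rw [← mul_pow, hi₀, one_pow]
    linear_combination (u : R) ^ 2 * hu' - (u₀ : R) ^ 2 * hu₀' + 2 * π * n * e1 - 2 * π * n * e2
  · refine key (2 * π) h2 (fun u => u⁻¹) inv_injective fun u hu => ?_
    have hu' : π * phaseDeriv m n u = 0 := (Finset.mem_filter.1 hu).2
    have hi : (u : R) * (u⁻¹ : Rˣ) = 1 := u.mul_inv
    have hi₀ : (u₀ : R) * (u₀⁻¹ : Rˣ) = 1 := u₀.mul_inv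
    refine hn.mul_left_cancel ?_
    rw [phaseDeriv] at hu' hu₀'
    simp only [Units.val_pow_eq_pow_val]
    have e1 : (u : R) ^ 3 * (u⁻¹ : Rˣ) ^ 3 = 1 := by rw [← mul_pow, hi, one_pow]
    have e2 : (u₀ : R) ^ 3 * (u₀⁻¹ : Rˣ) ^ 3 = 1 := by rw [← mul_pow, hi₀, one_pow]
    linear_combination -((u⁻¹ : Rˣ) : R) ^ 3 * hu' + ((u₀⁻¹ : Rˣ) : R) ^ 3 * hu₀' +
      3 * π * m * e1 - 3 * π * m * e2

end Stationary

section FiberSum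

@[to_additive]
theorem MonoidHom.sum_comp_of_surjective {G H : Type*} [Group G] [Fintype G] [Group H] [Fintype H]
    (f : G →* H) (hf : Function.Surjective f) (F : H → ℂ) :
    (Fintype.card H : ℂ) * ∑ g, F (f g) = Fintype.card G * ∑ h, F h := by
  classical
  set N := ({g | f g = 1} : Finset G).card with hN
  have h1 (h : H) : ({g | f g = h} : Finset G).card = N :=
    MonoidHom.card_fiber_eq_of_mem_range f (hf h) (hf 1)
  have key (F : H → ℂ) : ∑ g, F (f g) = N * ∑ h, F h := by
    rw [← Finset.sum_fiberwise Finset.univ f, Finset.mul_sum]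
    refine Finset.sum_congr rfl fun h _ => ?_
    rw [Finset.sum_congr rfl fun g hg => by rw [(Finset.mem_filter.1 hg).2], Finset.sum_const, h1,
      nsmul_eq_mul]
  have h2 := key fun _ => 1
  simp only [Finset.sum_const, Finset.card_univ, nsmul_eq_mul, mul_one] at h2
  rw [key, h2]
  ring

end FiberSum

section PrimePower

theorem card_natCast_mul_eq_zero_le {q c : ℕ} [NeZero q] (hc : 0 < c) :
    ({x : ZMod q | (c : ZMod q) * x = 0} : Finset (ZMod q)).card ≤ c := by
  simpa only [nsmul_eq_mul] using IsAddCyclic.card_nsmul_eq_zero_le (α := ZMod q) hc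

variable {p : ℕ} [hp : Fact p.Prime]

theorem card_pow_five_eq_one_le (k : ℕ) :
    ({v : (ZMod (p ^ k))ˣ | v ^ 5 = 1} : Finset (ZMod (p ^ k))ˣ).card ≤ 5 := by
  by_cases h2 : p = 2
  · subst h2
    have h1 : ({v : (ZMod (2 ^ k))ˣ | v ^ 5 = 1} : Finset (ZMod (2 ^ k))ˣ) ⊆ {1} := by
      intro v hv
      rw [Finset.mem_singleton]
      have h1 : v ^ 5 = 1 := (Finset.mem_filter.1 hv).2
      have h2 : v ^ (2 ^ k) = 1 := by
        rcases k with _ | k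
        · exact Subsingleton.elim (α := (ZMod 1)ˣ) _ _
        · rw [← orderOf_dvd_iff_pow_eq_one]
          refine (orderOf_dvd_card (x := v)).trans ?_
          rw [ZMod.card_units_eq_totient, Nat.totient_prime_pow_succ Nat.prime_two]
          exact ⟨2, by ring⟩
      have h3 : Nat.Coprime 5 (2 ^ k) := Nat.Coprime.pow_right _ (by norm_num)
      rw [← orderOf_eq_one_iff]
      exact Nat.eq_one_of_dvd_coprimes h3 (orderOf_dvd_of_pow_eq_one h1)
        (orderOf_dvd_of_pow_eq_one h2)
    exact (Finset.card_le_card h1).trans (by simp)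
  · have := ZMod.isCyclic_units_of_prime_pow p hp.out h2 k
    exact IsCyclic.card_pow_eq_one_le (by norm_num)

theorem dvd_or_isUnit {k : ℕ} (x : ZMod (p ^ k)) : (p : ZMod (p ^ k)) ∣ x ∨ IsUnit x := by
  rw [← ZMod.natCast_zmod_val x]
  rcases (Nat.coprime_or_dvd_of_prime hp.out x.val) with h | h
  · right
    rw [ZMod.isUnit_iff_coprime]
    exact (h.pow_left k).symm
  · left
    exact Nat.cast_dvd_cast h

/-- The descent step when both coefficients are divisible by `p`. -/
theorem SqrtCancel.descent {k : ℕ} (hk : 1 ≤ k) {c : ℝ} (hc : SqrtCancel (ZMod (p ^ k)) c)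
    {ψ : AddChar (ZMod (p ^ (k + 1))) ℂ} (hψ : ψ.IsPrimitive) (m n : ZMod (p ^ (k + 1))) :
    ‖unitSum ψ (p * m) (p * n)‖ ^ 2 ≤
      c * Fintype.card (ZMod (p ^ (k + 1))) * annCount (p * m) (p * n) := by
  have hp0 : (0 : ℝ) < p := by exact_mod_cast hp.out.pos
  have hdvd : p ^ k ∣ p ^ (k + 1) := pow_dvd_pow p (Nat.le_succ k)
  set f := ZMod.castHom hdvd (ZMod (p ^ k)) with hf
  have hfs : Function.Surjective f := ZMod.castHom_surjective hdvd
  have hker (x : ZMod (p ^ (k + 1))) : f x = 0 ↔ p * x = 0 := by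
    rw [← ZMod.natCast_zmod_val x, map_natCast, ← Nat.cast_mul, ZMod.natCast_eq_zero_iff,
      ZMod.natCast_eq_zero_iff]
    generalize x.val = v
    rw [pow_succ', Nat.mul_dvd_mul_iff_left hp.out.pos]
  have hfeq (x y : ZMod (p ^ (k + 1))) (h : f x = f y) : (p * x : ZMod (p ^ (k + 1))) = p * y := by
    rw [← sub_eq_zero, ← mul_sub, ← hker, map_sub, h, sub_self]
  obtain ⟨g, hg⟩ := hfs.hasRightInverse
  have hval (x : ZMod (p ^ (k + 1))) : (p * g (f x) : ZMod (p ^ (k + 1))) = p * x :=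
    hfeq _ _ (hg _)
  set ψ' : AddChar (ZMod (p ^ k)) ℂ :=
    { toFun := fun y => ψ (p * g y)
      map_zero_eq_one' := by
        rw [← map_zero f, hval]
        simp
      map_add_eq_mul' := by
        intro a b
        rw [← AddChar.map_add_eq_mul, ← mul_add]
        congr 1
        exact hfeq _ _ (by rw [hg, map_add, hg, hg]) } with hψ'
  have hap (x : ZMod (p ^ (k + 1))) : ψ' (f x) = ψ (p * x) := by
    change ψ (p * g (f x)) = _
    rw [hval]
  have hprim : ψ'.IsPrimitive := by
    intro a ha h
    obtain ⟨b, rfl⟩ := hfs a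
    have hb : (p * b : ZMod (p ^ (k + 1))) ≠ 0 := fun h0 => ha ((hker b).2 h0)
    refine hψ hb ?_
    ext y
    have := DFunLike.congr_fun h (f y)
    rw [AddChar.mulShift_apply, ← map_mul, hap] at this
    rw [AddChar.mulShift_apply, mul_assoc, this]
    simp
  have h1 : unitSum ψ (p * m) (p * n) = p * unitSum ψ' (f m) (f n) := by
    have h2 := MonoidHom.sum_comp_of_surjective (Units.map (f : ZMod (p ^ (k + 1)) →* ZMod (p ^ k)))
      (ZMod.unitsMap_surjective hdvd)
      (fun v : (ZMod (p ^ k))ˣ => ψ' (f m * v ^ 3 + f n * (v⁻¹ : (ZMod (p ^ k))ˣ) ^ 2))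
    rw [ZMod.card_units_eq_totient, ZMod.card_units_eq_totient,
      Nat.totient_prime_pow_succ hp.out] at h2
    have h3 : (p ^ k).totient * p = p ^ k * (p - 1) := by
      obtain ⟨j, rfl⟩ := Nat.exists_eq_add_of_le' hk
      rw [Nat.totient_prime_pow_succ hp.out]
      ring
    have h4 : ((p ^ k).totient : ℂ) ≠ 0 := by
      exact_mod_cast (Nat.totient_pos.2 (pow_pos hp.out.pos k)).ne'
    rw [← h3] at h2
    push_cast at h2
    rw [mul_assoc] at h2
    rw [unitSum, unitSum, ← mul_left_cancel₀ h4 h2]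
    refine Finset.sum_congr rfl fun u _ => ?_
    rw [← map_inv]
    simp only [Units.coe_map, MonoidHom.coe_coe, ← map_pow, ← map_mul, ← map_add]
    rw [hap]
    congr 1
    ring
  have h2 : p * annCount (f m) (f n) = annCount (p * m) (p * n) := by
    classical
    have h3 := AddMonoidHom.sum_comp_of_surjective (f : ZMod (p ^ (k + 1)) →+ ZMod (p ^ k)) hfs
      (fun y => if y * f m = 0 ∧ y * f n = 0 then 1 else 0)
    have h4 (x : ZMod (p ^ (k + 1))) : (f x * f m = 0 ∧ f x * f n = 0) ↔
        (x * (p * m) = 0 ∧ x * (p * n) = 0) := by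
      rw [← map_mul, ← map_mul, hker, hker, mul_left_comm, mul_left_comm (p : ZMod (p ^ (k + 1)))]
    simp only [AddMonoidHom.coe_coe, h4, Finset.sum_boole, ZMod.card] at h3
    have h5 : p ^ k ≠ 0 := pow_ne_zero _ hp.out.ne_zero
    rw [annCount, annCount, Nat.card_eq_fintype_card, Nat.card_eq_fintype_card,
      Fintype.card_subtype, Fintype.card_subtype]
    refine Nat.eq_of_mul_eq_mul_left (Nat.pos_of_ne_zero h5) ?_
    have h6 : p ^ k * ({x | x * (p * m) = 0 ∧ x * (p * n) = 0} : Finset (ZMod (p ^ (k + 1)))).card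
      = p ^ (k + 1) * ({y | y * f m = 0 ∧ y * f n = 0} : Finset (ZMod (p ^ k))).card := by
      exact_mod_cast h3
    rw [h6]
    ring
  have h3 := hc ψ' hprim (f m) (f n)
  rw [h1, ← h2, norm_mul, mul_pow, Complex.norm_natCast]
  rw [ZMod.card] at h3 ⊢
  push_cast at h3 ⊢
  calc (p : ℝ) ^ 2 * ‖unitSum ψ' (f m) (f n)‖ ^ 2 ≤
        p ^ 2 * (c * p ^ k * annCount (f m) (f n)) :=
        mul_le_mul_of_nonneg_left h3 (by positivity)
    _ = _ := by ring

end PrimePower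

section PrimePowerBound

variable {p : ℕ} [hp : Fact p.Prime]

theorem SqrtCancel.prime : SqrtCancel (ZMod p) 1125 := by
  intro ψ hψ m n
  have hann : (1 : ℝ) ≤ annCount m n := by exact_mod_cast annCount_pos m n
  have hp0 : (0 : ℝ) < p := by exact_mod_cast hp.out.pos
  have htriv := norm_unitSum_le ψ m n
  rw [ZMod.card] at htriv ⊢
  suffices h : ‖unitSum ψ m n‖ ^ 2 ≤ 1125 * p ∨ ‖unitSum ψ m n‖ ^ 2 ≤ p * annCount m n by
    rcases h with h | h
    · exact h.trans (le_mul_of_one_le_right (by positivity) hann)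
    · refine h.trans (mul_le_mul_of_nonneg_right ?_ (by positivity))
      linarith
  by_cases hp5 : p < 5
  · left
    have h5 : (p : ℝ) < 5 := by exact_mod_cast hp5
    calc ‖unitSum ψ m n‖ ^ 2 ≤ (p : ℝ) ^ 2 := pow_le_pow_left₀ (norm_nonneg _) htriv 2
      _ ≤ 1125 * p := by nlinarith
  rw [not_lt] at hp5
  by_cases hm : m = 0
  · subst hm
    by_cases hn : n = 0
    · subst hn
      right
      have h1 : annCount (0 : ZMod p) 0 = p := by
        rw [annCount]
        simp
      rw [h1, ← sq]
      exact pow_le_pow_left₀ (norm_nonneg _) htriv 2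
    · left
      have h2 : (2 : ZMod p) ≠ 0 := by
        have : ((2 : ℕ) : ZMod p) ≠ 0 := by
          rw [Ne, ZMod.natCast_eq_zero_iff]
          exact fun h => absurd (Nat.le_of_dvd (by norm_num) h) (by omega)
        exact_mod_cast this
      have h3 : unitSum ψ 0 n = ∑ t : ZMod p, ψ (0 * t + n * t ^ 2) - 1 := by
        rw [← Finset.add_sum_erase _ _ (Finset.mem_univ (0 : ZMod p))]
        have : ψ (0 * 0 + n * 0 ^ 2) = 1 := by simp
        rw [this, add_sub_cancel_left, unitSum]
        refine Finset.sum_bij (fun u _ => ((u⁻¹ : (ZMod p)ˣ) : ZMod p)) ?_ ?_ ?_ ?_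
        · intro u _
          exact Finset.mem_erase.2 ⟨Units.ne_zero _, Finset.mem_univ _⟩
        · intro u _ v _ h
          exact inv_injective (Units.ext h)
        · intro x hx
          exact ⟨(Units.mk0 x (Finset.ne_of_mem_erase hx))⁻¹, Finset.mem_univ _, by simp⟩
        · intro u _
          rw [zero_mul, zero_mul]
      have h4 := norm_quadratic_sum_sq_le hψ 0 n
      have h5 : ({d : ZMod p | 2 * n * d = 0} : Finset (ZMod p)) = {0} := by
        ext d
        simp [h2, hn]
      rw [h5, Finset.card_singleton, ZMod.card, Nat.cast_one, mul_one] at h4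
      have h6 : ‖unitSum ψ 0 n‖ ≤ ‖∑ t : ZMod p, ψ (0 * t + n * t ^ 2)‖ + 1 := by
        rw [h3]
        refine (norm_sub_le _ _).trans ?_
        simp
      have h7 : (5 : ℝ) ≤ p := by exact_mod_cast hp5
      nlinarith [norm_nonneg (unitSum ψ 0 n), norm_nonneg (∑ t : ZMod p, ψ (0 * t + n * t ^ 2)),
        sq_nonneg (‖∑ t : ZMod p, ψ (0 * t + n * t ^ 2)‖ - 1)]
  · left
    have hψ1 : ψ ≠ 1 := by
      intro h
      refine hψ (a := 1) one_ne_zero ?_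
      rw [AddChar.mulShift_one, h]
    have h1 : ‖unitSum ψ m n‖ ≤ 5 * Real.sqrt p := norm_prime_sum_le ψ m n hp5 hψ1 hm
    calc ‖unitSum ψ m n‖ ^ 2 ≤ (5 * Real.sqrt p) ^ 2 := pow_le_pow_left₀ (norm_nonneg _) h1 2
      _ = 25 * p := by
        rw [mul_pow, Real.sq_sqrt hp0.le]
        norm_num
      _ ≤ 1125 * p := by linarith

theorem card_stationarySet_prime_pow_le {k h : ℕ} {m n : ZMod (p ^ k)}
    (hmn : IsUnit m ∨ IsUnit n) :
    (stationarySet ((p : ZMod (p ^ k)) ^ h) m n).card ≤ 15 * p ^ h := by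
  have hpos : 0 < p ^ h := pow_pos hp.out.pos h
  have hcard (c : ℕ) (hc : 0 < c) (hc3 : c ≤ 3) :
      ({x : ZMod (p ^ k) | c * (p : ZMod (p ^ k)) ^ h * x = 0} : Finset (ZMod (p ^ k))).card ≤
        3 * p ^ h := by
    have h1 := card_natCast_mul_eq_zero_le (q := p ^ k) (c := c * p ^ h) (by positivity)
    push_cast at h1
    exact h1.trans (Nat.mul_le_mul_right _ hc3)
  refine (card_stationarySet_le m n hmn (hcard 3 (by norm_num) le_rfl)
    (hcard 2 (by norm_num) (by norm_num)) (card_pow_five_eq_one_le k)).trans (le_of_eq ?_)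
  ring

theorem isUnit_phase_of_mem_stationarySet {k h : ℕ} (hhk : h < k) (hp7 : 7 ≤ p)
    {m n : ZMod (p ^ k)} (hmn : IsUnit m ∨ IsUnit n) {u : (ZMod (p ^ k))ˣ}
    (hu : u ∈ stationarySet ((p : ZMod (p ^ k)) ^ h) m n) : IsUnit (phase m n u) := by
  have hnu : ¬ IsUnit (p : ZMod (p ^ k)) := by
    rw [ZMod.isUnit_iff_coprime]
    intro hc
    rw [Nat.coprime_pow_right_iff (by omega), Nat.coprime_self] at hc
    omega
  have hnotdvd {x : ZMod (p ^ k)} (hx : IsUnit x) : ¬ (p : ZMod (p ^ k)) ∣ x :=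
    fun hd => hnu (isUnit_of_dvd_unit hd hx)
  have h5 : IsUnit (5 : ZMod (p ^ k)) := by
    have : IsUnit ((5 : ℕ) : ZMod (p ^ k)) := by
      rw [ZMod.isUnit_iff_coprime]
      refine Nat.Coprime.pow_right _ ((Nat.coprime_primes (by norm_num) hp.out).2 (by omega))
    exact_mod_cast this
  refine (dvd_or_isUnit (phase m n u)).resolve_left fun hd => ?_
  have hu' : (p : ZMod (p ^ k)) ^ h * phaseDeriv m n u = 0 := (Finset.mem_filter.1 hu).2
  have hd' : (p : ZMod (p ^ k)) ∣ phaseDeriv m n u := by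
    refine (dvd_or_isUnit (phaseDeriv m n u)).resolve_right fun hun => ?_
    rw [hun.mul_left_eq_zero, ← Nat.cast_pow, ZMod.natCast_eq_zero_iff] at hu'
    have := (Nat.pow_dvd_pow_iff_le_right hp.out.one_lt).1 hu'
    omega
  rw [phase] at hd
  rw [phaseDeriv] at hd'
  rcases hmn with hm | hn
  · refine hnotdvd ((h5.mul hm).mul (u.isUnit.pow 3)) ?_
    have := (hd.mul_left 2).add hd'
    convert this using 1
    ring
  · refine hnotdvd ((h5.mul hn).mul ((u⁻¹).isUnit.pow 2)) ?_
    have := (hd.mul_left 3).sub hd'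
    convert this using 1
    ring

theorem norm_unitSum_sq_le_of_isUnit {k : ℕ} (hk : 2 ≤ k) {ψ : AddChar (ZMod (p ^ k)) ℂ}
    (hψ : ψ.IsPrimitive) {m n : ZMod (p ^ k)} (hmn : IsUnit m ∨ IsUnit n) :
    ‖unitSum ψ m n‖ ^ 2 ≤ 1125 * (p : ℝ) ^ k := by
  have hp0 : (0 : ℝ) < p := by exact_mod_cast hp.out.pos
  have hzero {j : ℕ} (hj : k ≤ j) : (p : ZMod (p ^ k)) ^ j = 0 := by
    rw [← Nat.cast_pow, ZMod.natCast_eq_zero_iff]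
    exact pow_dvd_pow p hj
  rcases Nat.even_or_odd' k with ⟨h, hk' | hk'⟩
  · have h1 := norm_unitSum_le_card hψ m n (π := (p : ZMod (p ^ k)) ^ h)
      (by rw [← pow_mul]; exact hzero (by omega))
    have h2 : (((stationarySet ((p : ZMod (p ^ k)) ^ h) m n).card : ℕ) : ℝ) ≤ 15 * (p : ℝ) ^ h := by
      exact_mod_cast card_stationarySet_prime_pow_le hmn
    calc ‖unitSum ψ m n‖ ^ 2 ≤ (15 * (p : ℝ) ^ h) ^ 2 :=
          pow_le_pow_left₀ (norm_nonneg _) (h1.trans h2) 2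
      _ = 225 * (p : ℝ) ^ k := by
        rw [hk']
        ring
      _ ≤ _ := by
        have : 0 < (p : ℝ) ^ k := by positivity
        linarith
  · have hπ : ((p : ZMod (p ^ k)) ^ (h + 1)) ^ 2 = 0 := by
      rw [← pow_mul]
      exact hzero (by omega)
    have h2 : (((stationarySet ((p : ZMod (p ^ k)) ^ (h + 1)) m n).card : ℕ) : ℝ) ≤
        15 * (p : ℝ) ^ (h + 1) := by
      exact_mod_cast card_stationarySet_prime_pow_le hmn
    by_cases hp7 : p < 7
    · have h5 : (p : ℝ) ≤ 5 := by
        have : p ≠ 6 := by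
          rintro rfl
          exact absurd hp.out (by norm_num)
        exact_mod_cast (by omega : p ≤ 5)
      have h1 := norm_unitSum_le_card hψ m n hπ
      calc ‖unitSum ψ m n‖ ^ 2 ≤ (15 * (p : ℝ) ^ (h + 1)) ^ 2 :=
            pow_le_pow_left₀ (norm_nonneg _) (h1.trans h2) 2
        _ = p * (225 * (p : ℝ) ^ k) := by
          rw [hk']
          ring
        _ ≤ 5 * (225 * (p : ℝ) ^ k) := mul_le_mul_of_nonneg_right h5 (by positivity)
        _ = _ := by ring
    · rw [not_lt] at hp7
      have h6 : IsUnit (6 : ZMod (p ^ k)) := by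
        have : IsUnit ((6 : ℕ) : ZMod (p ^ k)) := by
          rw [ZMod.isUnit_iff_coprime]
          refine Nat.Coprime.pow_right _ ?_
          rw [show 6 = 2 * 3 by norm_num]
          exact Nat.Coprime.mul_left
            ((Nat.coprime_primes (by norm_num) hp.out).2 (by omega))
            ((Nat.coprime_primes (by norm_num) hp.out).2 (by omega))
        exact_mod_cast this
      have h1 := norm_unitSum_sq_le hψ m n hπ (ρ := (p : ZMod (p ^ k)) ^ h)
        (by rw [← pow_mul]; exact hzero (by omega)) (by rw [← pow_add]; exact hzero (by omega))
        (D := p ^ (2 * h)) (by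
          intro u hu
          have h7 := isUnit_phase_of_mem_stationarySet (by omega) hp7 hmn hu
          refine le_trans (Finset.card_le_card ?_) (card_natCast_mul_eq_zero_le
            (q := p ^ k) (c := p ^ (2 * h)) (pow_pos hp.out.pos _))
          intro d hd
          simp only [Finset.mem_filter, Finset.mem_univ, true_and] at hd ⊢
          refine (h6.mul h7).mul_left_cancel ?_
          push_cast
          rw [mul_zero, ← hd]
          ring)
      rw [ZMod.card] at h1
      push_cast at h1
      have h3 := h1.trans (mul_le_mul_of_nonneg_left (pow_le_pow_left₀ (by positivity) h2 2)
        (by positivity))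
      have h4 : (p : ℝ) ^ k * ‖unitSum ψ m n‖ ^ 2 ≤ (p : ℝ) ^ k * (225 * (p : ℝ) ^ k) := by
        refine h3.trans (le_of_eq ?_)
        rw [hk']
        ring
      have h8 := le_of_mul_le_mul_left h4 (by positivity)
      have : 0 < (p : ℝ) ^ k := by positivity
      linarith

theorem SqrtCancel.prime_pow {k : ℕ} (hk : 1 ≤ k) : SqrtCancel (ZMod (p ^ k)) 1125 := by
  induction k, hk using Nat.le_induction with
  | base => exact SqrtCancel.prime.congr (ZMod.ringEquivCongr (pow_one p))
  | succ k hk ih =>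
    intro ψ hψ m n
    have key (h : IsUnit m ∨ IsUnit n) : ‖unitSum ψ m n‖ ^ 2 ≤
        1125 * Fintype.card (ZMod (p ^ (k + 1))) * annCount m n := by
      have h1 := norm_unitSum_sq_le_of_isUnit (by omega) hψ h
      have hann : (1 : ℝ) ≤ annCount m n := by exact_mod_cast annCount_pos m n
      rw [ZMod.card]
      push_cast
      exact h1.trans (le_mul_of_one_le_right (by positivity) hann)
    rcases dvd_or_isUnit m with ⟨m, rfl⟩ | hm
    · rcases dvd_or_isUnit n with ⟨n, rfl⟩ | hn
      · exact ih.descent hk hψ m n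
      · exact key (Or.inr hn)
    · exact key (Or.inl hm)

end PrimePowerBound

theorem SqrtCancel.zmod (q : ℕ) [NeZero q] :
    SqrtCancel (ZMod q) (1125 ^ q.primeFactors.card) := by
  suffices h : ∀ q : ℕ, q ≠ 0 → ∀ _ : NeZero q,
      SqrtCancel (ZMod q) (1125 ^ q.primeFactors.card) from h q (NeZero.ne q) _
  intro q
  induction q using Nat.recOnPosPrimePosCoprime with
  | prime_pow p n hp hn =>
    intro _ _
    have : Fact p.Prime := ⟨hp⟩
    rw [Nat.primeFactors_prime_pow (by omega) hp, Finset.card_singleton, pow_one]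
    exact SqrtCancel.prime_pow hn
  | zero => exact fun h => absurd rfl h
  | one =>
    intro _ _ ψ _ m n
    have h1 := norm_unitSum_le ψ m n
    have h2 : (1 : ℝ) ≤ annCount m n := by exact_mod_cast annCount_pos m n
    simp only [ZMod.card, Nat.cast_one, Nat.primeFactors_one, Finset.card_empty, pow_zero,
      one_mul] at h1 ⊢
    exact (pow_le_one₀ (norm_nonneg _) h1).trans h2
  | coprime a b ha hb hab iha ihb =>
    intro _ _
    have : NeZero a := ⟨by omega⟩
    have : NeZero b := ⟨by omega⟩
    rw [hab.primeFactors_mul, Finset.card_union_of_disjoint hab.disjoint_primeFactors, pow_add]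
    exact ((iha (by omega) _).prod (by positivity) (ihb (by omega) _)).congr
      (ZMod.chineseRemainder hab)

section Divisors

/-- The divisor bound. -/
theorem exists_card_divisors_le {δ : ℝ} (hδ : 0 < δ) :
    ∃ c : ℝ, 1 ≤ c ∧ ∀ q : ℕ, q ≠ 0 → (q.divisors.card : ℝ) ≤ c * (q : ℝ) ^ δ := by
  have hlog : 0 < Real.log 2 := Real.log_pos one_lt_two
  set M : ℝ := 1 + 1 / (δ * Real.log 2) with hM
  have hM1 : 1 ≤ M := le_add_of_nonneg_right (by positivity)
  obtain ⟨P, hP⟩ := exists_nat_ge ((2 : ℝ) ^ (1 / δ))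
  have hlocal (p k : ℕ) (hp : 2 ≤ p) :
      ((k + 1 : ℕ) : ℝ) ≤ (if p < P then M else 1) * ((p : ℝ) ^ k) ^ δ := by
    have hp2 : (2 : ℝ) ≤ p := by exact_mod_cast hp
    have hpk : ((p : ℝ) ^ k) ^ δ = ((p : ℝ) ^ δ) ^ k := by
      rw [← Real.rpow_natCast, ← Real.rpow_natCast, ← Real.rpow_mul (by positivity),
        ← Real.rpow_mul (by positivity), mul_comm]
    rw [hpk]
    push_cast
    split_ifs with h
    · have h1 : 1 + k * (δ * Real.log 2) ≤ ((2 : ℝ) ^ δ) ^ k := by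
        rw [Real.rpow_def_of_pos two_pos, ← Real.exp_nat_mul]
        have := Real.add_one_le_exp (k * (Real.log 2 * δ))
        linarith
      have h2 : ((2 : ℝ) ^ δ) ^ k ≤ ((p : ℝ) ^ δ) ^ k :=
        pow_le_pow_left₀ (by positivity) (Real.rpow_le_rpow zero_le_two hp2 hδ.le) k
      have h3 : (k : ℝ) + 1 ≤ M * (1 + k * (δ * Real.log 2)) := by
        have h4 : M * (1 + k * (δ * Real.log 2)) =
            1 + k + (k * (δ * Real.log 2) + 1 / (δ * Real.log 2)) := by
          rw [hM]
          field_simp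
          ring
        rw [h4]
        have : 0 ≤ k * (δ * Real.log 2) + 1 / (δ * Real.log 2) := by positivity
        linarith
      exact h3.trans (mul_le_mul_of_nonneg_left (h1.trans h2) (by linarith))
    · have h1 : (2 : ℝ) ≤ (p : ℝ) ^ δ := by
        have h2 : (2 : ℝ) ^ (1 / δ) ≤ p := hP.trans (by exact_mod_cast not_lt.1 h)
        calc (2 : ℝ) = ((2 : ℝ) ^ (1 / δ)) ^ δ := by
              rw [← Real.rpow_mul zero_le_two, one_div_mul_cancel hδ.ne', Real.rpow_one]
          _ ≤ _ := Real.rpow_le_rpow (by positivity) h2 hδ.le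
      have h2 : (k + 1 : ℝ) ≤ 2 ^ k := by
        have : k + 1 ≤ 2 ^ k := Nat.lt_two_pow_self
        exact_mod_cast this
      rw [one_mul]
      exact h2.trans (pow_le_pow_left₀ zero_le_two h1 k)
  refine ⟨M ^ P, one_le_pow₀ hM1, fun q hq => ?_⟩
  have hq' : (q : ℝ) ^ δ = ∏ p ∈ q.primeFactors, ((p : ℝ) ^ q.factorization p) ^ δ := by
    conv_lhs => rw [← Nat.prod_factorization_pow_eq_self hq, Finsupp.prod,
      Nat.support_factorization]
    push_cast
    rw [Real.finsetProd_rpow _ _ fun p _ => by positivity]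
  rw [Nat.card_divisors hq, hq', Nat.cast_prod]
  calc _ ≤ ∏ p ∈ q.primeFactors, ((if p < P then M else 1) * ((p : ℝ) ^ q.factorization p) ^ δ) :=
        Finset.prod_le_prod (fun p _ => by positivity) fun p hp =>
          hlocal p _ (Nat.prime_of_mem_primeFactors hp).two_le
    _ = (∏ p ∈ q.primeFactors, if p < P then M else 1) *
        ∏ p ∈ q.primeFactors, ((p : ℝ) ^ q.factorization p) ^ δ := Finset.prod_mul_distrib
    _ ≤ _ := by
      refine mul_le_mul_of_nonneg_right ?_ (Finset.prod_nonneg fun p _ => by positivity)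
      rw [Finset.prod_ite, Finset.prod_const, Finset.prod_const_one, mul_one]
      refine pow_le_pow_right₀ hM1 ?_
      calc _ ≤ (Finset.range P).card := Finset.card_le_card fun p hp =>
            Finset.mem_range.2 (Finset.mem_filter.1 hp).2
        _ = P := Finset.card_range P

theorem two_pow_card_primeFactors_le {q : ℕ} (hq : q ≠ 0) :
    2 ^ q.primeFactors.card ≤ q.divisors.card := by
  rw [Nat.card_divisors hq, ← Finset.prod_const]
  refine Finset.prod_le_prod' fun p hp => ?_
  have := (Nat.prime_of_mem_primeFactors hp).factorization_pos_of_dvd hq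
    (Nat.dvd_of_mem_primeFactors hp)
  omega

theorem sum_gcd_div_le {q : ℕ} (hq : q ≠ 0) :
    ∑ j ∈ Finset.Icc 1 q, (Nat.gcd j q : ℝ) / j ≤ q.divisors.card * (1 + Real.log q) := by
  have h1 : ∑ j ∈ Finset.Icc 1 q, (Nat.gcd j q : ℝ) / j ≤
      ∑ j ∈ Finset.Icc 1 q, ∑ d ∈ q.divisors, if d ∣ j then (d : ℝ) / j else 0 := by
    refine Finset.sum_le_sum fun j _ => ?_
    have hmem : Nat.gcd j q ∈ q.divisors := Nat.mem_divisors.2 ⟨Nat.gcd_dvd_right _ _, hq⟩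
    have := Finset.single_le_sum (f := fun d => if d ∣ j then (d : ℝ) / j else 0)
      (fun d _ => by
        split_ifs <;> positivity) hmem
    simpa only [Nat.gcd_dvd_left, if_true] using this
  refine h1.trans ?_
  rw [Finset.sum_comm, ← nsmul_eq_mul]
  refine Finset.sum_le_card_nsmul _ _ _ fun d hd => ?_
  have hd0 : 0 < d := Nat.pos_of_mem_divisors hd
  rw [← Finset.sum_filter]
  have h2 : ∑ j ∈ Finset.Icc 1 q with d ∣ j, (d : ℝ) / j =
      ∑ i ∈ ((Finset.Icc 1 q).filter (d ∣ ·)).image (fun j => j / d), ((i : ℝ))⁻¹ := by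
    rw [Finset.sum_image]
    · refine Finset.sum_congr rfl fun j hj => ?_
      obtain ⟨i, rfl⟩ := (Finset.mem_filter.1 hj).2
      have : (d : ℝ) ≠ 0 := by exact_mod_cast hd0.ne'
      rw [Nat.mul_div_cancel_left _ hd0]
      push_cast
      rw [div_mul_eq_div_div, div_self this, one_div]
    · intro i hi j hj hij
      obtain ⟨i, rfl⟩ := (Finset.mem_filter.1 hi).2
      obtain ⟨j, rfl⟩ := (Finset.mem_filter.1 hj).2
      simp only [Nat.mul_div_cancel_left _ hd0] at hij
      rw [hij]
  have h3 : ∑ i ∈ Finset.Icc 1 q, ((i : ℝ))⁻¹ ≤ 1 + Real.log q := by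
    have := harmonic_le_one_add_log q
    rw [harmonic_eq_sum_Icc] at this
    push_cast at this
    exact this
  rw [h2]
  refine le_trans (Finset.sum_le_sum_of_subset_of_nonneg ?_ fun i _ _ => by positivity) h3
  intro i hi
  obtain ⟨j, hj, rfl⟩ := Finset.mem_image.1 hi
  obtain ⟨hj1, i, rfl⟩ := Finset.mem_filter.1 hj
  rw [Finset.mem_Icc] at hj1 ⊢
  rw [Nat.mul_div_cancel_left _ hd0]
  refine ⟨Nat.pos_of_ne_zero ?_, (Nat.le_mul_of_pos_left i hd0).trans hj1.2⟩
  rintro rfl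
  omega

/-- The product of all the divisor and logarithmic losses is `O(q ^ ε)`. -/
theorem exists_loss_le {ε : ℝ} (hε : 0 < ε) : ∃ c : ℝ, 0 < c ∧ ∀ q : ℕ, q ≠ 0 →
    Real.sqrt (1125 ^ q.primeFactors.card) * (q.divisors.card * (1 + Real.log q)) ^ 2 ≤
      c * (q : ℝ) ^ ε := by
  set δ := ε / 10 with hδ
  have hδ0 : 0 < δ := by positivity
  obtain ⟨c, hc1, hc⟩ := exists_card_divisors_le hδ0
  refine ⟨c ^ 8 * (1 + 1 / δ) ^ 2, by positivity, fun q hq => ?_⟩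
  have hq1 : (1 : ℝ) ≤ q := by exact_mod_cast Nat.one_le_iff_ne_zero.2 hq
  set τ : ℝ := (q.divisors.card : ℝ) with hτ
  set x : ℝ := (q : ℝ) ^ δ with hx
  have hx1 : 1 ≤ x := Real.one_le_rpow hq1 hδ0.le
  have hlog : 1 + Real.log q ≤ (1 + 1 / δ) * x := by
    have h1 := Real.log_le_rpow_div (x := q) (by positivity) hδ0
    have h2 : (1 + 1 / δ) * x = x + x / δ := by ring
    rw [h2]
    linarith
  have hlog0 : 0 ≤ Real.log q := Real.log_nonneg hq1
  have hsqrt : Real.sqrt (1125 ^ q.primeFactors.card) ≤ τ ^ 6 := by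
    rw [Real.sqrt_le_left (by positivity)]
    have h1 : ((2 : ℝ) ^ q.primeFactors.card) ≤ τ := by
      rw [hτ]
      exact_mod_cast two_pow_card_primeFactors_le hq
    calc (1125 : ℝ) ^ q.primeFactors.card ≤ (2 ^ 12) ^ q.primeFactors.card :=
          pow_le_pow_left₀ (by norm_num) (by norm_num) _
      _ = (2 ^ q.primeFactors.card) ^ 12 := by rw [← pow_mul, ← pow_mul, mul_comm]
      _ ≤ τ ^ 12 := pow_le_pow_left₀ (by positivity) h1 12
      _ = (τ ^ 6) ^ 2 := by ring
  have hτc : τ ≤ c * x := hc q hq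
  have hx10 : x ^ 10 = (q : ℝ) ^ ε := by
    rw [hx, ← Real.rpow_natCast, ← Real.rpow_mul (by positivity), hδ]
    congr 1
    push_cast
    ring
  calc _ ≤ (c * x) ^ 6 * ((c * x) * ((1 + 1 / δ) * x)) ^ 2 := by
        refine mul_le_mul (hsqrt.trans (pow_le_pow_left₀ (by positivity) hτc 6)) ?_
          (by positivity) (by positivity)
        exact pow_le_pow_left₀ (by positivity)
          (mul_le_mul hτc hlog (by positivity) (by positivity)) 2
    _ = c ^ 8 * (1 + 1 / δ) ^ 2 * x ^ 10 := by ring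
    _ = _ := by rw [hx10]

end Divisors

section Completion

variable {q : ℕ} [NeZero q]

/-- The exponential sum over a finite set of integers at frequency `-m`. -/
noncomputable def freqSum (I : Finset ℤ) (m : ZMod q) : ℂ :=
  ∑ a ∈ I, ZMod.stdAddChar (-(m * (a : ZMod q)))

theorem sum_mul_freqSum (I : Finset ℤ) (x : ZMod q) :
    ∑ m : ZMod q, ZMod.stdAddChar (m * x) * freqSum I m =
      q * ∑ a ∈ I, if (a : ZMod q) = x then (1 : ℂ) else 0 := by
  simp_rw [freqSum, Finset.mul_sum]
  rw [Finset.sum_comm]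
  refine Finset.sum_congr rfl fun a _ => ?_
  have h := AddChar.sum_mulShift (x - (a : ZMod q)) (ZMod.isPrimitive_stdAddChar q)
  rw [ZMod.card] at h
  have h2 (m : ZMod q) : (ZMod.stdAddChar (m * x) * ZMod.stdAddChar (-(m * (a : ZMod q))) : ℂ) =
      ZMod.stdAddChar (m * (x - (a : ZMod q))) := by
    rw [← AddChar.map_add_eq_mul]
    congr 1
    ring
  rw [Finset.sum_congr rfl fun m _ => h2 m, h]
  have h3 : x - (a : ZMod q) = 0 ↔ (a : ZMod q) = x := by rw [sub_eq_zero, eq_comm]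
  simp only [h3]
  split_ifs <;> simp

/-- The solutions of `x ^ 2 * y ^ 3 = l` are parametrized by the units. -/
theorem sum_units_indicator (l : (ZMod q)ˣ) (x y : ZMod q) :
    ∑ u : (ZMod q)ˣ, (if x = (l⁻¹ : (ZMod q)ˣ) * u ^ 3 then (1 : ℂ) else 0) *
      (if y = l * ((u⁻¹ : (ZMod q)ˣ) : ZMod q) ^ 2 then 1 else 0) =
      if x ^ 2 * y ^ 3 = l then 1 else 0 := by
  have hmul (P Q : Prop) [Decidable P] [Decidable Q] :
      (if P then (1 : ℂ) else 0) * (if Q then 1 else 0) = if P ∧ Q then 1 else 0 := by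
    split_ifs <;> simp_all
  simp_rw [hmul]
  rw [Finset.sum_boole]
  split_ifs with h
  · have hx : IsUnit x := by
      have : IsUnit (x ^ 2 * y ^ 3) := h ▸ l.isUnit
      exact (isUnit_pow_iff two_ne_zero).1 (isUnit_of_mul_isUnit_left this)
    have hy : IsUnit y := by
      have : IsUnit (x ^ 2 * y ^ 3) := h ▸ l.isUnit
      exact (isUnit_pow_iff three_ne_zero).1 (isUnit_of_mul_isUnit_right this)
    obtain ⟨x, rfl⟩ := hx
    obtain ⟨y, rfl⟩ := hy
    have hl : l = x ^ 2 * y ^ 3 := Units.ext (by push_cast; exact h.symm)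
    rw [Nat.cast_eq_one, Finset.card_eq_one]
    refine ⟨x * y, ?_⟩
    ext u
    simp only [Finset.mem_filter, Finset.mem_univ, true_and, Finset.mem_singleton,
      ← Units.val_pow_eq_pow_val, ← Units.val_mul, ← Units.ext_iff]
    rw [hl]
    constructor
    · rintro ⟨h1, h2⟩
      have h3 : u ^ 3 = x ^ 3 * y ^ 3 := by
        calc u ^ 3 = (x ^ 2 * y ^ 3) * ((x ^ 2 * y ^ 3)⁻¹ * u ^ 3) := by group
          _ = (x ^ 2 * y ^ 3) * x := by rw [← h1]
          _ = _ := by rw [mul_right_comm, ← pow_succ]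
      have h4 : u ^ 2 = x ^ 2 * y ^ 2 := by
        have h5 : y * u ^ 2 = x ^ 2 * y ^ 3 := by
          calc y * u ^ 2 = (x ^ 2 * y ^ 3 * u⁻¹ ^ 2) * u ^ 2 := by rw [← h2]
            _ = _ := by rw [mul_assoc, ← mul_pow, inv_mul_cancel, one_pow, mul_one]
        refine mul_left_cancel (a := y) ?_
        rw [h5, pow_succ y 2, mul_comm y, mul_assoc]
      calc u = (u ^ 2)⁻¹ * u ^ 3 := by group
        _ = x * y := by
          rw [h3, h4, ← mul_pow, ← mul_pow]
          group
    · rintro rfl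
      constructor
      · rw [eq_inv_mul_iff_mul_eq, mul_pow, mul_right_comm, ← pow_succ]
      · rw [inv_pow, eq_mul_inv_iff_mul_eq, mul_pow, mul_left_comm, ← pow_succ']
  · rw [Nat.cast_eq_zero, Finset.card_eq_zero, Finset.filter_eq_empty_iff]
    rintro u - ⟨rfl, rfl⟩
    refine h ?_
    have e1 : (l : ZMod q) * (l⁻¹ : (ZMod q)ˣ) = 1 := l.mul_inv
    have e2 : (u : ZMod q) * (u⁻¹ : (ZMod q)ˣ) = 1 := u.mul_inv
    calc (((l⁻¹ : (ZMod q)ˣ) : ZMod q) * (u : ZMod q) ^ 3) ^ 2 *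
          ((l : ZMod q) * ((u⁻¹ : (ZMod q)ˣ) : ZMod q) ^ 2) ^ 3 =
        (l : ZMod q) * ((l : ZMod q) * ((l⁻¹ : (ZMod q)ˣ) : ZMod q)) ^ 2 *
          ((u : ZMod q) * ((u⁻¹ : (ZMod q)ˣ) : ZMod q)) ^ 6 := by ring
      _ = (l : ZMod q) := by rw [e1, e2]; ring

theorem sq_mul_card_eq_sum (I J : Finset ℤ) (l : (ZMod q)ˣ) :
    (q : ℂ) ^ 2 * (((I ×ˢ J).filter
      fun ab : ℤ × ℤ => (ab.1 : ZMod q) ^ 2 * (ab.2 : ZMod q) ^ 3 = l).card : ℕ) =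
      ∑ m : ZMod q, ∑ n : ZMod q, freqSum I m * freqSum J n *
        unitSum ZMod.stdAddChar (m * ((l⁻¹ : (ZMod q)ˣ) : ZMod q)) (n * (l : ZMod q)) := by
  have h1 : ((((I ×ˢ J).filter
      fun ab : ℤ × ℤ => (ab.1 : ZMod q) ^ 2 * (ab.2 : ZMod q) ^ 3 = l).card : ℕ) : ℂ) =
      ∑ u : (ZMod q)ˣ, (∑ a ∈ I, if (a : ZMod q) = (l⁻¹ : (ZMod q)ˣ) * u ^ 3 then (1 : ℂ) else 0) *
        ∑ b ∈ J, if (b : ZMod q) = l * ((u⁻¹ : (ZMod q)ˣ) : ZMod q) ^ 2 then (1 : ℂ) else 0 := by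
    rw [← Finset.sum_boole, Finset.sum_product]
    simp_rw [Finset.sum_mul_sum, ← sum_units_indicator]
    rw [Finset.sum_comm]
    conv_rhs => rw [Finset.sum_comm]
    conv_lhs => rw [Finset.sum_comm]
    refine Finset.sum_congr rfl fun a _ => ?_
    rw [Finset.sum_comm]
  rw [h1, sq, Finset.mul_sum]
  have h2 (u : (ZMod q)ˣ) : (q : ℂ) * q *
      ((∑ a ∈ I, if (a : ZMod q) = (l⁻¹ : (ZMod q)ˣ) * u ^ 3 then (1 : ℂ) else 0) *
        ∑ b ∈ J, if (b : ZMod q) = l * ((u⁻¹ : (ZMod q)ˣ) : ZMod q) ^ 2 then (1 : ℂ) else 0) =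
      ∑ m : ZMod q, ∑ n : ZMod q, freqSum I m * freqSum J n *
        ZMod.stdAddChar (m * ((l⁻¹ : (ZMod q)ˣ) : ZMod q) * (u : ZMod q) ^ 3 +
          n * (l : ZMod q) * ((u⁻¹ : (ZMod q)ˣ) : ZMod q) ^ 2) := by
    rw [mul_mul_mul_comm, ← sum_mul_freqSum, ← sum_mul_freqSum, Finset.sum_mul_sum]
    refine Finset.sum_congr rfl fun m _ => Finset.sum_congr rfl fun n _ => ?_
    rw [AddChar.map_add_eq_mul, ← mul_assoc m, ← mul_assoc n]
    ring
  rw [Finset.sum_congr rfl fun u _ => h2 u, Finset.sum_comm]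
  refine Finset.sum_congr rfl fun m _ => ?_
  rw [Finset.sum_comm]
  refine Finset.sum_congr rfl fun n _ => ?_
  rw [unitSum, Finset.mul_sum]

theorem norm_stdAddChar_sub_one_ge (m : ZMod q) :
    4 * (m.valMinAbs.natAbs : ℝ) / q ≤ ‖(ZMod.stdAddChar m : ℂ) - 1‖ := by
  have hq : (0 : ℝ) < q := by exact_mod_cast NeZero.pos q
  set j := m.valMinAbs with hj
  have h1 : (ZMod.stdAddChar m : ℂ) =
      Complex.exp (Complex.I * ((2 * Real.pi * j / q : ℝ) : ℂ)) := by
    conv_lhs => rw [← ZMod.coe_valMinAbs m, ZMod.stdAddChar_coe]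
    congr 1
    push_cast
    ring
  have hjle : |(j : ℝ)| * 2 ≤ q := by
    have h2 := ZMod.natAbs_valMinAbs_le m
    have h3 : m.valMinAbs.natAbs * 2 ≤ q := by omega
    rw [← Int.cast_abs, ← Nat.cast_natAbs]
    exact_mod_cast h3
  have habs : |2 * Real.pi * j / q / 2| = Real.pi * |(j : ℝ)| / q := by
    rw [show 2 * Real.pi * j / q / 2 = Real.pi * j / q by ring, abs_div, abs_mul,
      abs_of_pos Real.pi_pos, abs_of_pos hq]
  rw [h1, Complex.norm_exp_I_mul_ofReal_sub_one, norm_mul, Real.norm_eq_abs, Real.norm_eq_abs,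
    abs_two]
  have h4 := Real.mul_abs_le_abs_sin (x := 2 * Real.pi * j / q / 2) (by
    rw [habs, div_le_div_iff₀ hq two_pos, mul_assoc]
    exact mul_le_mul_of_nonneg_left hjle Real.pi_pos.le)
  rw [habs] at h4
  have h5 : 2 / Real.pi * (Real.pi * |(j : ℝ)| / q) = 2 * |(j : ℝ)| / q := by
    field_simp
  rw [h5] at h4
  have h6 : ((j.natAbs : ℕ) : ℝ) = |(j : ℝ)| := by rw [Nat.cast_natAbs, Int.cast_abs]
  rw [h6]
  calc 4 * |(j : ℝ)| / q = 2 * (2 * |(j : ℝ)| / q) := by ring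
    _ ≤ _ := mul_le_mul_of_nonneg_left h4 zero_le_two

theorem norm_freqSum_Ioc_le {m : ZMod q} (hm : m ≠ 0) {x y : ℤ} (hxy : x ≤ y) :
    ‖freqSum (Finset.Ioc x y) m‖ ≤ q / (2 * m.valMinAbs.natAbs) := by
  have hq : (0 : ℝ) < q := by exact_mod_cast NeZero.pos q
  have ht : (0 : ℝ) < m.valMinAbs.natAbs := by
    have : m.valMinAbs ≠ 0 := fun h => hm ((ZMod.valMinAbs_eq_zero m).1 h)
    exact_mod_cast Int.natAbs_pos.2 this
  set E : ℤ → ℂ := fun a => ZMod.stdAddChar (-(m * (a : ZMod q))) with hE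
  have hE1 (a : ℤ) : E a * ZMod.stdAddChar m = E (a - 1) := by
    simp only [hE]
    rw [← AddChar.map_add_eq_mul]
    congr 1
    push_cast
    ring
  have key : (∑ a ∈ Finset.Ioc x y, E a) * ((ZMod.stdAddChar m : ℂ) - 1) = E x - E y := by
    induction y, hxy using Int.leInduction with
    | base => simp
    | succ y hy ih =>
      have h1 : Finset.Ioc x (y + 1) = insert (y + 1) (Finset.Ioc x y) := by
        ext a
        simp only [Finset.mem_Ioc, Finset.mem_insert]
        omega
      rw [h1, Finset.sum_insert (by simp), add_mul, ih, mul_sub, hE1, add_sub_cancel_right]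
      ring
  have h1 : ‖freqSum (Finset.Ioc x y) m‖ * (4 * (m.valMinAbs.natAbs : ℝ) / q) ≤ 2 := by
    refine (mul_le_mul_of_nonneg_left (norm_stdAddChar_sub_one_ge m) (norm_nonneg _)).trans ?_
    rw [← norm_mul]
    change ‖(∑ a ∈ Finset.Ioc x y, E a) * ((ZMod.stdAddChar m : ℂ) - 1)‖ ≤ 2
    rw [key]
    refine (norm_sub_le _ _).trans ?_
    simp only [hE, AddChar.norm_apply]
    norm_num
  rw [← le_div_iff₀ (by positivity)] at h1
  refine h1.trans (le_of_eq ?_)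
  field_simp
  norm_num

end Completion

theorem norm_sum_mul_mul_sub_le {ι : Type*} [Fintype ι] [DecidableEq ι] {o : ι} {F G : ι → ℂ}
    {U : ι → ι → ℂ} {P Q σ X : ℝ} {w g : ι → ℝ} (hσ : 0 ≤ σ) (hF0 : ‖F o‖ ≤ P) (hG0 : ‖G o‖ ≤ Q)
    (hF : ∀ m, m ≠ o → ‖F m‖ ≤ w m) (hG : ∀ n, n ≠ o → ‖G n‖ ≤ w n)
    (hU : ∀ m n, m ≠ o → ‖U m n‖ ≤ σ * g m) (hU' : ∀ m n, n ≠ o → ‖U m n‖ ≤ σ * g n)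
    (hg : ∀ m, m ≠ o → 1 ≤ g m) (hX : ∑ m ∈ Finset.univ.erase o, g m * w m ≤ X) :
    ‖(∑ m, ∑ n, F m * G n * U m n) - F o * G o * U o o‖ ≤ σ * (P * X + Q * X + X ^ 2) := by
  have hP : 0 ≤ P := (norm_nonneg _).trans hF0
  have hQ : 0 ≤ Q := (norm_nonneg _).trans hG0
  have hw (m : ι) (hm : m ≠ o) : 0 ≤ w m := (norm_nonneg _).trans (hF m hm)
  have hX0 : 0 ≤ X := (Finset.sum_nonneg fun m hm => mul_nonneg
    (zero_le_one.trans (hg m (Finset.ne_of_mem_erase hm))) (hw m (Finset.ne_of_mem_erase hm))).trans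
    hX
  have hwX : ∑ m ∈ Finset.univ.erase o, w m ≤ X := (Finset.sum_le_sum fun m hm =>
    le_mul_of_one_le_left (hw m (Finset.ne_of_mem_erase hm)) (hg m (Finset.ne_of_mem_erase hm))).trans
    hX
  have hrow (m : ι) {c : ℝ} (hc : ‖F m‖ ≤ c) :
      ‖∑ n ∈ Finset.univ.erase o, F m * G n * U m n‖ ≤ c * (σ * X) := by
    have hc0 : 0 ≤ c := (norm_nonneg _).trans hc
    calc ‖∑ n ∈ Finset.univ.erase o, F m * G n * U m n‖ ≤
        ∑ n ∈ Finset.univ.erase o, c * (σ * (g n * w n)) := by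
          refine norm_sum_le_of_le _ fun n hn => ?_
          have hn := Finset.ne_of_mem_erase hn
          rw [norm_mul, norm_mul]
          calc ‖F m‖ * ‖G n‖ * ‖U m n‖ ≤ c * w n * (σ * g n) := by
                gcongr
                · exact mul_nonneg hc0 (hw n hn)
                · exact hG n hn
                · exact hU' m n hn
            _ = _ := by ring
      _ = c * (σ * ∑ n ∈ Finset.univ.erase o, g n * w n) := by rw [Finset.mul_sum, Finset.mul_sum]
      _ ≤ _ := by gcongr
  have hcol : ‖∑ m ∈ Finset.univ.erase o, F m * G o * U m o‖ ≤ Q * (σ * X) := by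
    calc ‖∑ m ∈ Finset.univ.erase o, F m * G o * U m o‖ ≤
        ∑ m ∈ Finset.univ.erase o, Q * (σ * (g m * w m)) := by
          refine norm_sum_le_of_le _ fun m hm => ?_
          have hm := Finset.ne_of_mem_erase hm
          rw [norm_mul, norm_mul]
          calc ‖F m‖ * ‖G o‖ * ‖U m o‖ ≤ w m * Q * (σ * g m) := by
                gcongr
                · exact mul_nonneg (hw m hm) hQ
                · exact hw m hm
                · exact hF m hm
                · exact hU m o hm
            _ = _ := by ring
      _ = Q * (σ * ∑ m ∈ Finset.univ.erase o, g m * w m) := by rw [Finset.mul_sum, Finset.mul_sum]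
      _ ≤ _ := by gcongr
  have hrest : ‖∑ m ∈ Finset.univ.erase o, ∑ n ∈ Finset.univ.erase o, F m * G n * U m n‖ ≤
      X * (σ * X) := by
    calc _ ≤ ∑ m ∈ Finset.univ.erase o, w m * (σ * X) :=
          norm_sum_le_of_le _ fun m hm => hrow m (hF m (Finset.ne_of_mem_erase hm))
      _ = (∑ m ∈ Finset.univ.erase o, w m) * (σ * X) := by rw [Finset.sum_mul]
      _ ≤ _ := by gcongr
  have hsplit (m : ι) : ∑ n, F m * G n * U m n =
      F m * G o * U m o + ∑ n ∈ Finset.univ.erase o, F m * G n * U m n :=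
    (Finset.add_sum_erase _ _ (Finset.mem_univ o)).symm
  have hall : (∑ m, ∑ n, F m * G n * U m n) - F o * G o * U o o =
      (∑ n ∈ Finset.univ.erase o, F o * G n * U o n) +
      ((∑ m ∈ Finset.univ.erase o, F m * G o * U m o) +
      ∑ m ∈ Finset.univ.erase o, ∑ n ∈ Finset.univ.erase o, F m * G n * U m n) := by
    rw [← Finset.add_sum_erase _ _ (Finset.mem_univ o), hsplit o,
      Finset.sum_congr rfl fun m _ => hsplit m, Finset.sum_add_distrib]
    ring
  rw [hall]
  refine (norm_add_le _ _).trans ?_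
  have h1 := hrow o hF0
  have h2 := (norm_add_le _ _).trans (add_le_add hcol hrest)
  calc _ ≤ P * (σ * X) + (Q * (σ * X) + X * (σ * X)) := add_le_add h1 h2
    _ = _ := by ring

section Gcd

variable {q : ℕ}

theorem eq_or_eq_neg_natAbs_valMinAbs (m : ZMod q) :
    m = m.valMinAbs.natAbs ∨ m = -(m.valMinAbs.natAbs : ZMod q) := by
  rcases Int.natAbs_eq m.valMinAbs with h | h
  · left
    calc m = (m.valMinAbs : ZMod q) := (ZMod.coe_valMinAbs m).symm
      _ = ((m.valMinAbs.natAbs : ℤ) : ZMod q) := congrArg Int.cast h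
      _ = _ := Int.cast_natCast _
  · right
    calc m = (m.valMinAbs : ZMod q) := (ZMod.coe_valMinAbs m).symm
      _ = ((-(m.valMinAbs.natAbs : ℤ) : ℤ) : ZMod q) := congrArg Int.cast h
      _ = _ := by rw [Int.cast_neg, Int.cast_natCast]

theorem card_natAbs_valMinAbs_eq_le (j : ℕ) (s : Finset (ZMod q)) :
    (s.filter fun m => m.valMinAbs.natAbs = j).card ≤ 2 := by
  refine (Finset.card_le_card (t := {(j : ZMod q), -(j : ZMod q)}) fun m hm => ?_).trans
    Finset.card_le_two
  rw [Finset.mem_insert, Finset.mem_singleton, ← (Finset.mem_filter.1 hm).2]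
  exact eq_or_eq_neg_natAbs_valMinAbs m

theorem natCast_gcd_natAbs_valMinAbs_mul_eq_zero {m x : ZMod q} (h : x * m = 0) :
    ((Nat.gcd m.valMinAbs.natAbs q : ℕ) : ZMod q) * x = 0 := by
  set t := m.valMinAbs.natAbs with ht
  have h1 : (t : ZMod q) * x = 0 := by
    rcases eq_or_eq_neg_natAbs_valMinAbs m with h2 | h2
    · rw [mul_comm, ← h2, h]
    · rw [← neg_eq_zero, ← neg_mul, mul_comm, ← h2, h]
  have h2 := congrArg (Int.cast : ℤ → ZMod q) (Nat.gcd_eq_gcd_ab t q)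
  push_cast at h2
  rw [ZMod.natCast_self, zero_mul, add_zero] at h2
  rw [h2, mul_right_comm, h1, zero_mul]

variable [NeZero q]

theorem annCount_le_gcd {m m' n' : ZMod q} (h : ∀ x : ZMod q, x * m' = 0 ∧ x * n' = 0 → x * m = 0) :
    annCount m' n' ≤ Nat.gcd m.valMinAbs.natAbs q := by
  refine le_trans ?_ (card_natCast_mul_eq_zero_le (q := q)
    (Nat.gcd_pos_of_pos_right m.valMinAbs.natAbs (NeZero.pos q)))
  rw [annCount, Nat.card_eq_fintype_card, Fintype.card_subtype]
  refine Finset.card_le_card fun x hx => ?_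
  rw [Finset.mem_filter] at hx ⊢
  exact ⟨hx.1, natCast_gcd_natAbs_valMinAbs_mul_eq_zero (h x hx.2)⟩

theorem norm_unitSum_stdAddChar_le_gcd {m m' n' : ZMod q}
    (h : ∀ x : ZMod q, x * m' = 0 ∧ x * n' = 0 → x * m = 0) :
    ‖unitSum ZMod.stdAddChar m' n'‖ ≤
      Real.sqrt (1125 ^ q.primeFactors.card) * Real.sqrt q * Nat.gcd m.valMinAbs.natAbs q := by
  set g := Nat.gcd m.valMinAbs.natAbs q with hg
  have hg1 : (1 : ℝ) ≤ g := by
    exact_mod_cast Nat.gcd_pos_of_pos_right m.valMinAbs.natAbs (NeZero.pos q)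
  have h1 := SqrtCancel.zmod q _ (ZMod.isPrimitive_stdAddChar q) m' n'
  rw [ZMod.card] at h1
  have h2 : (annCount m' n' : ℝ) ≤ g := by exact_mod_cast annCount_le_gcd h
  refine abs_le_of_sq_le_sq' ?_ (by positivity) |>.2
  rw [mul_pow, mul_pow, Real.sq_sqrt (by positivity), Real.sq_sqrt (by positivity)]
  refine h1.trans ?_
  gcongr
  exact h2.trans (le_self_pow₀ hg1 two_ne_zero)

theorem sum_gcd_mul_div_le :
    ∑ m ∈ Finset.univ.erase (0 : ZMod q), (Nat.gcd m.valMinAbs.natAbs q : ℝ) *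
      (q / (2 * m.valMinAbs.natAbs)) ≤ q * (q.divisors.card * (1 + Real.log q)) := by
  have hmaps : ∀ m ∈ Finset.univ.erase (0 : ZMod q), m.valMinAbs.natAbs ∈ Finset.Icc 1 q := by
    intro m hm
    have h0 : m.valMinAbs ≠ 0 := fun h =>
      Finset.ne_of_mem_erase hm ((ZMod.valMinAbs_eq_zero m).1 h)
    have h1 := ZMod.natAbs_valMinAbs_le m
    rw [Finset.mem_Icc]
    omega
  rw [← Finset.sum_fiberwise_of_maps_to hmaps]
  refine le_trans ?_ (mul_le_mul_of_nonneg_left (sum_gcd_div_le (NeZero.ne q)) (Nat.cast_nonneg q))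
  rw [Finset.mul_sum]
  refine Finset.sum_le_sum fun j _ => ?_
  calc _ = ∑ m ∈ (Finset.univ.erase (0 : ZMod q)).filter (fun m => m.valMinAbs.natAbs = j),
        (Nat.gcd j q : ℝ) * (q / (2 * j)) :=
      Finset.sum_congr rfl fun m hm => by rw [(Finset.mem_filter.1 hm).2]
    _ ≤ 2 * ((Nat.gcd j q : ℝ) * (q / (2 * j))) := by
      rw [Finset.sum_const, nsmul_eq_mul]
      gcongr
      exact_mod_cast card_natAbs_valMinAbs_eq_le j _
    _ = _ := by
      rw [div_mul_eq_div_div]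
      ring

theorem freqSum_zero (I : Finset ℤ) : freqSum I (0 : ZMod q) = I.card := by
  simp [freqSum]

theorem unitSum_zero (ψ : AddChar (ZMod q) ℂ) : unitSum ψ 0 0 = q.totient := by
  simp [unitSum, ZMod.card_units_eq_totient]

theorem abs_card_sub_le {x y z w : ℤ} (hxy : x ≤ y) (hzw : z ≤ w) (l : (ZMod q)ˣ) :
    |(q : ℝ) ^ 2 * (((Finset.Ioc x y ×ˢ Finset.Ioc z w).filter
      fun ab : ℤ × ℤ => (ab.1 : ZMod q) ^ 2 * (ab.2 : ZMod q) ^ 3 = l).card : ℕ) -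
      (y - x) * (w - z) * q.totient| ≤
    Real.sqrt (1125 ^ q.primeFactors.card) * Real.sqrt q *
      ((y - x) * (q * (q.divisors.card * (1 + Real.log q))) +
        (w - z) * (q * (q.divisors.card * (1 + Real.log q))) +
        (q * (q.divisors.card * (1 + Real.log q))) ^ 2) := by
  have hcard {x y : ℤ} (h : x ≤ y) : ((Finset.Ioc x y).card : ℝ) = y - x := by
    have h1 : ((Finset.Ioc x y).card : ℤ) = y - x := by
      rw [Int.card_Ioc, Int.toNat_of_nonneg (by omega)]
    exact_mod_cast h1
  have hl (x : ZMod q) {n : ZMod q} {v : (ZMod q)ˣ} (h : x * (n * (v : ZMod q)) = 0) :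
      x * n = 0 := by
    rw [← mul_assoc] at h
    exact (Units.mul_left_eq_zero v).1 h
  have key := norm_sum_mul_mul_sub_le (o := (0 : ZMod q)) (F := freqSum (Finset.Ioc x y))
    (G := freqSum (Finset.Ioc z w))
    (U := fun m n => unitSum ZMod.stdAddChar (m * ((l⁻¹ : (ZMod q)ˣ) : ZMod q)) (n * (l : ZMod q)))
    (P := y - x) (Q := w - z) (σ := Real.sqrt (1125 ^ q.primeFactors.card) * Real.sqrt q)
    (g := fun m => (Nat.gcd m.valMinAbs.natAbs q : ℝ)) (w := fun m => q / (2 * m.valMinAbs.natAbs))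
    (by positivity) (by rw [freqSum_zero, Complex.norm_natCast, hcard hxy])
    (by rw [freqSum_zero, Complex.norm_natCast, hcard hzw])
    (fun m hm => norm_freqSum_Ioc_le hm hxy) (fun m hm => norm_freqSum_Ioc_le hm hzw)
    (fun m n _ => norm_unitSum_stdAddChar_le_gcd fun a h => hl a h.1)
    (fun m n _ => norm_unitSum_stdAddChar_le_gcd fun a h => hl a h.2)
    (fun m _ => by exact_mod_cast Nat.gcd_pos_of_pos_right m.valMinAbs.natAbs (NeZero.pos q))
    sum_gcd_mul_div_le
  rw [← sq_mul_card_eq_sum] at key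
  simp only [zero_mul, unitSum_zero, freqSum_zero] at key
  refine le_of_eq_of_le ?_ key
  rw [← hcard hxy, ← hcard hzw, ← Real.norm_eq_abs, ← Complex.norm_real]
  push_cast
  rfl

end Gcd

theorem NAB_eq_card_filter {q : ℕ} {l : ℤ} {v : (ZMod q)ˣ} (hv : (v : ZMod q) = l) (A B K L : ℝ) :
    NAB q l A B K L = ((Finset.Ioc ⌊A⌋ ⌊A + K⌋ ×ˢ Finset.Ioc ⌊B⌋ ⌊B + L⌋).filter
      fun ab : ℤ × ℤ => (ab.1 : ZMod q) ^ 2 * (ab.2 : ZMod q) ^ 3 = v).card := by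
  rw [NAB]
  refine Nat.subtype_card _ fun ab => ?_
  have h (a b : ℤ) : (a : ZMod q) ^ 2 * (b : ZMod q) ^ 3 = v ↔ (q : ℤ) ∣ a ^ 2 * b ^ 3 - l := by
    rw [hv, ← sub_eq_zero, ← ZMod.intCast_zmod_eq_zero_iff_dvd]
    push_cast
    rfl
  simp only [Finset.mem_filter, Finset.mem_product, Finset.mem_Ioc, Int.floor_lt, Int.le_floor, h]
  tauto

theorem abs_mul_sub_mul_le {M N K L : ℝ} (hK : 0 ≤ K) (hL : 0 ≤ L) (hM : |M - K| ≤ 1)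
    (hN : |N - L| ≤ 1) : |M * N - K * L| ≤ K + L + 1 := by
  calc |M * N - K * L| = |K * (N - L) + L * (M - K) + (M - K) * (N - L)| := by ring_nf
    _ ≤ |K * (N - L)| + |L * (M - K)| + |(M - K) * (N - L)| := abs_add_three _ _ _
    _ = K * |N - L| + L * |M - K| + |M - K| * |N - L| := by
      rw [abs_mul, abs_mul, abs_mul, abs_of_nonneg hK, abs_of_nonneg hL]
    _ ≤ K * 1 + L * 1 + 1 * 1 := by gcongr
    _ = _ := by ring

theorem abs_floor_sub_floor_sub_le (A K : ℝ) : |((⌊A + K⌋ : ℝ) - ⌊A⌋) - K| ≤ 1 := by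
  have h1 := Int.floor_le A
  have h2 := Int.lt_floor_add_one A
  have h3 := Int.floor_le (A + K)
  have h4 := Int.lt_floor_add_one (A + K)
  rw [abs_le]
  constructor <;> linarith

theorem abs_sub_main_term_le {s b Λ φ c M N K L : ℝ} (hs : 1 ≤ s) (hb : 1 ≤ b) (hΛ : 1 ≤ Λ)
    (hφ : 0 ≤ φ) (hφs : φ ≤ s ^ 2) (hK : 1 ≤ K) (hL : 1 ≤ L) (hM : |M - K| ≤ 1)
    (hN : |N - L| ≤ 1)
    (h : |(s ^ 2) ^ 2 * c - M * N * φ| ≤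
      b * s * (M * (s ^ 2 * Λ) + N * (s ^ 2 * Λ) + (s ^ 2 * Λ) ^ 2)) :
    |c - φ * K * L / (s ^ 2) ^ 2| ≤ 4 * (b * Λ ^ 2) * ((K + L) / s + s) := by
  have hs0 : 0 < s := by linarith
  have hMN : M + N ≤ 2 * (K + L) := by
    have := (abs_le.1 hM).2
    have := (abs_le.1 hN).2
    linarith
  have h1 : |φ * (M * N - K * L)| ≤ b * Λ ^ 2 * (s ^ 3 * (2 * (K + L))) := by
    rw [abs_mul, abs_of_nonneg hφ]
    calc φ * |M * N - K * L| ≤ s ^ 2 * (2 * (K + L)) := by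
          gcongr
          refine (abs_mul_sub_mul_le (by linarith) (by linarith) hM hN).trans ?_
          linarith
      _ ≤ s ^ 3 * (2 * (K + L)) := by
          gcongr
          norm_num
      _ ≤ _ := le_mul_of_one_le_left (by positivity)
          (one_le_mul_of_one_le_of_one_le hb (one_le_pow₀ hΛ))
  have h2 : |(s ^ 2) ^ 2 * c - M * N * φ| ≤
      b * Λ ^ 2 * (s ^ 3 * (2 * (K + L))) + b * Λ ^ 2 * s ^ 5 := by
    refine h.trans ?_
    calc b * s * (M * (s ^ 2 * Λ) + N * (s ^ 2 * Λ) + (s ^ 2 * Λ) ^ 2) =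
        b * Λ * (s ^ 3 * (M + N)) + b * Λ ^ 2 * s ^ 5 := by ring
      _ ≤ b * Λ ^ 2 * (s ^ 3 * (2 * (K + L))) + b * Λ ^ 2 * s ^ 5 := by
        have hM0 : 0 ≤ M + N := by
          have := (abs_le.1 hM).1
          have := (abs_le.1 hN).1
          linarith
        gcongr
        exact le_self_pow₀ hΛ two_ne_zero
  have h3 : c - φ * K * L / (s ^ 2) ^ 2 =
      (((s ^ 2) ^ 2 * c - M * N * φ) + φ * (M * N - K * L)) / (s ^ 2) ^ 2 := by
    field_simp
    ring
  rw [h3, abs_div, abs_of_pos (by positivity : 0 < (s ^ 2) ^ 2), div_le_iff₀ (by positivity)]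
  refine (abs_add_le _ _).trans ((add_le_add h2 h1).trans ?_)
  have h4 : 4 * (b * Λ ^ 2) * ((K + L) / s + s) * (s ^ 2) ^ 2 =
      4 * (b * Λ ^ 2 * (s ^ 3 * (K + L))) + 4 * (b * Λ ^ 2 * s ^ 5) := by
    field_simp
  rw [h4]
  have h5 : 0 ≤ b * Λ ^ 2 * s ^ 5 := by positivity
  linarith

end

theorem points_in_box : ∀ ε : ℝ, 0 < ε → ∃ C : ℝ, 0 < C ∧
    ∀ (q : ℕ) (l : ℤ) (A B K L : ℝ), 0 < q → Int.gcd l q = 1 → 1 ≤ K → 1 ≤ L →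
      |(NAB q l A B K L : ℝ) - (Nat.totient q : ℝ) * K * L / q ^ 2| ≤
        C * ((K + L) / (q : ℝ) ^ ((1 : ℝ) / 2 - ε) + (q : ℝ) ^ ((1 : ℝ) / 2 + ε)) := by
  intro ε hε
  obtain ⟨c, hc, hloss⟩ := exists_loss_le hε
  refine ⟨4 * c, by positivity, ?_⟩
  intro q l A B K L hq hl hK hL
  have : NeZero q := ⟨hq.ne'⟩
  have hunit : IsUnit (l : ZMod q) :=
    (ZMod.coe_int_isUnit_iff_isCoprime l q).2 (Int.isCoprime_iff_gcd_eq_one.2 hl).symm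
  obtain ⟨v, hv⟩ := hunit
  have hq1 : (1 : ℝ) ≤ q := by exact_mod_cast hq
  have hq0 : (0 : ℝ) < q := by exact_mod_cast hq
  have hsq : Real.sqrt q ^ 2 = q := Real.sq_sqrt hq0.le
  have hx : ⌊A⌋ ≤ ⌊A + K⌋ := Int.floor_mono (by linarith)
  have hy : ⌊B⌋ ≤ ⌊B + L⌋ := Int.floor_mono (by linarith)
  have h := abs_card_sub_le hx hy v
  rw [← NAB_eq_card_filter hv] at h
  have hφ : (q.totient : ℝ) ≤ Real.sqrt q ^ 2 := by
    rw [hsq]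
    exact_mod_cast Nat.totient_le q
  have hb : 1 ≤ Real.sqrt (1125 ^ q.primeFactors.card) :=
    Real.one_le_sqrt.2 (one_le_pow₀ (by norm_num))
  have hΛ : 1 ≤ (q.divisors.card : ℝ) * (1 + Real.log q) := by
    refine one_le_mul_of_one_le_of_one_le ?_ ?_
    · exact_mod_cast Finset.card_pos.2 ⟨1, Nat.one_mem_divisors.2 hq.ne'⟩
    · linarith [Real.log_nonneg hq1]
  have hmain := abs_sub_main_term_le (s := Real.sqrt q) (Real.one_le_sqrt.2 hq1) hb hΛ
    (Nat.cast_nonneg q.totient) hφ hK hL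
    (abs_floor_sub_floor_sub_le A K) (abs_floor_sub_floor_sub_le B L) (c := NAB q l A B K L)
    (by rw [hsq]; exact h)
  rw [hsq] at hmain
  refine hmain.trans ?_
  have hε0 : (0 : ℝ) < (q : ℝ) ^ ε := Real.rpow_pos_of_pos hq0 ε
  have hs0 : 0 < Real.sqrt q := Real.sqrt_pos.2 hq0
  rw [Real.rpow_sub hq0, Real.rpow_add hq0, ← Real.sqrt_eq_rpow]
  calc _ ≤ 4 * (c * (q : ℝ) ^ ε) * ((K + L) / Real.sqrt q + Real.sqrt q) :=
        mul_le_mul_of_nonneg_right (mul_le_mul_of_nonneg_left (hloss q hq.ne') (by norm_num))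
          (by positivity)
    _ = _ := by
        field_simp
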